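/- arXiv:2101.03145 — 3 statements merged into one kernel-verified Lean document; each statement's English description precedes it below -/
import Mathlib

section
/- Let F be a number field with odd class number h(F) and unit group E_F, and let k/F be a quadratic extension in which exactly two prime ideals 𝔭₁ and 𝔭₂ of odd norm ramify (and which is unramified at all primes above 2 and at all infinite places). Suppose 𝔭₁ and 𝔭₂ are primary, write 𝔭₁^{h(F)} = (π₁) with π₁ primary, and suppose (𝔭₁/𝔭₂) := [π₁/𝔭₂] = −1. Then the class number h of k satisfies h ≡ 2 (mod 4), and every unit of F is the relative norm of a unit of k, i.e. E_F = N_{k/F}E_k. -/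
open NumberField
open scoped Classical

/-- The quadratic residue symbol `[α/𝔭] ∈ {±1}`, determined by Euler's congruence
`[α/𝔭] ≡ α^((N𝔭 - 1)/2) (mod 𝔭)`. -/
noncomputable def quadResSym (F : Type*) [Field F] [NumberField F]
    (𝔭 : Ideal (𝓞 F)) (α : 𝓞 F) : ℤ :=
  if α ^ ((Ideal.absNorm 𝔭 - 1) / 2) - 1 ∈ 𝔭 then 1 else -1

/-- An ideal `𝔭` is primary if `[ε/𝔭] = 1` for every unit `ε`, i.e. `(E_F/𝔭) = +1`. -/
def IsPrimaryIdeal (F : Type*) [Field F] [NumberField F] (𝔭 : Ideal (𝓞 F)) : Prop :=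
  ∀ ε : (𝓞 F)ˣ, quadResSym F 𝔭 (ε : 𝓞 F) = 1

/-- An element of the ring of integers is primary if it is totally positive and
congruent to a square modulo 4. -/
def IsPrimaryElem (F : Type*) [Field F] [NumberField F] (α : 𝓞 F) : Prop :=
  (∀ φ : F →+* ℝ, 0 < φ (algebraMap (𝓞 F) F α)) ∧ ∃ ξ : 𝓞 F, (4 : 𝓞 F) ∣ α - ξ ^ 2

/-- A prime ideal `𝔭` of `F` is ramified in `K` if some prime of `K` appears at least
twice in the factorization of `𝔭 O_K`. -/
def IsRamifiedIn (F K : Type*) [Field F] [NumberField F] [Field K] [NumberField K]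
    [Algebra F K] (𝔭 : Ideal (𝓞 F)) : Prop :=
  ∃ 𝔓 : Ideal (𝓞 K), 𝔓.IsPrime ∧ 𝔓 ^ 2 ∣ Ideal.map (algebraMap (𝓞 F) (𝓞 K)) 𝔭

/-- `K/F` is unramified at all infinite places: every real embedding of `F`
extends to a real embedding of `K`. -/
def UnramifiedAtInfinitePlaces (F K : Type*) [Field F] [Field K] [Algebra F K] : Prop :=
  ∀ φ : F →+* ℝ, ∃ ψ : K →+* ℝ, ψ.comp (algebraMap F K) = φ

/-- The subgroup `N_{K/F} E_K` of norms of units, inside the unit group `E_F`. -/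
noncomputable def relUnitNormRange (F K : Type*) [Field F] [NumberField F] [Field K]
    [NumberField K] [Algebra F K] : Subgroup (𝓞 F)ˣ :=
  (Units.map (RingOfIntegers.norm F : 𝓞 K →* 𝓞 F)).range


namespace Scholz

set_option linter.unusedSectionVars false
set_option linter.unusedVariables false

variable {A B : Type*} [CommRing A] [IsDedekindDomain A] [CommRing B] [IsDedekindDomain B]
  [Algebra A B]

structure Setup (s : B ≃ₐ[A] B) (P₁ P₂ : Ideal B) (h : ℕ) (π : A) : Prop where
  inj : Function.Injective (algebraMap A B)
  inv : ∀ x, s (s x) = x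
  fix : ∀ x, s x = x → ∃ a, algebraMap A B a = x
  prime1 : P₁.IsPrime
  prime2 : P₂.IsPrime
  bot1 : P₁ ≠ ⊥
  bot2 : P₂ ≠ ⊥
  ne : P₁ ≠ P₂
  hodd : Odd h
  princ : ∀ 𝔞 : Ideal A, ∃ c, 𝔞 ^ h = Ideal.span {c}
  ram1 : ∃ p : Ideal A, p.map (algebraMap A B) = P₁ ^ 2
  ram2 : ∃ p : Ideal A, p.map (algebraMap A B) = P₂ ^ 2
  gen1 : P₁ ^ (2 * h) = Ideal.span {algebraMap A B π}
  unr : ∀ P : Ideal B, P.IsPrime → P ≠ ⊥ → P ≠ P₁ → P ≠ P₂ →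
    Squarefree ((P.comap (algebraMap A B)).map (algebraMap A B))
  res1 : ∀ b : B, ∃ a : A, b - algebraMap A B a ∈ P₁
  res2 : ∀ b : B, ∃ a : A, b - algebraMap A B a ∈ P₂
  two1 : (2 : B) ∉ P₁
  two2 : (2 : B) ∉ P₂
  nt : ∃ x, s x ≠ x
  nr : ∀ (γ : B) (ε : Aˣ) (n : A) (m : ℕ), Odd m → γ ∉ P₂ →
    γ * s γ = algebraMap A B (ε * n ^ 2 * π ^ m) → False

variable {s : B ≃ₐ[A] B} {P₁ P₂ : Ideal B} {h : ℕ} {π : A}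

theorem dvd_prime_eq {P Q : Ideal B} (hP : P.IsPrime) (hQ : Q.IsPrime) (hP0 : P ≠ ⊥)
    (hQ0 : Q ≠ ⊥) (hd : P ∣ Q) : P = Q := by
  have := hQ.isMaximal hQ0
  exact (this.eq_of_le hP.ne_top (Ideal.dvd_iff_le.mp hd)).symm

theorem Setup.map_map (S : Setup s P₁ P₂ h π) (J : Ideal B) : (J.map s).map s = J := by
  have : ∀ J : Ideal B, (J.map s).map s ≤ J := by
    intro J
    rw [Ideal.map_le_iff_le_comap, Ideal.map_le_iff_le_comap]
    intro x hx
    simpa [Ideal.mem_comap, S.inv] using hx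
  apply le_antisymm (this J)
  intro x hx
  have := Ideal.mem_map_of_mem s (Ideal.mem_map_of_mem s hx)
  rwa [S.inv] at this

theorem map_alg (I : Ideal A) : (I.map (algebraMap A B)).map s = I.map (algebraMap A B) := by
  have : ((s : B ≃+* B) : B →+* B).comp (algebraMap A B) = algebraMap A B := by
    ext x; simp
  have h2 := Ideal.map_map (I := I) (algebraMap A B) ((s : B ≃+* B) : B →+* B)
  rw [this] at h2
  exact h2

theorem Setup.mem_map (S : Setup s P₁ P₂ h π) (J : Ideal B) (x : B) : x ∈ J.map s ↔ s x ∈ J := by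
  constructor
  · intro hx
    have := Ideal.mem_map_of_mem s hx
    rwa [S.map_map] at this
  · intro hx
    have := Ideal.mem_map_of_mem s hx
    rwa [S.inv] at this

theorem Setup.prime_map (S : Setup s P₁ P₂ h π) {J : Ideal B} (hJ : J.IsPrime) :
    (J.map s).IsPrime := by
  have := Ideal.map_isPrime_of_equiv s (I := J)
  exact this

theorem Setup.map_ne_bot (S : Setup s P₁ P₂ h π) {J : Ideal B} (hJ : J ≠ ⊥) :
    (J.map s) ≠ ⊥ := by
  intro h0
  apply hJ
  rw [← S.map_map J, h0, Ideal.map_bot]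

theorem Setup.trans (S : Setup s P₁ P₂ h π) {P Q : Ideal B} (hP : P.IsPrime) (hQ : Q.IsPrime)
    (hP0 : P ≠ ⊥) (hQ0 : Q ≠ ⊥)
    (hc : Q.comap (algebraMap A B) = P.comap (algebraMap A B)) : Q = P ∨ Q = P.map s := by
  have h1 : (Q : Set B) ⊆ (P : Set B) ∪ (P.map s : Ideal B) := by
    intro x hx
    obtain ⟨a, ha⟩ := S.fix (x * s x) (by simp [S.inv, mul_comm])
    have : a ∈ Q.comap (algebraMap A B) := by
      rw [Ideal.mem_comap, ha]; exact Q.mul_mem_right _ hx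
    rw [hc, Ideal.mem_comap, ha] at this
    rcases hP.mem_or_mem this with h | h
    · left; exact h
    · right; exact (S.mem_map _ _).2 h
  rw [Ideal.subset_union] at h1
  have hQm := hQ.isMaximal hQ0
  rcases h1 with h | h
  · left; exact hQm.eq_of_le hP.ne_top h
  · right; exact hQm.eq_of_le (S.prime_map hP).ne_top h

theorem Setup.unr_dvd (S : Setup s P₁ P₂ h π) {P J : Ideal B} (hP : P.IsPrime) (hP0 : P ≠ ⊥)
    (hsq : Squarefree ((P.comap (algebraMap A B)).map (algebraMap A B)))
    (hJ : J.map s = J) (hPJ : P ∣ J) :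
    (P.comap (algebraMap A B)).map (algebraMap A B) ∣ J := by
  set I := (P.comap (algebraMap A B)).map (algebraMap A B) with hI
  by_cases hJ0 : J = 0
  · rw [hJ0]; exact dvd_zero _
  have hI0 : I ≠ 0 := hsq.ne_zero
  rw [UniqueFactorizationMonoid.dvd_iff_normalizedFactors_le_normalizedFactors hI0 hJ0]
  have hnd := (UniqueFactorizationMonoid.squarefree_iff_nodup_normalizedFactors hI0).1 hsq
  rw [Multiset.le_iff_subset hnd]
  intro Q hQ
  have hQp := UniqueFactorizationMonoid.prime_of_normalized_factor Q hQ
  have hQI := UniqueFactorizationMonoid.dvd_of_mem_normalizedFactors hQ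
  have hQ' : Q.IsPrime := Ideal.isPrime_of_prime hQp
  have hQ0 : Q ≠ ⊥ := hQp.ne_zero
  have hpm : (P.comap (algebraMap A B)).IsMaximal := by
    have : (P.comap (algebraMap A B)).IsPrime := hP.comap _
    refine this.isMaximal ?_
    intro h0
    apply hI0
    rw [hI, h0, Ideal.map_bot]; rfl
  have hc : Q.comap (algebraMap A B) = P.comap (algebraMap A B) := by
    refine (hpm.eq_of_le (hQ'.comap _).ne_top ?_).symm
    rw [← Ideal.map_le_iff_le_comap]
    exact Ideal.dvd_iff_le.mp hQI
  rw [Ideal.mem_normalizedFactors_iff hJ0]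
  refine ⟨hQ', ?_⟩
  have hle := Ideal.dvd_iff_le.mp hPJ
  rcases S.trans hP hQ' hP0 hQ0 hc with h | h
  · rw [h]; exact hle
  · rw [h, ← hJ]; exact Ideal.map_mono hle

theorem Setup.smap1 (S : Setup s P₁ P₂ h π) : P₁.map s = P₁ := by
  obtain ⟨p, hp⟩ := S.ram1
  have h1 := map_alg (s := s) p
  rw [hp, Ideal.map_pow] at h1
  have : P₁.map s ∣ P₁ ^ 2 := by rw [← h1]; exact dvd_pow_self _ two_ne_zero
  have hp' : Prime (P₁.map s) := Ideal.prime_of_isPrime (S.map_ne_bot S.bot1) (S.prime_map S.prime1)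
  exact dvd_prime_eq (S.prime_map S.prime1) S.prime1 (S.map_ne_bot S.bot1) S.bot1
    (hp'.dvd_of_dvd_pow this)

theorem Setup.smap2 (S : Setup s P₁ P₂ h π) : P₂.map s = P₂ := by
  obtain ⟨p, hp⟩ := S.ram2
  have h1 := map_alg (s := s) p
  rw [hp, Ideal.map_pow] at h1
  have : P₂.map s ∣ P₂ ^ 2 := by rw [← h1]; exact dvd_pow_self _ two_ne_zero
  have hp' : Prime (P₂.map s) := Ideal.prime_of_isPrime (S.map_ne_bot S.bot2) (S.prime_map S.prime2)
  exact dvd_prime_eq (S.prime_map S.prime2) S.prime2 (S.map_ne_bot S.bot2) S.bot2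
    (hp'.dvd_of_dvd_pow this)

/-- ambiguous ideals, first form -/
theorem Setup.amb0 (S : Setup s P₁ P₂ h π) (J : Ideal B) : J ≠ 0 → J.map s = J →
    ∃ a b : ℕ, ∃ 𝔞 : Ideal A, J = P₁ ^ a * P₂ ^ b * 𝔞.map (algebraMap A B) := by
  refine WellFounded.induction (C := fun J : Ideal B => J ≠ 0 → J.map s = J →
    ∃ a b : ℕ, ∃ 𝔞 : Ideal A, J = P₁ ^ a * P₂ ^ b * 𝔞.map (algebraMap A B))
    (wellFounded_dvdNotUnit (α := Ideal B)) J ?_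
  intro J ih hJ0 hJ
  by_cases hu : IsUnit J
  · refine ⟨0, 0, ⊤, ?_⟩
    rw [Ideal.map_top]
    simpa using hu
  · obtain ⟨P, hPm, hPJ⟩ := Ideal.exists_le_maximal J (by rwa [Ideal.isUnit_iff] at hu)
    have hPd : P ∣ J := Ideal.dvd_iff_le.mpr hPJ
    have hP := hPm.isPrime
    have hP0 : P ≠ ⊥ := by
      rintro rfl
      exact hJ0 (le_bot_iff.1 hPJ)
    have key : ∃ I : Ideal B, I ∣ J ∧ ¬ IsUnit I ∧ I.map s = I ∧
        (I = P₁ ∨ I = P₂ ∨ ∃ 𝔟 : Ideal A, I = 𝔟.map (algebraMap A B)) := by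
      by_cases h1 : P = P₁
      · exact ⟨P, hPd, by rw [Ideal.isUnit_iff]; exact hP.ne_top, by rw [h1, S.smap1], Or.inl h1⟩
      by_cases h2 : P = P₂
      · exact ⟨P, hPd, by rw [Ideal.isUnit_iff]; exact hP.ne_top, by rw [h2, S.smap2],
          Or.inr (Or.inl h2)⟩
      refine ⟨_, S.unr_dvd hP hP0 (S.unr P hP hP0 h1 h2) hJ hPd, ?_, map_alg _,
        Or.inr (Or.inr ⟨_, rfl⟩)⟩
      rw [Ideal.isUnit_iff]
      intro ht
      apply hP.ne_top
      rw [eq_top_iff, ← ht]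
      exact Ideal.map_comap_le
    obtain ⟨I, ⟨J', rfl⟩, hIu, hIs, hI⟩ := key
    have hI0 : I ≠ 0 := left_ne_zero_of_mul hJ0
    have hJ'0 : J' ≠ 0 := right_ne_zero_of_mul hJ0
    have hJ's : J'.map s = J' := by
      rw [Ideal.map_mul, hIs] at hJ
      exact mul_left_cancel₀ hI0 hJ
    obtain ⟨a, b, 𝔞, e⟩ := ih J' ⟨hJ'0, I, hIu, mul_comm _ _⟩ hJ'0 hJ's
    rcases hI with rfl | rfl | ⟨𝔟, rfl⟩
    · exact ⟨a + 1, b, 𝔞, by rw [e]; ring⟩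
    · exact ⟨a, b + 1, 𝔞, by rw [e]; ring⟩
    · exact ⟨a, b, 𝔟 * 𝔞, by rw [e, Ideal.map_mul]; ring⟩

theorem red_pow {P : Ideal B} (hr : ∃ p : Ideal A, p.map (algebraMap A B) = P ^ 2) (a : ℕ) :
    ∃ (a' : ℕ) (𝔟 : Ideal A), (a' = 0 ∨ a' = 1) ∧ P ^ a = P ^ a' * 𝔟.map (algebraMap A B) := by
  obtain ⟨p, hp⟩ := hr
  refine ⟨a % 2, p ^ (a / 2), Nat.mod_two_eq_zero_or_one a, ?_⟩
  rw [Ideal.map_pow, hp, ← pow_mul, ← pow_add, Nat.mod_add_div]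

theorem Setup.amb (S : Setup s P₁ P₂ h π) (J : Ideal B) (hJ0 : J ≠ 0) (hJ : J.map s = J) :
    ∃ a b : ℕ, ∃ 𝔞 : Ideal A, (a = 0 ∨ a = 1) ∧ (b = 0 ∨ b = 1) ∧
      J = P₁ ^ a * P₂ ^ b * 𝔞.map (algebraMap A B) := by
  obtain ⟨a, b, 𝔞, e⟩ := S.amb0 J hJ0 hJ
  obtain ⟨a', 𝔟, ha', e1⟩ := red_pow S.ram1 a
  obtain ⟨b', 𝔠, hb', e2⟩ := red_pow S.ram2 b
  refine ⟨a', b', 𝔟 * 𝔠 * 𝔞, ha', hb', ?_⟩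
  rw [e, e1, e2, Ideal.map_mul, Ideal.map_mul]
  ring

/-- raise to the `h` -/
theorem Setup.ambh (S : Setup s P₁ P₂ h π) (J : Ideal B) (hJ0 : J ≠ 0) (hJ : J.map s = J) :
    ∃ a b : ℕ, ∃ c : A, (a = 0 ∨ a = 1) ∧ (b = 0 ∨ b = 1) ∧ algebraMap A B c ≠ 0 ∧
      J ^ h = (P₁ ^ h) ^ a * (P₂ ^ h) ^ b * Ideal.span {algebraMap A B c} := by
  obtain ⟨a, b, 𝔞, ha, hb, e⟩ := S.amb J hJ0 hJ
  obtain ⟨c, hc⟩ := S.princ 𝔞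
  have e2 : J ^ h = (P₁ ^ h) ^ a * (P₂ ^ h) ^ b * Ideal.span {algebraMap A B c} := by
    rw [e, mul_pow, mul_pow, ← Ideal.map_pow, hc, Ideal.map_span, Set.image_singleton,
      ← pow_mul, ← pow_mul, ← pow_mul, ← pow_mul, mul_comm a, mul_comm b]
  refine ⟨a, b, c, ha, hb, ?_, e2⟩
  intro h0
  rw [h0] at e2
  have : J ^ h ≠ 0 := pow_ne_zero _ hJ0
  apply this
  rw [e2]
  simp

theorem Setup.fix_gen (S : Setup s P₁ P₂ h π) {a : A} {y : B} (ha : algebraMap A B a ≠ 0)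
    (hy : s y = y) (e : Ideal.span {y} = Ideal.span {algebraMap A B a}) :
    ∃ ε : Aˣ, y = algebraMap A B (ε * a) := by
  rw [Ideal.span_singleton_eq_span_singleton] at e
  obtain ⟨u, hu⟩ := e.symm
  have h1 : s u = u := by
    have := congrArg s hu
    rw [map_mul, hy, AlgEquiv.commutes, ← hu] at this
    exact mul_left_cancel₀ ha this
  have h2 : s (u⁻¹ : Bˣ) = (u⁻¹ : Bˣ) := by
    have : (u : B) * s (u⁻¹ : Bˣ) = u * (u⁻¹ : Bˣ) := by
      conv_lhs => rw [← h1]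
      rw [← map_mul, Units.mul_inv, map_one]
    exact mul_left_cancel₀ u.ne_zero this
  obtain ⟨v, hv⟩ := S.fix _ h1
  obtain ⟨w, hw⟩ := S.fix _ h2
  have hvw : v * w = 1 := by
    apply S.inj
    rw [map_mul, hv, hw, Units.mul_inv, map_one]
  refine ⟨⟨v, w, hvw, by rw [mul_comm, hvw]⟩, ?_⟩
  rw [← hu, map_mul, hv, mul_comm]

theorem Setup.span_s (S : Setup s P₁ P₂ h π) (x : B) :
    (Ideal.span {x}).map s = Ideal.span {s x} := by
  rw [Ideal.map_span, Set.image_singleton]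

theorem Setup.pi_ne (S : Setup s P₁ P₂ h π) : algebraMap A B π ≠ 0 := by
  intro h0
  have := S.gen1
  rw [h0] at this
  have h2 : P₁ ^ (2 * h) ≠ 0 := pow_ne_zero _ S.bot1
  apply h2
  rw [this]; simp

theorem Setup.p1 (S : Setup s P₁ P₂ h π) : Prime P₁ := Ideal.prime_of_isPrime S.bot1 S.prime1
theorem Setup.p2 (S : Setup s P₁ P₂ h π) : Prime P₂ := Ideal.prime_of_isPrime S.bot2 S.prime2

theorem Setup.ndvd21 (S : Setup s P₁ P₂ h π) (n : ℕ) : ¬ P₂ ∣ P₁ ^ n := fun hd =>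
  S.ne (dvd_prime_eq S.prime2 S.prime1 S.bot2 S.bot1 (S.p2.dvd_of_dvd_pow hd)).symm
theorem Setup.ndvd12 (S : Setup s P₁ P₂ h π) (n : ℕ) : ¬ P₁ ∣ P₂ ^ n := fun hd =>
  S.ne (dvd_prime_eq S.prime1 S.prime2 S.bot1 S.bot2 (S.p1.dvd_of_dvd_pow hd))

theorem Setup.nonprin1 (S : Setup s P₁ P₂ h π) (γ : B) : P₁ ^ h ≠ Ideal.span {γ} := by
  intro e
  have hγ : γ ∉ P₂ := by
    intro hm
    apply S.ndvd21 h
    rw [e, Ideal.dvd_span_singleton]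
    exact hm
  have h1 : Ideal.span {γ * s γ} = Ideal.span {algebraMap A B π} := by
    rw [← Ideal.span_singleton_mul_span_singleton, ← S.span_s, ← e, Ideal.map_pow, S.smap1,
      ← S.gen1]
    ring
  obtain ⟨ε, hε⟩ := S.fix_gen S.pi_ne (by simp [S.inv, mul_comm]) h1
  exact S.nr γ ε 1 1 odd_one hγ (by simpa using hε)

/-- cancel a generator -/
theorem cancel_span {I : Ideal B} {c x : B} (hc : c ≠ 0) (e : Ideal.span {x} = I * Ideal.span {c}) :
    ∃ y, I = Ideal.span {y} ∧ x = y * c := by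
  have : c ∣ x := by
    rw [← Ideal.mem_span_singleton, ← Ideal.span_singleton_le_iff_mem, e]
    intro z hz
    exact (Ideal.mul_le.2 fun r _ q hq => Ideal.mul_mem_left _ r hq) hz
  obtain ⟨y, rfl⟩ := this
  refine ⟨y, ?_, mul_comm _ _⟩
  rw [mul_comm, ← Ideal.span_singleton_mul_span_singleton] at e
  exact (mul_right_cancel₀ (by simpa using hc) e).symm

theorem Setup.anti (S : Setup s P₁ P₂ h π) {P : Ideal B} (hP : P.IsPrime)
    (res : ∀ b : B, ∃ a : A, b - algebraMap A B a ∈ P) (h2 : (2 : B) ∉ P) (hs : P.map s = P)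
    {y : B} (hy : s y = - y) : y ∈ P := by
  obtain ⟨a, ha⟩ := res y
  have h1 : s (y - algebraMap A B a) ∈ P := by
    rw [← S.mem_map, hs]; exact ha
  rw [map_sub, hy, AlgEquiv.commutes] at h1
  have h3 := P.sub_mem ha h1
  have h4 : 2 * y ∈ P := by convert h3 using 1; ring
  exact (hP.mem_or_mem h4).resolve_left h2

theorem Setup.delta0 (S : Setup s P₁ P₂ h π) : ∃ δ : B, δ ≠ 0 ∧ s δ = - δ := by
  obtain ⟨x, hx⟩ := S.nt
  exact ⟨s x - x, sub_ne_zero.2 hx, by rw [map_sub, S.inv]; ring⟩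

theorem Setup.delta (S : Setup s P₁ P₂ h π) : ∃ (δ : B) (c : A), δ ≠ 0 ∧ s δ = - δ ∧
    algebraMap A B c ≠ 0 ∧ Ideal.span {δ} = P₁ ^ h * P₂ ^ h * Ideal.span {algebraMap A B c} := by
  obtain ⟨δ, h0, hδ⟩ := S.delta0
  have hδh : s (δ ^ h) = - δ ^ h := by rw [map_pow, hδ, S.hodd.neg_pow]
  obtain ⟨a, b, c, ha, hb, hc, e⟩ := S.ambh (Ideal.span {δ}) (by simpa using h0)
    (by rw [S.span_s, hδ, Ideal.span_singleton_neg])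
  rw [Ideal.span_singleton_pow] at e
  obtain ⟨y, hy, hyc⟩ := cancel_span hc e
  have hsy : s y = - y := by
    rw [hyc, map_mul, AlgEquiv.commutes, ← neg_mul] at hδh
    exact mul_right_cancel₀ hc hδh
  have m1 := S.anti S.prime1 S.res1 S.two1 S.smap1 hsy
  have m2 := S.anti S.prime2 S.res2 S.two2 S.smap2 hsy
  rw [← Ideal.dvd_span_singleton, ← hy] at m1 m2
  rcases ha with rfl | rfl
  · exfalso
    rw [pow_zero, one_mul, ← pow_mul] at m1
    exact S.ndvd12 _ m1
  rcases hb with rfl | rfl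
  · exfalso
    rw [pow_zero, mul_one, ← pow_mul] at m2
    exact S.ndvd21 _ m2
  exact ⟨δ ^ h, c, pow_ne_zero _ h0, hδh, hc, by rw [e]; simp⟩

theorem Setup.nonprin2 (S : Setup s P₁ P₂ h π) (γ : B) : P₂ ^ h ≠ Ideal.span {γ} := by
  intro e
  obtain ⟨δ, c, h0, hδ, hc, hd⟩ := S.delta
  have hγ : γ ≠ 0 := by
    rintro rfl
    have : P₂ ^ h ≠ 0 := pow_ne_zero _ S.bot2
    apply this; rw [e]; simp
  rw [e, mul_assoc, Ideal.span_singleton_mul_span_singleton] at hd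
  obtain ⟨y, hy, -⟩ := cancel_span (mul_ne_zero hγ hc) hd
  exact S.nonprin1 y hy

theorem Setup.h90 (S : Setup s P₁ P₂ h π) {β n : B} (hn0 : n ≠ 0) (hn : s n = n)
    (e : β * s β = n * n) : ∃ α : B, α ≠ 0 ∧ β * s α = n * α := by
  by_cases h0 : n + β = 0
  · obtain ⟨δ, hδ0, hδ⟩ := S.delta0
    refine ⟨δ, hδ0, ?_⟩
    rw [hδ, eq_neg_of_add_eq_zero_right h0]; ring
  · refine ⟨n + β, h0, ?_⟩
    rw [map_add, hn]
    linear_combination e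


/-- the action on units -/
def sU (s : B ≃ₐ[A] B) : Bˣ →* Bˣ := Units.map (s : B →* B)

theorem sU_coe (e : Bˣ) : ((sU s e : Bˣ) : B) = s e := rfl

theorem odd_red {M : Type*} [CommGroup M] (S : Subgroup M) {e : M} (hh : Odd h) (h2 : e ^ 2 ∈ S)
    (he : e ^ h ∈ S) : e ∈ S := by
  obtain ⟨t, rfl⟩ := hh
  rw [pow_succ, pow_mul] at he
  exact (S.mul_mem_cancel_left (S.pow_mem h2 t)).1 he

theorem Setup.H1 (S : Setup s P₁ P₂ h π) (e : Bˣ) (he : e * sU s e = 1) :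
    e ∈ (MonoidHom.id Bˣ / sU s).range ∨ -e ∈ (MonoidHom.id Bˣ / sU s).range := by
  have key : ∀ f : Bˣ, (∃ u : Bˣ, (f : B) * s u = u) → f ∈ (MonoidHom.id Bˣ / sU s).range := by
    rintro f ⟨u, hu⟩
    refine ⟨u, ?_⟩
    rw [MonoidHom.div_apply, MonoidHom.id_apply, div_eq_iff_eq_mul]
    ext
    rw [Units.val_mul, sU_coe, hu]
  have he1 : (e : B) * s e = 1 := by
    have := congrArg Units.val he
    simpa [sU_coe] using this
  have h2 : e ^ 2 ∈ (MonoidHom.id Bˣ / sU s).range := by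
    apply key
    refine ⟨e, ?_⟩
    push_cast
    linear_combination (e : B) * he1
  have h2' : (-e) ^ 2 ∈ (MonoidHom.id Bˣ / sU s).range := by rwa [neg_sq]
  obtain ⟨α, hα0, hα⟩ := S.h90 (β := e) (n := 1) one_ne_zero (map_one s) (by rw [he1, mul_one])
  rw [one_mul] at hα
  have hαh : (e : B) ^ h * s (α ^ h) = α ^ h := by
    rw [map_pow, ← mul_pow, hα]
  have hst : (Ideal.span {α}).map s = Ideal.span {α} := by
    rw [S.span_s, Ideal.span_singleton_eq_span_singleton]
    exact ⟨e, by rw [mul_comm, hα]⟩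
  obtain ⟨a, b, c, ha, hb, hc, ec⟩ := S.ambh (Ideal.span {α}) (by simpa using hα0) hst
  rw [Ideal.span_singleton_pow] at ec
  obtain ⟨y, hy, hyc⟩ := cancel_span hc ec
  have hysy : (e : B) ^ h * s y = y := by
    rw [hyc, map_mul, AlgEquiv.commutes, ← mul_assoc] at hαh
    exact mul_right_cancel₀ hc hαh
  have hy0 : y ≠ 0 := by
    rintro rfl
    apply pow_ne_zero h hα0
    rw [hyc, zero_mul]
  rcases ha with rfl | rfl <;> rcases hb with rfl | rfl
  · left
    refine odd_red _ S.hodd h2 (key _ ?_)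
    have : IsUnit y := by
      rw [← Ideal.span_singleton_eq_top, ← hy]; simp
    obtain ⟨u, rfl⟩ := this
    exact ⟨u, by push_cast; exact hysy⟩
  · exfalso
    exact S.nonprin2 y (by simpa using hy)
  · exfalso
    exact S.nonprin1 y (by simpa using hy)
  · right
    refine odd_red _ S.hodd h2' (key _ ?_)
    obtain ⟨δ, c', h0, hδ, hc', hd⟩ := S.delta
    rw [pow_one, pow_one] at hy
    rw [hy, Ideal.span_singleton_mul_span_singleton, Ideal.span_singleton_eq_span_singleton] at hd
    obtain ⟨u, hu⟩ := hd
    refine ⟨u, ?_⟩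
    have hsu := congrArg s hu
    rw [map_mul, map_mul, hδ, AlgEquiv.commutes] at hsu
    have hkey : (δ * u) * (((-e) ^ h : Bˣ) : B) * s u = (δ * u) * u := by
      rw [Units.val_pow_eq_pow_val, Units.val_neg, S.hodd.neg_pow]
      linear_combination (u : B) * (e : B) ^ h * hsu + (u : B) * algebraMap A B c' * hysy - u * hu
    rw [mul_assoc] at hkey
    exact mul_left_cancel₀ (mul_ne_zero h0 u.ne_zero) hkey

theorem Setup.normI (S : Setup s P₁ P₂ h π) (J : Ideal B) :
    ∃ 𝔫 : Ideal A, J * J.map s = 𝔫.map (algebraMap A B) := by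
  induction J using UniqueFactorizationMonoid.induction_on_prime with
  | h₁ => exact ⟨⊥, by rw [Ideal.map_bot]; simp⟩
  | h₂ I hI =>
    rw [Ideal.isUnit_iff] at hI
    exact ⟨⊤, by rw [hI, Ideal.map_top, Ideal.map_top]; simp⟩
  | h₃ I P hI0 hPp ih =>
    obtain ⟨𝔫, hn⟩ := ih
    have hP0 : P ≠ ⊥ := hPp.ne_zero
    have hP : P.IsPrime := Ideal.isPrime_of_prime hPp
    have : ∃ 𝔪 : Ideal A, P * P.map s = 𝔪.map (algebraMap A B) := by
      by_cases h1 : P = P₁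
      · rw [h1, S.smap1, ← pow_two]
        obtain ⟨p, hp⟩ := S.ram1
        exact ⟨p, hp.symm⟩
      by_cases h2 : P = P₂
      · rw [h2, S.smap2, ← pow_two]
        obtain ⟨p, hp⟩ := S.ram2
        exact ⟨p, hp.symm⟩
      have hd := S.unr_dvd (J := P * P.map s) hP hP0 (S.unr P hP hP0 h1 h2)
        (by rw [Ideal.map_mul, S.map_map, mul_comm]) (dvd_mul_right _ _)
      have hd2 : P ∣ (P.comap (algebraMap A B)).map (algebraMap A B) :=
        Ideal.dvd_iff_le.mpr Ideal.map_comap_le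
      obtain ⟨C, hC⟩ := hd2
      rw [hC] at hd
      have hCd : C ∣ P.map s := (mul_dvd_mul_iff_left hPp.ne_zero).1 hd
      have hsp : Prime (P.map s) := Ideal.prime_of_isPrime (S.map_ne_bot hP0) (S.prime_map hP)
      rcases (Irreducible.dvd_iff hsp.irreducible).1 hCd with hu | ha
      · rw [Ideal.isUnit_iff] at hu
        rw [hu, Ideal.mul_top] at hC
        have hs : P.map s = P := by
          have := map_alg (s := s) (P.comap (algebraMap A B))
          rwa [hC] at this
        exact ⟨(P.comap (algebraMap A B)) ^ 2, by rw [hs, Ideal.map_pow, hC, pow_two]⟩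
      · rw [associated_iff_eq] at ha
        exact ⟨_, by rw [hC, ← ha]⟩
    obtain ⟨𝔪, hm⟩ := this
    refine ⟨𝔪 * 𝔫, ?_⟩
    rw [Ideal.map_mul, Ideal.map_mul, ← hn, ← hm]
    ring

theorem Setup.normIh (S : Setup s P₁ P₂ h π) (J : Ideal B) (hJ : J ≠ 0) :
    ∃ n : A, algebraMap A B n ≠ 0 ∧ J ^ h * (J ^ h).map s = Ideal.span {algebraMap A B n} := by
  obtain ⟨𝔫, hn⟩ := S.normI J
  obtain ⟨n, hn'⟩ := S.princ 𝔫
  have e : J ^ h * (J ^ h).map s = Ideal.span {algebraMap A B n} := by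
    rw [Ideal.map_pow, ← mul_pow, hn, ← Ideal.map_pow, hn', Ideal.map_span, Set.image_singleton]
  refine ⟨n, ?_, e⟩
  intro h0
  rw [h0] at e
  have : J ^ h * (J ^ h).map s ≠ 0 :=
    mul_ne_zero (pow_ne_zero _ hJ) (S.map_ne_bot (pow_ne_zero _ hJ))
  apply this
  rw [e]; simp

theorem Setup.nonsq (S : Setup s P₁ P₂ h π) (J : Ideal B) (hJ : J ≠ 0) (γ : B)
    (e : P₁ ^ h * J ^ 2 = Ideal.span {γ}) : False := by
  obtain ⟨m, A', hA', rfl⟩ := WfDvdMonoid.max_power_factor hJ S.p2.irreducible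
  have hA0 : A' ≠ 0 := right_ne_zero_of_mul hJ
  obtain ⟨p, hp⟩ := S.ram2
  obtain ⟨c, hc⟩ := S.princ p
  have hc2 : P₂ ^ (2 * h) = Ideal.span {algebraMap A B c} := by
    rw [pow_mul, ← hp, ← Ideal.map_pow, hc, Ideal.map_span, Set.image_singleton]
  have hc0 : algebraMap A B c ≠ 0 := by
    intro h0
    rw [h0] at hc2
    have : P₂ ^ (2 * h) ≠ 0 := pow_ne_zero _ S.bot2
    apply this; rw [hc2]; simp
  have e2 : Ideal.span {γ ^ h} = (P₁ ^ (h * h) * A' ^ (2 * h)) *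
      Ideal.span {algebraMap A B c ^ m} := by
    rw [← Ideal.span_singleton_pow, ← Ideal.span_singleton_pow, ← e, ← hc2]
    ring
  obtain ⟨y, hy, -⟩ := cancel_span (pow_ne_zero _ hc0) e2
  have hyP : y ∉ P₂ := by
    intro hm
    rw [← Ideal.dvd_span_singleton, ← hy] at hm
    rcases S.p2.dvd_or_dvd hm with h1 | h1
    · exact S.ndvd21 _ h1
    · exact hA' (S.p2.dvd_of_dvd_pow h1)
  obtain ⟨n, hn0, hn⟩ := S.normIh A' hA0
  have h1 : Ideal.span {y * s y} = Ideal.span {algebraMap A B (n ^ 2 * π ^ h)} := by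
    rw [map_mul, map_pow, map_pow, ← Ideal.span_singleton_mul_span_singleton,
      ← Ideal.span_singleton_mul_span_singleton,
      ← Ideal.span_singleton_pow, ← Ideal.span_singleton_pow, ← S.span_s, ← hy, ← S.gen1, ← hn,
      Ideal.map_mul, Ideal.map_pow, Ideal.map_pow, Ideal.map_pow, S.smap1]
    ring
  have hne : algebraMap A B (n ^ 2 * π ^ h) ≠ 0 := by
    rw [map_mul, map_pow, map_pow]
    exact mul_ne_zero (pow_ne_zero _ hn0) (pow_ne_zero _ S.pi_ne)
  obtain ⟨ε, hε⟩ := S.fix_gen hne (by simp [S.inv, mul_comm]) h1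
  exact S.nr y ε n h S.hodd hyP (by rw [hε, mul_assoc])

theorem Setup.two_tors (S : Setup s P₁ P₂ h π)
    (hU : ∀ ε : Aˣ, ∃ u : Bˣ, (u : B) * s u = algebraMap A B ε) (J : Ideal B) (hJ : J ≠ 0) (β : B)
    (e : J ^ 2 = Ideal.span {β}) :
    ∃ x y : B, x ≠ 0 ∧ y ≠ 0 ∧ (Ideal.span {x} * J = Ideal.span {y} ∨
      Ideal.span {x} * J = Ideal.span {y} * P₁ ^ h) := by
  obtain ⟨n, hn0, hn⟩ := S.normIh J hJ
  have hβ0 : β ≠ 0 := by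
    rintro rfl
    have : J ^ 2 ≠ 0 := pow_ne_zero _ hJ
    apply this; rw [e]; simp
  have h1 : Ideal.span {β ^ h * s (β ^ h)} = Ideal.span {algebraMap A B (n ^ 2)} := by
    rw [map_pow (algebraMap A B), ← Ideal.span_singleton_mul_span_singleton, ← S.span_s,
      ← Ideal.span_singleton_pow, ← Ideal.span_singleton_pow, ← e, ← hn,
      Ideal.map_pow, Ideal.map_pow, Ideal.map_pow]
    ring
  obtain ⟨ε, hε⟩ := S.fix_gen (by rw [map_pow]; exact pow_ne_zero _ hn0)
    (by simp [S.inv, mul_comm]) h1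
  obtain ⟨u, hu⟩ := hU ε
  obtain ⟨β', hβ'⟩ : ∃ β', β' = β ^ h * ((u⁻¹ : Bˣ) : B) := ⟨_, rfl⟩
  have hβu : β' * u = β ^ h := by rw [hβ', mul_assoc, Units.inv_mul, mul_one]
  have hβ'n : β' * s β' = algebraMap A B n * algebraMap A B n := by
    have hsu : (u : B) * s u ≠ 0 := by
      rw [hu]; exact fun h0 => ε.ne_zero (S.inj (by rw [h0, map_zero]))
    apply mul_left_cancel₀ hsu
    rw [map_mul, ← hu, map_pow (algebraMap A B), ← hβu, map_mul] at hε
    linear_combination hε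
  have hβ's : Ideal.span {β'} = (J ^ h) ^ 2 := by
    have : Ideal.span {β'} = Ideal.span {β ^ h} := by
      rw [Ideal.span_singleton_eq_span_singleton]
      exact ⟨u, hβu⟩
    rw [this, ← Ideal.span_singleton_pow, ← e]; ring
  obtain ⟨α', hα'0, hα'⟩ := S.h90 hn0 (AlgEquiv.commutes _ _) hβ'n
  obtain ⟨α, hα⟩ : ∃ α, α = s α' := ⟨_, rfl⟩
  have hα0 : α ≠ 0 := by rw [hα]; simpa using hα'0
  have hαα : β' * α = algebraMap A B n * s α := by rw [hα, S.inv, hα']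
  have hK0 : Ideal.span {α} * J ^ h ≠ 0 := mul_ne_zero (by simpa using hα0) (pow_ne_zero _ hJ)
  have hKs : (Ideal.span {α} * J ^ h).map s = Ideal.span {α} * J ^ h := by
    have hz : J ^ h ≠ 0 := pow_ne_zero _ hJ
    apply mul_right_cancel₀ hz
    have h3 : Ideal.span {β'} * Ideal.span {α} = Ideal.span {algebraMap A B n} * Ideal.span {s α} := by
      rw [Ideal.span_singleton_mul_span_singleton, Ideal.span_singleton_mul_span_singleton, hαα]
    rw [hβ's, ← hn] at h3
    rw [Ideal.map_mul, S.span_s]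
    calc _ = J ^ h * (J ^ h).map s * Ideal.span {s α} := by ring
      _ = _ := by rw [← h3]; ring
  obtain ⟨a, b, c, ha, hb, hc, ec⟩ := S.ambh _ hK0 hKs
  obtain ⟨δ, c', hδ0, -, hc', hd⟩ := S.delta
  obtain ⟨t, ht⟩ := S.hodd.mul S.hodd
  have hx : (Ideal.span {α} * J ^ h) ^ h = Ideal.span {α ^ h * β ^ t} * J := by
    rw [mul_pow, ← pow_mul, ht, pow_succ, pow_mul, e, Ideal.span_singleton_pow,
      Ideal.span_singleton_pow, ← Ideal.span_singleton_mul_span_singleton, mul_assoc]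
  rw [hx] at ec
  have hx0 : α ^ h * β ^ t ≠ 0 := mul_ne_zero (pow_ne_zero _ hα0) (pow_ne_zero _ hβ0)
  generalize α ^ h * β ^ t = x at ec hx0
  rcases ha with rfl | rfl <;> rcases hb with rfl | rfl
  · exact ⟨x, _, hx0, hc, Or.inl (by simpa using ec)⟩
  · refine ⟨x * algebraMap A B c' * algebraMap A B π, δ * algebraMap A B c,
      mul_ne_zero (mul_ne_zero hx0 hc') S.pi_ne, mul_ne_zero hδ0 hc, Or.inr ?_⟩
    rw [← Ideal.span_singleton_mul_span_singleton, ← Ideal.span_singleton_mul_span_singleton,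
      ← Ideal.span_singleton_mul_span_singleton, ← S.gen1, hd]
    calc _ = (Ideal.span {x} * J) * Ideal.span {algebraMap A B c'} * P₁ ^ (2 * h) := by ring
      _ = _ := by rw [ec]; ring
  · exact ⟨x, _, hx0, hc, Or.inr (by rw [ec]; ring)⟩
  · refine ⟨x * algebraMap A B c', δ * algebraMap A B c,
      mul_ne_zero hx0 hc', mul_ne_zero hδ0 hc, Or.inl ?_⟩
    rw [← Ideal.span_singleton_mul_span_singleton, ← Ideal.span_singleton_mul_span_singleton, hd]
    calc _ = (Ideal.span {x} * J) * Ideal.span {algebraMap A B c'} := by ring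
      _ = _ := by rw [ec]; ring

theorem group_mod4 {G : Type*} [CommGroup G] [Finite G] (c : G) (hc1 : c ≠ 1) (hc2 : c ^ 2 = 1)
    (hsq : ∀ x : G, x ^ 2 ≠ c) (ht : ∀ x : G, x ^ 2 = 1 → x = 1 ∨ x = c) :
    Nat.card G % 4 = 2 := by
  have hk : Nat.card (powMonoidHom 2 : G →* G).ker = 2 := by
    have : ((powMonoidHom 2 : G →* G).ker : Set G) = {1, c} := by
      ext x
      simp only [SetLike.mem_coe, MonoidHom.mem_ker, powMonoidHom_apply, Set.mem_insert_iff,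
        Set.mem_singleton_iff]
      constructor
      · exact ht x
      · rintro (rfl | rfl)
        · simp
        · exact hc2
    rw [← SetLike.coe_sort_coe, this, Nat.card_coe_set_eq, Set.ncard_pair hc1.symm]
  have hr : ¬ 2 ∣ Nat.card (powMonoidHom 2 : G →* G).range := by
    intro hd
    have : Fact (Nat.Prime 2) := ⟨Nat.prime_two⟩
    obtain ⟨⟨x, y, hy⟩, hx⟩ := exists_prime_orderOf_dvd_card' 2 hd
    have hx2 := pow_orderOf_eq_one (⟨x, y, hy⟩ : (powMonoidHom 2 : G →* G).range)
    rw [hx] at hx2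
    have hx2' : x ^ 2 = 1 := congrArg Subtype.val hx2
    rcases ht x hx2' with h | h
    · subst h
      have : orderOf (1 : (powMonoidHom 2 : G →* G).range) = 2 := hx
      simp at this
    · apply hsq y
      rw [← h, ← hy]; rfl
  have := Subgroup.card_mul_index (powMonoidHom 2 : G →* G).ker
  rw [hk, Subgroup.index_ker] at this
  omega

theorem Setup.card (S : Setup s P₁ P₂ h π) [Finite (ClassGroup B)]
    (hU : ∀ ε : Aˣ, ∃ u : Bˣ, (u : B) * s u = algebraMap A B ε) :
    Nat.card (ClassGroup B) % 4 = 2 := by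
  have hP0 : P₁ ^ h ≠ 0 := pow_ne_zero _ S.bot1
  obtain ⟨Pc, hPc⟩ : ∃ Pc : nonZeroDivisors (Ideal B), (Pc : Ideal B) = P₁ ^ h :=
    ⟨⟨P₁ ^ h, mem_nonZeroDivisors_of_ne_zero hP0⟩, rfl⟩
  have one_iff : ∀ J : nonZeroDivisors (Ideal B), ClassGroup.mk0 J = 1 ↔
      ∃ γ, (J : Ideal B) = Ideal.span {γ} := by
    intro J
    rw [ClassGroup.mk0_eq_one_iff, Submodule.isPrincipal_iff]
  refine group_mod4 (ClassGroup.mk0 Pc) ?_ ?_ ?_ ?_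
  · rw [Ne, one_iff, hPc]
    rintro ⟨γ, hγ⟩
    exact S.nonprin1 γ hγ
  · rw [← map_pow, one_iff]
    refine ⟨algebraMap A B π, ?_⟩
    rw [← S.gen1]; push_cast; rw [hPc]; ring
  · intro x hx
    obtain ⟨J, hJ⟩ := ClassGroup.mk0_surjective x⁻¹
    have : ClassGroup.mk0 (Pc * J ^ 2) = 1 := by
      rw [map_mul, map_pow, hJ, ← hx]; simp
    rw [one_iff] at this
    obtain ⟨γ, hγ⟩ := this
    push_cast at hγ
    rw [hPc] at hγ
    exact S.nonsq J (nonZeroDivisors.ne_zero J.2) γ hγ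
  · intro x hx
    obtain ⟨J, rfl⟩ := ClassGroup.mk0_surjective x
    rw [← map_pow, one_iff] at hx
    obtain ⟨β, hβ⟩ := hx
    push_cast at hβ
    obtain ⟨a, b, ha, hb, h1 | h1⟩ := S.two_tors hU J (nonZeroDivisors.ne_zero J.2) β hβ
    · left
      rw [← map_one ClassGroup.mk0, ClassGroup.mk0_eq_mk0_iff]
      exact ⟨a, b, ha, hb, by rw [h1]; simp⟩
    · right
      rw [ClassGroup.mk0_eq_mk0_iff]
      exact ⟨a, b, ha, hb, by rw [h1, hPc]⟩

end Scholz


namespace Scholz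

theorem finrank_ker_range {M N : Type*} [AddCommGroup M] [AddCommGroup N] [Module.Finite ℤ M]
    (f : M →ₗ[ℤ] N) : Module.finrank ℤ f.range + Module.finrank ℤ f.ker = Module.finrank ℤ M := by
  rw [← Submodule.finrank_quotient_add_finrank f.ker, (LinearMap.quotKerEquivRange f).finrank_eq]

theorem finite_of_directSum {ι : Type} [Fintype ι] (p e : ι → ℕ) (hp : ∀ i, Nat.Prime (p i)) :
    Finite (DirectSum ι fun i => ZMod (p i ^ e i)) := by
  have : ∀ i, NeZero (p i ^ e i) := fun i => ⟨pow_ne_zero _ (hp i).ne_zero⟩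
  exact Finite.of_equiv _ (DirectSum.addEquivProd (fun i => ZMod (p i ^ e i))).symm.toEquiv

theorem idx_free (n : ℕ) : (nsmulAddMonoidHom 2 : (Fin n →₀ ℤ) →+ _).range.index = 2 ^ n := by
  have h := ModN.natCard_eq (Fin n →₀ ℤ) 2
  rw [Module.finrank_finsupp_self, Fintype.card_fin] at h
  rw [← h, AddSubgroup.index]
  have : (nsmulAddMonoidHom 2 : (Fin n →₀ ℤ) →+ _).range =
      ((LinearMap.lsmul ℤ (Fin n →₀ ℤ) ((2 : ℕ) : ℤ)).range).toAddSubgroup := by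
    ext x
    simp [AddMonoidHom.mem_range, two_smul]
  rw [this]
  rfl

theorem idx_aux (G T : Type*) [AddCommGroup G] [AddCommGroup T] [Finite T] (n : ℕ)
    (f : G ≃+ (Fin n →₀ ℤ) × T) :
    Finite (nsmulAddMonoidHom 2 : G →+ G).ker ∧
    (nsmulAddMonoidHom 2 : G →+ G).range.index = 2 ^ Module.finrank ℤ G *
      Nat.card (nsmulAddMonoidHom 2 : G →+ G).ker := by
  have hT : (nsmulAddMonoidHom 2 : T →+ T).range.index = Nat.card (nsmulAddMonoidHom 2 : T →+ T).ker :=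
    AddSubgroup.index_range
  have hr : Module.finrank ℤ G = n := by
    rw [f.toIntLinearEquiv.finrank_eq]
    have h1 := finrank_ker_range (LinearMap.fst ℤ (Fin n →₀ ℤ) T)
    have h2 : (LinearMap.fst ℤ (Fin n →₀ ℤ) T).range = ⊤ := LinearMap.range_eq_top.2 LinearMap.fst_surjective
    have h3 : Module.finrank ℤ (LinearMap.fst ℤ (Fin n →₀ ℤ) T).ker = 0 := by
      rw [Module.finrank_eq_zero_iff_isTorsion]
      rintro ⟨⟨x, t⟩, hx⟩
      have hx' : x = 0 := hx
      subst hx'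
      refine ⟨⟨(addOrderOf t : ℤ), ?_⟩, ?_⟩
      · rw [mem_nonZeroDivisors_iff_ne_zero]
        exact_mod_cast (addOrderOf_pos t).ne'
      · ext : 1
        simp [Submonoid.smul_def]
    rw [h2, h3, finrank_top, Module.finrank_finsupp_self, Fintype.card_fin] at h1
    omega
  have hidx : (nsmulAddMonoidHom 2 : G →+ G).range.index = 2 ^ n * (nsmulAddMonoidHom 2 : T →+ T).range.index := by
    rw [← idx_free n, ← AddSubgroup.index_prod, ← AddSubgroup.index_map_equiv _ f]
    congr 1
    ext ⟨x, t⟩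
    simp only [AddSubgroup.mem_map, AddMonoidHom.mem_range, AddSubgroup.mem_prod,
      nsmulAddMonoidHom_apply]
    constructor
    · rintro ⟨_, ⟨g, rfl⟩, hg⟩
      have hg' : 2 • f g = (x, t) := by rw [← hg]; simp
      exact ⟨⟨(f g).1, congrArg Prod.fst hg'⟩, ⟨(f g).2, congrArg Prod.snd hg'⟩⟩
    · rintro ⟨⟨a, ha⟩, ⟨b, hb⟩⟩
      refine ⟨_, ⟨f.symm (a, b), rfl⟩, ?_⟩
      have ha' : 2 • a = x := ha
      have hb' : 2 • b = t := hb
      simp [← ha', ← hb']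
  have hk : Nonempty ((nsmulAddMonoidHom 2 : G →+ G).ker ≃ (nsmulAddMonoidHom 2 : T →+ T).ker) := by
    have two : ∀ g : G, g ∈ (nsmulAddMonoidHom 2 : G →+ G).ker → (f g).1 = 0 ∧ 2 • (f g).2 = 0 := by
      intro g hg
      have h1 : 2 • g = 0 := hg
      have h2 : 2 • f g = 0 := by rw [← map_nsmul, h1, map_zero]
      have h3 : 2 • (f g).1 = 0 := congrArg Prod.fst h2
      exact ⟨by simpa using h3, congrArg Prod.snd h2⟩
    refine ⟨Equiv.ofBijective (fun g => ⟨(f g.1).2, (two g.1 g.2).2⟩) ⟨?_, ?_⟩⟩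
    · rintro ⟨a, ha⟩ ⟨b, hb⟩ hab
      have hab' : (f a).2 = (f b).2 := congrArg Subtype.val hab
      ext
      apply f.injective
      exact Prod.ext (by rw [(two a ha).1, (two b hb).1]) hab'
    · rintro ⟨t, ht⟩
      have ht' : 2 • t = 0 := ht
      refine ⟨⟨f.symm (0, t), ?_⟩, ?_⟩
      · show 2 • f.symm (0, t) = 0
        rw [← map_nsmul]
        simp [ht']
      · ext; simp
  obtain ⟨eq⟩ := hk
  refine ⟨Finite.of_equiv _ eq.symm, ?_⟩
  rw [hr, hidx, hT, Nat.card_congr eq]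

theorem idx_add (G : Type*) [AddCommGroup G] [Module.Finite ℤ G] :
    Finite (nsmulAddMonoidHom 2 : G →+ G).ker ∧
    (nsmulAddMonoidHom 2 : G →+ G).range.index = 2 ^ Module.finrank ℤ G *
      Nat.card (nsmulAddMonoidHom 2 : G →+ G).ker := by
  have : AddGroup.FG G := Module.Finite.iff_addGroup_fg.1 inferInstance
  obtain ⟨n, ι, _, p, hp, e, ⟨f⟩⟩ := AddCommGroup.equiv_free_prod_directSum_zmod G
  have hT := finite_of_directSum p e hp
  exact idx_aux G _ n f

theorem idx_mul (G : Type*) [CommGroup G] [Module.Finite ℤ (Additive G)] :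
    Finite (powMonoidHom 2 : G →* G).ker ∧
    (powMonoidHom 2 : G →* G).range.index = 2 ^ Module.finrank ℤ (Additive G) *
      Nat.card (powMonoidHom 2 : G →* G).ker := idx_add (Additive G)

theorem idx_sub {M : Type*} [CommGroup M] (H : Subgroup M) :
    (H.map (powMonoidHom 2)).relIndex H = (powMonoidHom 2 : H →* H).range.index := by
  rw [Subgroup.relIndex]
  congr 1
  ext ⟨x, hx⟩
  simp only [Subgroup.mem_subgroupOf, Subgroup.mem_map, MonoidHom.mem_range, powMonoidHom_apply]
  constructor
  · rintro ⟨y, hy, e⟩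
    exact ⟨⟨y, hy⟩, Subtype.ext e⟩
  · rintro ⟨⟨y, hy⟩, e⟩
    exact ⟨y, hy, congrArg Subtype.val e⟩

theorem herbrand {M E : Type*} [CommGroup M] [CommGroup E] [Module.Finite ℤ (Additive M)]
    [Module.Finite ℤ (Additive E)] (σ : M →* M) (ι : E →* M) (ν : M →* E)
    (hι : Function.Injective ι) (hιν : ∀ x, ι (ν x) = x * σ x) (hσ : ∀ x, σ (σ x) = x)
    (hfix : ∀ x, σ x = x ↔ x ∈ ι.range) (m : M) (hm : m ≠ 1) (hm2 : m ^ 2 = 1)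
    (hmσ : m * σ m = 1) (m' : E) (hE : ∀ x : E, x ^ 2 = 1 → x = 1 ∨ x = m')
    (hrank : Module.finrank ℤ (Additive M) = 2 * Module.finrank ℤ (Additive E) + 1)
    (H1 : ∀ e, e * σ e = 1 → e ∈ (MonoidHom.id M / σ).range ∨ m * e ∈ (MonoidHom.id M / σ).range) :
    Function.Surjective ν := by
  set D : M →* M := MonoidHom.id M / σ with hD
  set N : M →* M := MonoidHom.id M * σ with hN
  have hDa : ∀ x, D x = x / σ x := fun x => rfl
  have hNa : ∀ x, N x = x * σ x := fun x => rfl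
  have hDk : ∀ x, x ∈ D.ker ↔ σ x = x := by
    intro x; rw [MonoidHom.mem_ker, hDa, div_eq_one, eq_comm]
  have hNk : ∀ x, x ∈ N.ker ↔ σ x = x⁻¹ := by
    intro x; rw [MonoidHom.mem_ker, hNa, mul_eq_one_iff_inv_eq, eq_comm]
  have hkr : D.ker = ι.range := by
    ext x; rw [hDk, hfix]
  have hNle : N.range ≤ D.ker := by
    rintro _ ⟨x, rfl⟩
    rw [hDk, hNa, map_mul, hσ, mul_comm]
  have hDle : D.range ≤ N.ker := by
    rintro _ ⟨x, rfl⟩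
    rw [hNk, hDa, map_div, hσ, inv_div]
  -- squares
  have hNsq : D.ker.map N = D.ker.map (powMonoidHom 2) := by
    ext y
    constructor <;>
    · rintro ⟨x, hx, rfl⟩
      refine ⟨x, hx, ?_⟩
      have := (hDk x).1 hx
      rw [hNa, powMonoidHom_apply, this, pow_two]
  have hDsq : N.ker.map D = N.ker.map (powMonoidHom 2) := by
    ext y
    constructor <;>
    · rintro ⟨x, hx, rfl⟩
      refine ⟨x, hx, ?_⟩
      have := (hNk x).1 hx
      rw [hDa, powMonoidHom_apply, this, div_inv_eq_mul, pow_two]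
  have q1 : (D.ker.map N).relIndex N.range = (D.ker ⊔ N.ker).index := by
    rw [MonoidHom.range_eq_map, Subgroup.relIndex_map_map, top_sup_eq, Subgroup.relIndex_top_right]
  have q2 : (N.ker.map D).relIndex D.range = (D.ker ⊔ N.ker).index := by
    rw [MonoidHom.range_eq_map, Subgroup.relIndex_map_map, top_sup_eq, Subgroup.relIndex_top_right,
      sup_comm]
  have a1 := Subgroup.relIndex_mul_relIndex (D.ker.map N) N.range D.ker
    (by rw [MonoidHom.range_eq_map]; exact Subgroup.map_mono le_top) hNle
  have b1 := Subgroup.relIndex_mul_relIndex (N.ker.map D) D.range N.ker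
    (by rw [MonoidHom.range_eq_map]; exact Subgroup.map_mono le_top) hDle
  rw [q1, hNsq, idx_sub] at a1
  rw [q2, hDsq, idx_sub] at b1
  -- the plus part
  have hE1 : (powMonoidHom 2 : D.ker →* D.ker).range.index = (powMonoidHom 2 : E →* E).range.index := by
    let eq : E ≃* D.ker := (MonoidHom.ofInjective hι).trans (MulEquiv.subgroupCongr hkr.symm)
    rw [← Subgroup.index_map_equiv (powMonoidHom 2 : E →* E).range eq]
    congr 1
    ext x
    simp only [Subgroup.mem_map, MonoidHom.mem_range, powMonoidHom_apply]
    constructor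
    · rintro ⟨y, rfl⟩
      exact ⟨_, ⟨eq.symm y, rfl⟩, by simp⟩
    · rintro ⟨_, ⟨z, rfl⟩, rfl⟩
      exact ⟨eq z, by simp⟩
  obtain ⟨hEf, hEi⟩ := idx_mul E
  have hEc : Nat.card (powMonoidHom 2 : E →* E).ker ≤ 2 := by
    have : ((powMonoidHom 2 : E →* E).ker : Set E) ⊆ {1, m'} := fun x hx => by
      simpa using hE x hx
    have h2 := Set.ncard_le_ncard this
    rw [← Nat.card_coe_set_eq] at h2
    exact h2.trans ((Set.ncard_insert_le _ _).trans (by rw [Set.ncard_singleton]))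
  have hEpos : 0 < Nat.card (powMonoidHom 2 : E →* E).ker := Nat.card_pos
  -- the minus part
  have hfin : Module.Finite ℤ (Additive N.ker) := by
    let f : Additive N.ker →ₗ[ℤ] Additive M := (MonoidHom.toAdditive N.ker.subtype).toIntLinearMap
    exact Module.Finite.of_injective f (fun x y hxy => Subtype.ext hxy)
  have hrk : Module.finrank ℤ (Additive E) + 1 ≤ Module.finrank ℤ (Additive N.ker) := by
    let f : Additive M →ₗ[ℤ] Additive E := (MonoidHom.toAdditive ν).toIntLinearMap
    have h1 := finrank_ker_range f
    have h2 := Submodule.finrank_le f.range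
    let g : f.ker →ₗ[ℤ] Additive N.ker :=
      { toFun := fun x => Additive.ofMul ⟨Additive.toMul x.1, by
          have hx : ν (Additive.toMul x.1) = 1 := x.2
          rw [MonoidHom.mem_ker, hNa, ← hιν, hx, map_one]⟩
        map_add' := fun x y => rfl
        map_smul' := fun n x => rfl }
    have h3 := LinearMap.finrank_le_finrank_of_injective (f := g) (by
      intro x y hxy
      ext
      exact congrArg (fun z : Additive N.ker => ((Additive.toMul z : N.ker) : M)) hxy)
    omega
  obtain ⟨hNf, hNi⟩ := idx_mul N.ker
  have hNc : 2 ≤ Nat.card (powMonoidHom 2 : N.ker →* N.ker).ker := by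
    have hmN : m ∈ N.ker := hmσ
    have : Nontrivial (powMonoidHom 2 : N.ker →* N.ker).ker :=
      ⟨⟨⟨⟨m, hmN⟩, Subtype.ext hm2⟩, 1, fun h => hm (congrArg
        (fun z : (powMonoidHom 2 : N.ker →* N.ker).ker => ((z : N.ker) : M)) h)⟩⟩
    exact Finite.one_lt_card
  have hD2 : D.range.relIndex N.ker ≤ 2 := by
    rw [Subgroup.relIndex, Subgroup.index]
    have hs : Set.range (![(QuotientGroup.mk 1 : N.ker ⧸ D.range.subgroupOf N.ker),
        QuotientGroup.mk (⟨m, hmσ⟩ : N.ker)]) = Set.univ := by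
      rw [Set.eq_univ_iff_forall]
      intro x
      induction x using QuotientGroup.induction_on with
      | H z =>
        rcases H1 z.1 z.2 with h | h
        · refine ⟨0, ?_⟩
          simp only [Matrix.cons_val_zero]
          rw [QuotientGroup.eq, Subgroup.mem_subgroupOf]
          simpa using h
        · refine ⟨1, ?_⟩
          simp only [Matrix.cons_val_one, Matrix.cons_val_zero]
          rw [QuotientGroup.eq, Subgroup.mem_subgroupOf]
          have : m⁻¹ = m := by rw [inv_eq_iff_mul_eq_one, ← pow_two, hm2]
          simpa [this] using h
    have := Nat.card_le_card_of_surjective _ (Set.range_eq_univ.1 hs)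
    simpa using this
  -- conclude
  have hx : N.range.relIndex D.ker = 1 := by
    set q := (D.ker ⊔ N.ker).index
    set x := N.range.relIndex D.ker
    set y := D.range.relIndex N.ker
    rw [hE1, hEi] at a1
    rw [hNi] at b1
    set r := Module.finrank ℤ (Additive E)
    have hp : 0 < 2 ^ r := by positivity
    have hge : 2 ^ r * 2 * 2 ≤ q * y := by
      rw [b1]
      refine Nat.mul_le_mul ?_ hNc
      rw [← pow_succ]
      exact Nat.pow_le_pow_right (by norm_num) hrk
    have hq : 2 ^ r * 2 ≤ q := by nlinarith
    have hle : q * x ≤ 2 ^ r * 2 := by rw [a1]; exact Nat.mul_le_mul le_rfl hEc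
    have hpos : 0 < q * x := by rw [a1]; positivity
    have hx0 : 0 < x := Nat.pos_of_mul_pos_left hpos
    by_contra hne
    have : 2 ≤ x := by omega
    nlinarith
  rw [Subgroup.relIndex_eq_one] at hx
  intro y
  have : ι y ∈ D.ker := by rw [hkr]; exact ⟨y, rfl⟩
  obtain ⟨x, hx'⟩ := hx this
  refine ⟨x, hι ?_⟩
  rw [hιν, ← hx', hNa]

end Scholz


namespace Scholz

theorem galois_of_deg (F k : Type*) [Field F] [NumberField F] [Field k] [NumberField k] [Algebra F k]
    (hdeg : Module.finrank F k = 2) : IsGalois F k := by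
  have : Algebra.IsQuadraticExtension F k := ⟨hdeg⟩
  infer_instance

theorem exists_sigma (F k : Type*) [Field F] [NumberField F] [Field k] [NumberField k] [Algebra F k]
    (hdeg : Module.finrank F k = 2) : ∃ σ : k ≃ₐ[F] k, σ ≠ 1 ∧ (∀ τ : k ≃ₐ[F] k, τ = 1 ∨ τ = σ) ∧
      σ * σ = 1 := by
  have := galois_of_deg F k hdeg
  have hc : Nat.card (k ≃ₐ[F] k) = 2 := by rw [IsGalois.card_aut_eq_finrank, hdeg]
  obtain ⟨σ, hσ, hu⟩ := (Nat.card_eq_two_iff' (1 : k ≃ₐ[F] k)).mp hc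
  refine ⟨σ, hσ, fun τ => ?_, ?_⟩
  · by_cases h : τ = 1
    · exact Or.inl h
    · exact Or.inr (hu τ h)
  · by_contra h
    have := hu _ h
    exact hσ (mul_eq_left.mp this)

theorem norm_eq {F k : Type*} [Field F] [NumberField F] [Field k] [NumberField k] [Algebra F k]
    (hdeg : Module.finrank F k = 2) (σ : k ≃ₐ[F] k) (hσ : σ ≠ 1)
    (hall : ∀ τ : k ≃ₐ[F] k, τ = 1 ∨ τ = σ) (x : 𝓞 k) :
    x * RingOfIntegers.mapAlgEquiv σ x = algebraMap (𝓞 F) (𝓞 k) (RingOfIntegers.norm F x) := by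
  have := galois_of_deg F k hdeg
  apply RingOfIntegers.coe_injective
  have h1 : algebraMap (𝓞 k) k (algebraMap (𝓞 F) (𝓞 k) (RingOfIntegers.norm F x))
     = algebraMap F k (Algebra.norm F (x : k)) := by
    rw [← RingOfIntegers.coe_norm]; rfl
  rw [h1, Algebra.norm_eq_prod_automorphisms]
  have h2 : (Finset.univ : Finset (k ≃ₐ[F] k)) = {1, σ} := by
    ext τ; simpa using hall τ
  rw [h2, Finset.prod_pair hσ.symm]
  simp
  left; rfl

theorem fix_eq {F k : Type*} [Field F] [NumberField F] [Field k] [NumberField k] [Algebra F k]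
    (hdeg : Module.finrank F k = 2) (σ : k ≃ₐ[F] k)
    (hall : ∀ τ : k ≃ₐ[F] k, τ = 1 ∨ τ = σ) (x : 𝓞 k)
    (hx : RingOfIntegers.mapAlgEquiv σ x = x) : ∃ a, algebraMap (𝓞 F) (𝓞 k) a = x := by
  have := galois_of_deg F k hdeg
  have h1 : (x : k) ∈ (⊥ : IntermediateField F k) := by
    rw [IsGalois.mem_bot_iff_fixed]
    intro f
    rcases hall f with rfl | rfl
    · rfl
    · exact congrArg (algebraMap (𝓞 k) k) hx
  obtain ⟨y, hy⟩ := IntermediateField.mem_bot.mp h1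
  have hy' : IsIntegral ℤ y := by
    have h2 : IsIntegral ℤ (x : k) := x.isIntegral_coe
    rw [← hy] at h2
    exact (isIntegral_algebraMap_iff (algebraMap F k).injective).mp h2
  refine ⟨⟨y, hy'⟩, ?_⟩
  apply RingOfIntegers.coe_injective
  exact hy

theorem princ_pow (F : Type*) [Field F] [NumberField F] (𝔞 : Ideal (𝓞 F)) :
    ∃ c, 𝔞 ^ classNumber F = Ideal.span {c} := by
  by_cases h : 𝔞 = ⊥
  · refine ⟨0, ?_⟩
    rw [h, Ideal.bot_pow]
    · simp
    · exact Fintype.card_ne_zero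
  · have h2 : 𝔞 ∈ nonZeroDivisors (Ideal (𝓞 F)) := mem_nonZeroDivisors_of_ne_zero h
    have h3 : (ClassGroup.mk0 ⟨𝔞, h2⟩) ^ classNumber F = 1 := pow_card_eq_one
    rw [← map_pow] at h3
    have h4 := (ClassGroup.mk0_eq_one_iff (I := 𝔞 ^ classNumber F) (pow_mem h2 _)).mp h3
    obtain ⟨c, hc⟩ := h4.principal
    exact ⟨c, hc⟩

theorem rank_eq (F k : Type*) [Field F] [NumberField F] [Field k] [NumberField k] [Algebra F k]
    (hdeg : Module.finrank F k = 2)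
    (hinf : ∀ φ : F →+* ℝ, ∃ ψ : k →+* ℝ, ψ.comp (algebraMap F k) = φ) :
    Module.finrank ℤ (Additive (𝓞 k)ˣ) = 2 * Module.finrank ℤ (Additive (𝓞 F)ˣ) + 1 := by
  have := galois_of_deg F k hdeg
  have : IsUnramifiedAtInfinitePlaces F k := by
    refine ⟨fun w => ?_⟩
    rw [InfinitePlace.isUnramified_iff]
    by_contra hcon
    push Not at hcon
    obtain ⟨h1, h2⟩ := hcon
    rw [InfinitePlace.not_isComplex_iff_isReal] at h2
    have h3 := InfinitePlace.isReal_iff.mp h2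
    obtain ⟨ψ, hψ⟩ := hinf h3.embedding
    let χ : k →+* ℂ := Complex.ofRealHom.comp ψ
    have hχ : (InfinitePlace.mk χ).IsReal := by
      rw [InfinitePlace.isReal_mk_iff]
      ext x
      simp [χ]
    have hc : (InfinitePlace.mk χ).comap (algebraMap F k) = w.comap (algebraMap F k) := by
      rw [InfinitePlace.comap_mk]
      conv_rhs => rw [← InfinitePlace.mk_embedding (w.comap (algebraMap F k))]
      congr 1
      ext x
      simp only [χ, RingHom.comp_assoc, hψ]
      simp
    obtain ⟨τ, hτ⟩ := InfinitePlace.exists_smul_eq_of_comap_eq hc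
    apply h1
    rw [← hτ, InfinitePlace.isReal_smul_iff]
    exact hχ
  have h := IsUnramifiedAtInfinitePlaces.card_infinitePlace F k
  rw [hdeg] at h
  rw [Units.finrank_eq, Units.finrank_eq, Units.rank, Units.rank]
  have : 0 < Fintype.card (InfinitePlace F) := Fintype.card_pos
  omega

theorem prime_over {F k : Type*} [Field F] [NumberField F] [Field k] [NumberField k] [Algebra F k]
    (hdeg : Module.finrank F k = 2) (p : Ideal (𝓞 F)) (hp : p.IsPrime) (hN : Odd (Ideal.absNorm p))
    (hr : ∃ P : Ideal (𝓞 k), P.IsPrime ∧ P ^ 2 ∣ p.map (algebraMap (𝓞 F) (𝓞 k))) :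
    ∃ P : Ideal (𝓞 k), P.IsPrime ∧ P ≠ ⊥ ∧ p.map (algebraMap (𝓞 F) (𝓞 k)) = P ^ 2 ∧
      P.comap (algebraMap (𝓞 F) (𝓞 k)) = p ∧ (2 : 𝓞 k) ∉ P ∧
      ∀ b : 𝓞 k, ∃ a : 𝓞 F, b - algebraMap (𝓞 F) (𝓞 k) a ∈ P := by
  obtain ⟨P, hP, hd⟩ := hr
  have hp0 : p ≠ ⊥ := by
    rintro rfl
    simp at hN
  have hNp : Ideal.absNorm p ≠ 0 := fun h => by rw [h] at hN; simp at hN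
  have hmax : p.IsMaximal := hp.isMaximal hp0
  have hmap : p.map (algebraMap (𝓞 F) (𝓞 k)) ≠ ⊥ := by
    rw [Ne, Ideal.map_eq_bot_iff_of_injective (FaithfulSMul.algebraMap_injective _ _)]
    exact hp0
  have hP0 : P ≠ ⊥ := by
    rintro rfl
    rw [Ideal.bot_pow two_ne_zero] at hd
    exact hmap (zero_dvd_iff.mp hd)
  have hle : p.map (algebraMap (𝓞 F) (𝓞 k)) ≤ P :=
    (Ideal.dvd_iff_le.mp hd).trans (Ideal.pow_le_self two_ne_zero)
  have hcomap : P.comap (algebraMap (𝓞 F) (𝓞 k)) = p :=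
    (hmax.eq_of_le (Ideal.IsPrime.comap _).ne_top (Ideal.map_le_iff_le_comap.mp hle)).symm
  have hfr : Module.finrank (𝓞 F) (𝓞 k) = 2 := by
    rw [← hdeg]
    exact (IsFractionRing.finrank_eq (𝓞 F) F (𝓞 k) k).symm
  have hnm := Ideal.absNorm_algebraMap (𝓞 F) (𝓞 k) p
  rw [hfr] at hnm
  obtain ⟨J, hJ⟩ := hd
  have hnm2 : Ideal.absNorm P ^ 2 * Ideal.absNorm J = Ideal.absNorm p ^ 2 := by
    rw [← hnm, hJ, map_mul, map_pow]
  -- residue map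
  let f : (𝓞 F ⧸ p) →+* (𝓞 k ⧸ P) := Ideal.quotientMap P (algebraMap (𝓞 F) (𝓞 k)) hcomap.ge
  have hf : Function.Injective f := Ideal.quotientMap_injective' hcomap.le
  have hNP : Ideal.absNorm P ≠ 0 := by rwa [Ne, Ideal.absNorm_eq_zero_iff]
  have hfP : Finite (𝓞 k ⧸ P) := Ideal.finiteQuotientOfFreeOfNeBot P hP0
  have hle1 : Ideal.absNorm p ≤ Ideal.absNorm P := by
    rw [Ideal.absNorm_apply, Ideal.absNorm_apply]
    have : Finite (𝓞 k ⧸ Submodule.toAddSubgroup P) := hfP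
    exact Nat.card_le_card_of_injective f hf
  have hle2 : Ideal.absNorm P ≤ Ideal.absNorm p := by
    have : Ideal.absNorm P ^ 2 ∣ Ideal.absNorm p ^ 2 := ⟨_, hnm2.symm⟩
    exact Nat.le_of_dvd (Nat.pos_of_ne_zero hNp) ((Nat.pow_dvd_pow_iff two_ne_zero).mp this)
  have heq : Ideal.absNorm P = Ideal.absNorm p := le_antisymm hle2 hle1
  have hJ1 : Ideal.absNorm J = 1 := by
    rw [heq] at hnm2
    have : 0 < Ideal.absNorm p ^ 2 := by positivity
    exact Nat.eq_of_mul_eq_mul_left this (by rw [hnm2, mul_one])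
  rw [Ideal.absNorm_eq_one_iff] at hJ1
  refine ⟨P, hP, hP0, by rw [hJ, hJ1, Ideal.mul_top], hcomap, ?_, ?_⟩
  · intro h2
    have h3 : (2 : 𝓞 F) ∈ p := by
      rw [← hcomap, Ideal.mem_comap, map_ofNat]; exact h2
    have h4 := Ideal.absNorm_mem p
    obtain ⟨r, hr⟩ := hN
    rw [hr] at h4
    apply hp.ne_top
    rw [Ideal.eq_top_iff_one]
    have h5 : (1 : 𝓞 F) = ((2 * r + 1 : ℕ) : 𝓞 F) - r * 2 := by push_cast; ring
    rw [h5]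
    exact p.sub_mem h4 (p.mul_mem_left _ h3)
  · intro b
    have hbij : Function.Bijective f := by
      have hfp : Finite (𝓞 F ⧸ p) := Finite.of_injective f hf
      refine (Nat.bijective_iff_injective_and_card f).mpr ⟨hf, ?_⟩
      have := heq
      rw [Ideal.absNorm_apply, Ideal.absNorm_apply] at this
      exact this.symm
    obtain ⟨y, hy⟩ := hbij.2 (Ideal.Quotient.mk P b)
    obtain ⟨a, rfl⟩ := Ideal.Quotient.mk_surjective y
    refine ⟨a, ?_⟩
    rw [← Ideal.Quotient.eq]
    rw [← hy]
    exact Ideal.quotientMap_mk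

theorem nr_aux {F : Type*} [Field F] [NumberField F] (p : Ideal (𝓞 F)) (hp : p.IsPrime)
    (hN : Odd (Ideal.absNorm p)) (ε : 𝓞 F) (hε : ε ^ ((Ideal.absNorm p - 1) / 2) - 1 ∈ p)
    (π : 𝓞 F) (hπ : π ^ ((Ideal.absNorm p - 1) / 2) - 1 ∉ p) (c n : 𝓞 F) (m : ℕ) (hm : Odd m)
    (hc : c ∉ p) (h : ε * n ^ 2 * π ^ m - c ^ 2 ∈ p) : False := by
  have hp0 : p ≠ ⊥ := by
    rintro rfl
    simp at hN
  have hmax : p.IsMaximal := hp.isMaximal hp0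
  let : Field (𝓞 F ⧸ p) := Ideal.Quotient.field p
  have : Finite (𝓞 F ⧸ p) := Ideal.finiteQuotientOfFreeOfNeBot p hp0
  let : Fintype (𝓞 F ⧸ p) := Fintype.ofFinite _
  have hcard : Fintype.card (𝓞 F ⧸ p) = Ideal.absNorm p := by
    rw [Ideal.absNorm_apply, ← Nat.card_eq_fintype_card]; rfl
  obtain ⟨r, hr⟩ := hN
  have hr2 : (Ideal.absNorm p - 1) / 2 = r := by omega
  rw [hr2] at hε hπ
  have fl : ∀ x : 𝓞 F ⧸ p, x ≠ 0 → (x ^ 2) ^ r = 1 := fun x hx => by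
    rw [← pow_mul]
    have := FiniteField.pow_card_sub_one_eq_one x hx
    rwa [hcard, hr, Nat.add_sub_cancel] at this
  rw [← Ideal.Quotient.eq] at h hε
  rw [← Ideal.Quotient.eq] at hπ
  simp only [map_mul, map_pow, map_one] at h hε hπ
  have hc' : Ideal.Quotient.mk p c ≠ 0 := by rwa [Ne, Ideal.Quotient.eq_zero_iff_mem]
  generalize Ideal.Quotient.mk p c = C at *
  generalize Ideal.Quotient.mk p n = N at *
  generalize Ideal.Quotient.mk p π = Q at *
  generalize Ideal.Quotient.mk p ε = E at *
  have hN0 : N ≠ 0 := by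
    rintro rfl
    apply hc'
    simpa using h.symm
  have hQ0 : Q ≠ 0 := by
    rintro rfl
    apply hc'
    rw [zero_pow (by rintro rfl; simp at hm)] at h
    simpa using h.symm
  have h2 := congrArg (fun z => z ^ r) h
  simp only [mul_pow] at h2
  rw [fl C hc', fl N hN0, hε, one_mul, one_mul] at h2
  have h3 := fl Q hQ0
  obtain ⟨t, rfl⟩ := hm
  apply hπ
  rw [pow_right_comm] at h2 h3
  rw [pow_succ, pow_mul, h3, one_pow, one_mul] at h2
  exact h2

end Scholz


namespace Scholz

theorem concrete_setup
    (F : Type*) [Field F] [NumberField F]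
    (hoddF : Odd (NumberField.classNumber F))
    (k : Type*) [Field k] [NumberField k] [Algebra F k]
    (hdeg : Module.finrank F k = 2)
    (𝔭₁ 𝔭₂ : Ideal (𝓞 F)) (hp1 : 𝔭₁.IsPrime) (hp2 : 𝔭₂.IsPrime) (hne : 𝔭₁ ≠ 𝔭₂)
    (hN1 : Odd (Ideal.absNorm 𝔭₁)) (hN2 : Odd (Ideal.absNorm 𝔭₂))
    (hram : ∀ 𝔭 : Ideal (𝓞 F), 𝔭.IsPrime → 𝔭 ≠ ⊥ →
      (IsRamifiedIn F k 𝔭 ↔ 𝔭 = 𝔭₁ ∨ 𝔭 = 𝔭₂))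
    (hprim2 : IsPrimaryIdeal F 𝔭₂)
    (π₁ : 𝓞 F)
    (hgen1 : 𝔭₁ ^ NumberField.classNumber F = Ideal.span {π₁})
    (hsym : quadResSym F 𝔭₂ π₁ = -1)
    (σ : k ≃ₐ[F] k) (hσ : σ ≠ 1) (hall : ∀ τ : k ≃ₐ[F] k, τ = 1 ∨ τ = σ) (hσσ : σ * σ = 1) :
    ∃ P₁ P₂ : Ideal (𝓞 k), Setup (RingOfIntegers.mapAlgEquiv σ : 𝓞 k ≃ₐ[𝓞 F] 𝓞 k) P₁ P₂
      (NumberField.classNumber F) π₁ := by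
  have hb1 : 𝔭₁ ≠ ⊥ := by rintro rfl; simp at hN1
  have hb2 : 𝔭₂ ≠ ⊥ := by rintro rfl; simp at hN2
  obtain ⟨P₁, hP1, hP1b, hP1m, hP1c, hP12, hP1r⟩ :=
    prime_over (k := k) hdeg 𝔭₁ hp1 hN1 ((hram _ hp1 hb1).mpr (Or.inl rfl))
  obtain ⟨P₂, hP2, hP2b, hP2m, hP2c, hP22, hP2r⟩ :=
    prime_over (k := k) hdeg 𝔭₂ hp2 hN2 ((hram _ hp2 hb2).mpr (Or.inr rfl))
  have hs : ∀ x : 𝓞 k, ((RingOfIntegers.mapAlgEquiv σ : 𝓞 k ≃ₐ[𝓞 F] 𝓞 k) x : k) = σ x :=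
    fun x => rfl
  have hinj : Function.Injective (algebraMap (𝓞 F) (𝓞 k)) := FaithfulSMul.algebraMap_injective _ _
  have hinv : ∀ x : 𝓞 k, (RingOfIntegers.mapAlgEquiv σ : 𝓞 k ≃ₐ[𝓞 F] 𝓞 k)
      ((RingOfIntegers.mapAlgEquiv σ : 𝓞 k ≃ₐ[𝓞 F] 𝓞 k) x) = x := by
    intro x
    apply RingOfIntegers.coe_injective
    exact DFunLike.congr_fun hσσ (x : k)
  refine ⟨P₁, P₂, hinj, hinv, fix_eq hdeg σ hall, hP1, hP2, hP1b, hP2b, ?_, hoddF, princ_pow F,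
    ⟨_, hP1m⟩, ⟨_, hP2m⟩, ?_, ?_, hP1r, hP2r, hP12, hP22, ?_, ?_⟩
  · rintro rfl
    exact hne (hP1c.symm.trans hP2c)
  · rw [pow_mul, ← hP1m, ← Ideal.map_pow, hgen1, Ideal.map_span, Set.image_singleton]
  · intro P hP hPb hn1 hn2
    have hq0 : P.comap (algebraMap (𝓞 F) (𝓞 k)) ≠ ⊥ := fun h =>
      hPb (Ideal.eq_bot_of_comap_eq_bot h)
    have hqp : (P.comap (algebraMap (𝓞 F) (𝓞 k))).IsPrime := Ideal.IsPrime.comap _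
    by_contra hsq
    have hramq : IsRamifiedIn F k (P.comap (algebraMap (𝓞 F) (𝓞 k))) := by
      rw [Squarefree] at hsq
      push Not at hsq
      obtain ⟨J, hJd, hJu⟩ := hsq
      have hJt : J ≠ ⊤ := fun h => hJu (Ideal.isUnit_iff.mpr h)
      obtain ⟨Q, hQ, hJQ⟩ := Ideal.exists_le_maximal J hJt
      refine ⟨Q, hQ.isPrime, ?_⟩
      have : Q ∣ J := Ideal.dvd_iff_le.mpr hJQ
      rw [sq]
      exact (mul_dvd_mul this this).trans hJd
    have key : ∀ R : Ideal (𝓞 k), R.IsPrime → R ≠ ⊥ →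
        (P.comap (algebraMap (𝓞 F) (𝓞 k))).map (algebraMap (𝓞 F) (𝓞 k)) = R ^ 2 → P = R := by
      intro R hR hRb h
      have h1 : R ^ 2 ≤ P := h ▸ Ideal.map_comap_le
      have h2 : R ≤ P := hP.le_of_pow_le h1
      exact ((hR.isMaximal hRb).eq_of_le hP.ne_top h2).symm
    rcases (hram _ hqp hq0).mp hramq with h | h
    · exact hn1 (key _ hP1 hP1b (h ▸ hP1m))
    · exact hn2 (key _ hP2 hP2b (h ▸ hP2m))
  · by_contra hcon
    push Not at hcon
    apply hσ
    ext x
    obtain ⟨a, b, hb, rfl⟩ := IsFractionRing.div_surjective (A := 𝓞 k) x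
    rw [map_div₀]
    have ha : σ (algebraMap (𝓞 k) k a) = algebraMap (𝓞 k) k a :=
      congrArg (algebraMap (𝓞 k) k) (hcon a)
    have hb : σ (algebraMap (𝓞 k) k b) = algebraMap (𝓞 k) k b :=
      congrArg (algebraMap (𝓞 k) k) (hcon b)
    rw [ha, hb]
    rfl
  · intro γ ε n m hm hγ heq
    obtain ⟨c, hc⟩ := hP2r γ
    have hst : ∀ x ∈ P₂, (RingOfIntegers.mapAlgEquiv σ : 𝓞 k ≃ₐ[𝓞 F] 𝓞 k) x ∈ P₂ := by
      intro x hx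
      have hx2 : x ^ 2 ∈ Ideal.map (algebraMap (𝓞 F) (𝓞 k)) 𝔭₂ := by
        rw [hP2m]; exact Ideal.pow_mem_pow hx 2
      have h3 := Ideal.mem_map_of_mem (RingOfIntegers.mapAlgEquiv σ : 𝓞 k ≃ₐ[𝓞 F] 𝓞 k) hx2
      rw [map_alg, hP2m, map_pow] at h3
      exact hP2.mem_of_pow_mem 2 (Ideal.pow_le_self two_ne_zero h3)
    have hsc := hst _ hc
    rw [map_sub, AlgEquiv.commutes] at hsc
    have hcn : c ∉ 𝔭₂ := by
      intro h
      rw [← hP2c, Ideal.mem_comap] at h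
      exact hγ (by simpa using P₂.add_mem hc h)
    have hfin : (ε : 𝓞 F) * n ^ 2 * π₁ ^ m - c ^ 2 ∈ 𝔭₂ := by
      rw [← hP2c, Ideal.mem_comap, map_sub, ← heq, map_pow]
      have := P₂.add_mem (P₂.mul_mem_right
        ((RingOfIntegers.mapAlgEquiv σ : 𝓞 k ≃ₐ[𝓞 F] 𝓞 k) γ) hc)
        (P₂.mul_mem_left (algebraMap (𝓞 F) (𝓞 k) c) hsc)
      convert this using 1
      ring
    have he := hprim2 ε
    unfold quadResSym at he hsym
    split_ifs at he with he'
    split_ifs at hsym with hs'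
    exact nr_aux 𝔭₂ hp2 hN2 ε he' π₁ hs' c n m hm hcn hfin

end Scholz

/-- In the two-ramified-primes situation with `𝔭₁, 𝔭₂` primary and
`(𝔭₁/𝔭₂) = [π₁/𝔭₂] = -1`, the class number of `k` is `≡ 2 mod 4` and every unit
of `F` is the norm of a unit of `k`. -/
theorem scholz_case_nonresidue
    (F : Type*) [Field F] [NumberField F]
    (hoddF : Odd (NumberField.classNumber F))
    (k : Type*) [Field k] [NumberField k] [Algebra F k]
    (hdeg : Module.finrank F k = 2)
    (𝔭₁ 𝔭₂ : Ideal (𝓞 F)) (hp1 : 𝔭₁.IsPrime) (hp2 : 𝔭₂.IsPrime) (hne : 𝔭₁ ≠ 𝔭₂)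
    (hN1 : Odd (Ideal.absNorm 𝔭₁)) (hN2 : Odd (Ideal.absNorm 𝔭₂))
    (hram : ∀ 𝔭 : Ideal (𝓞 F), 𝔭.IsPrime → 𝔭 ≠ ⊥ →
      (IsRamifiedIn F k 𝔭 ↔ 𝔭 = 𝔭₁ ∨ 𝔭 = 𝔭₂))
    (hinf : UnramifiedAtInfinitePlaces F k)
    (hprim1 : IsPrimaryIdeal F 𝔭₁) (hprim2 : IsPrimaryIdeal F 𝔭₂)
    (π₁ : 𝓞 F) (hπ₁ : IsPrimaryElem F π₁)
    (hgen1 : 𝔭₁ ^ NumberField.classNumber F = Ideal.span {π₁})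
    (hsym : quadResSym F 𝔭₂ π₁ = -1)
    : NumberField.classNumber k % 4 = 2 ∧ relUnitNormRange F k = ⊤ := by
  obtain ⟨σ, hσ, hall, hσσ⟩ := Scholz.exists_sigma F k hdeg
  obtain ⟨P₁, P₂, S⟩ := Scholz.concrete_setup F hoddF k hdeg 𝔭₁ 𝔭₂ hp1 hp2 hne hN1 hN2 hram hprim2
    π₁ hgen1 hsym σ hσ hall hσσ
  have hn := Scholz.norm_eq hdeg σ hσ hall
  have hsurj : Function.Surjective (Units.map (RingOfIntegers.norm F : 𝓞 k →* 𝓞 F)) := by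
    refine Scholz.herbrand
      (Scholz.sU (RingOfIntegers.mapAlgEquiv σ : 𝓞 k ≃ₐ[𝓞 F] 𝓞 k))
      (Units.map (algebraMap (𝓞 F) (𝓞 k) : 𝓞 F →* 𝓞 k))
      (Units.map (RingOfIntegers.norm F : 𝓞 k →* 𝓞 F)) ?_ ?_ ?_ ?_ (-1) ?_ ?_ ?_ (-1) ?_
      (Scholz.rank_eq F k hdeg hinf) ?_
    · exact Units.map_injective S.inj
    · intro x
      ext1
      simpa [Scholz.sU_coe] using (hn x).symm
    · intro x
      ext1
      simpa [Scholz.sU_coe] using S.inv x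
    · intro x
      constructor
      · intro hx
        have h1 : (RingOfIntegers.mapAlgEquiv σ : 𝓞 k ≃ₐ[𝓞 F] 𝓞 k) x = x := by
          have := congrArg Units.val hx
          rwa [Scholz.sU_coe] at this
        have h2 : (RingOfIntegers.mapAlgEquiv σ : 𝓞 k ≃ₐ[𝓞 F] 𝓞 k) (x⁻¹ : (𝓞 k)ˣ) =
            (x⁻¹ : (𝓞 k)ˣ) := by
          have := congrArg (fun z : (𝓞 k)ˣ => ((z⁻¹ : (𝓞 k)ˣ) : 𝓞 k)) hx
          rwa [← map_inv, Scholz.sU_coe] at this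
        obtain ⟨a, ha⟩ := S.fix _ h1
        obtain ⟨b, hb⟩ := S.fix _ h2
        have hab : a * b = 1 := S.inj (by rw [map_mul, ha, hb, map_one, Units.mul_inv])
        exact ⟨Units.mkOfMulEqOne a b hab, Units.ext ha⟩
      · rintro ⟨a, rfl⟩
        ext1
        rw [Scholz.sU_coe]
        exact AlgEquiv.commutes _ _
    · intro h
      have := congrArg Units.val h
      simp at this
      norm_num [neg_eq_iff_add_eq_zero] at this
    · simp
    · ext1
      simp [Scholz.sU_coe]
    · intro x hx
      have h1 : (x : 𝓞 F) ^ 2 = 1 := by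
        have := congrArg Units.val hx
        simpa using this
      rcases (sq_eq_sq_iff_eq_or_eq_neg.mp (h1.trans (one_pow 2).symm)) with h | h
      · exact Or.inl (Units.ext h)
      · exact Or.inr (Units.ext (by simpa using h))
    · intro e he
      rw [neg_one_mul]
      exact S.H1 e he
  have htop : relUnitNormRange F k = ⊤ := MonoidHom.range_eq_top.mpr hsurj
  refine ⟨?_, htop⟩
  have hc := S.card (fun ε => by
    obtain ⟨u, hu⟩ := hsurj ε
    refine ⟨u, ?_⟩
    rw [hn, ← hu]
    rfl)
  rwa [Nat.card_eq_fintype_card] at hc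
end

section
/- Let F be a number field with odd class number and unit group E_F, and let k/F be a quadratic extension in which exactly two prime ideals 𝔭₁ and 𝔭₂ of odd norm ramify (both not primary, i.e. (E_F/𝔭₁) = (E_F/𝔭₂) = −1), and which is unramified at all primes above 2 and at all infinite places. Then the class number h of k is odd and (E_F : N_{k/F}E_k) = 2. -/
open NumberField
open scoped Classical

lemma aux_two_index_equiv {G H : Type*} [AddCommGroup G] [AddCommGroup H] (e : G ≃+ H) :
    (nsmulAddMonoidHom (α := G) 2).range.index = (nsmulAddMonoidHom (α := H) 2).range.index ∧
    Nat.card (nsmulAddMonoidHom (α := G) 2).ker = Nat.card (nsmulAddMonoidHom (α := H) 2).ker := by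
  constructor
  · rw [← AddSubgroup.index_map_equiv _ e]
    congr 1
    ext x
    simp only [AddSubgroup.mem_map, AddMonoidHom.mem_range, nsmulAddMonoidHom_apply]
    constructor
    · rintro ⟨_, ⟨y, rfl⟩, rfl⟩
      exact ⟨e y, by simp⟩
    · rintro ⟨y, rfl⟩
      exact ⟨_, ⟨e.symm y, rfl⟩, by simp⟩
  · apply Nat.card_congr
    refine e.toEquiv.subtypeEquiv ?_
    intro a
    simp only [AddMonoidHom.mem_ker, nsmulAddMonoidHom_apply]
    rw [← e.map_eq_zero_iff]
    simp

lemma aux_two_index_prod (X T : Type*) [AddCommGroup X] [Module.Finite ℤ X] [Module.Free ℤ X]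
    [AddCommGroup T] [Finite T] :
    (nsmulAddMonoidHom (α := X × T) 2).range.index =
      2 ^ Module.finrank ℤ (X × T) * Nat.card (nsmulAddMonoidHom (α := X × T) 2).ker ∧
    Nat.card (nsmulAddMonoidHom (α := X × T) 2).ker ≠ 0 := by
  have hker : Nat.card (nsmulAddMonoidHom (α := X × T) 2).ker =
      Nat.card (nsmulAddMonoidHom (α := T) 2).ker := by
    apply Nat.card_congr
    have : IsAddTorsionFree X := Module.isTorsionFree_int_iff_isAddTorsionFree.mp inferInstance
    refine ⟨fun x => ⟨x.1.2, ?_⟩, fun y => ⟨(0, y.1), ?_⟩, ?_, ?_⟩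
    · have := x.2
      simp only [AddMonoidHom.mem_ker, nsmulAddMonoidHom_apply] at this ⊢
      exact congrArg Prod.snd this
    · have := y.2
      simp only [AddMonoidHom.mem_ker, nsmulAddMonoidHom_apply] at this ⊢
      ext <;> simp [this]
    · rintro ⟨⟨x, t⟩, h⟩
      simp only [AddMonoidHom.mem_ker, nsmulAddMonoidHom_apply] at h
      have h1 : 2 • x = 0 := congrArg Prod.fst h
      have h2 : x = 0 := by simpa using h1
      simp [h2]
    · rintro ⟨y, h⟩
      rfl
  have hrange : (nsmulAddMonoidHom (α := X × T) 2).range =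
      (nsmulAddMonoidHom (α := X) 2).range.prod (nsmulAddMonoidHom (α := T) 2).range := by
    ext ⟨x, t⟩
    simp only [AddMonoidHom.mem_range, nsmulAddMonoidHom_apply, AddSubgroup.mem_prod]
    constructor
    · rintro ⟨⟨a, b⟩, h⟩
      exact ⟨⟨a, congrArg Prod.fst h⟩, ⟨b, congrArg Prod.snd h⟩⟩
    · rintro ⟨⟨a, h⟩, ⟨b, h'⟩⟩
      exact ⟨(a, b), Prod.ext h h'⟩
  have hr : Module.finrank ℤ (X × T) = Module.finrank ℤ X := by
    have h0 : Module.finrank ℤ T = 0 := by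
      rw [Module.finrank_eq_zero_iff]
      intro x
      refine ⟨(addOrderOf x : ℤ), ?_, ?_⟩
      · exact_mod_cast (addOrderOf_pos x).ne'
      · rw [natCast_zsmul, addOrderOf_nsmul_eq_zero]
    have := Submodule.finrank_quotient_add_finrank (LinearMap.ker (LinearMap.fst ℤ X T))
    have e1 := ((LinearMap.fst ℤ X T).quotKerEquivOfSurjective LinearMap.fst_surjective).finrank_eq
    have e2 : Module.finrank ℤ (LinearMap.ker (LinearMap.fst ℤ X T)) = Module.finrank ℤ T := by
      rw [LinearMap.ker_fst]
      exact LinearMap.finrank_range_of_inj LinearMap.inr_injective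
    rw [← this, e1, e2, h0, add_zero]
  refine ⟨?_, ?_⟩
  · rw [hker, hrange, AddSubgroup.index_prod, hr, AddSubgroup.index_range_nsmul,
      AddSubgroup.index_range]
  · rw [hker]
    exact Nat.card_pos.ne'

lemma aux_two_index (A : Type*) [AddCommGroup A] [Module.Finite ℤ A] :
    (nsmulAddMonoidHom (α := A) 2).range.index =
      2 ^ Module.finrank ℤ A * Nat.card (nsmulAddMonoidHom (α := A) 2).ker ∧
    Nat.card (nsmulAddMonoidHom (α := A) 2).ker ≠ 0 := by
  have : AddGroup.FG A := Module.Finite.iff_addGroup_fg.mp inferInstance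
  obtain ⟨n, ι, _, p, hp, e, ⟨f⟩⟩ := AddCommGroup.equiv_free_prod_directSum_zmod A
  have hne : ∀ i, NeZero (p i ^ e i) := fun i => ⟨pow_ne_zero _ (hp i).ne_zero⟩
  have hT : Finite (DirectSum ι fun i => ZMod (p i ^ e i)) :=
    Finite.of_equiv _ DFinsupp.equivFunOnFintype.symm
  obtain ⟨h1, h2⟩ := aux_two_index_equiv f
  rw [h1, h2, f.toIntLinearEquiv.finrank_eq]
  exact aux_two_index_prod _ _

/-- Herbrand quotient inequality -/
lemma aux_herbrand (A : Type*) [AddCommGroup A] [Module.Finite ℤ A] (s : A →+ A)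
    (hs : ∀ a, s (s a) = a) (P M NA DA : AddSubgroup A)
    (hP : ∀ a, a ∈ P ↔ s a = a) (hM : ∀ a, a ∈ M ↔ a + s a = 0)
    (hNA : ∀ a, a ∈ NA ↔ ∃ b, b + s b = a) (hDA : ∀ a, a ∈ DA ↔ ∃ b, b - s b = a)
    (hr : 2 * Module.finrank ℤ P + 1 ≤ Module.finrank ℤ A) :
    2 * NA.relIndex P ≤ DA.relIndex M ∧ DA.relIndex M ≠ 0 ∧ NA.relIndex P ≠ 0 := by
  let f : A →+ A := AddMonoidHom.id A - s
  let g : A →+ A := AddMonoidHom.id A + s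
  have hfP : f.ker = P := by
    ext a; rw [hP, AddMonoidHom.mem_ker]; simp only [f, AddMonoidHom.sub_apply, AddMonoidHom.id_apply, sub_eq_zero]
    exact eq_comm
  have hgM : g.ker = M := by
    ext a; rw [hM, AddMonoidHom.mem_ker]; rfl
  have hfD : AddSubgroup.map f ⊤ = DA := by
    ext a; rw [hDA]; simp [f]
  have hgN : AddSubgroup.map g ⊤ = NA := by
    ext a; rw [hNA]; simp [g]
  have hNP : NA ≤ P := by
    intro a ha
    obtain ⟨b, rfl⟩ := (hNA a).1 ha
    rw [hP, map_add, hs, add_comm]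
  have hDM : DA ≤ M := by
    intro a ha
    obtain ⟨b, rfl⟩ := (hDA a).1 ha
    rw [hM, map_sub, hs]; abel
  have hfM : AddSubgroup.map f M = M.map (nsmulAddMonoidHom 2) := by
    ext a
    simp only [AddSubgroup.mem_map]
    refine exists_congr fun b => and_congr_right fun hb => ?_
    have : s b = -b := by rw [hM] at hb; rw [eq_neg_iff_add_eq_zero, add_comm]; exact hb
    simp [f, this, two_nsmul]
  have hgP : AddSubgroup.map g P = P.map (nsmulAddMonoidHom 2) := by
    ext a
    simp only [AddSubgroup.mem_map]
    refine exists_congr fun b => and_congr_right fun hb => ?_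
    have : s b = b := by rwa [hP] at hb
    simp [g, this, two_nsmul]
  have e1 : (M.map (nsmulAddMonoidHom 2)).relIndex DA = (P ⊔ M).index := by
    rw [← hfM, ← hfD, AddSubgroup.relIndex_map_map, hfP, top_sup_eq, AddSubgroup.relIndex_top_right, sup_comm]
  have e2 : (P.map (nsmulAddMonoidHom 2)).relIndex NA = (P ⊔ M).index := by
    rw [← hgP, ← hgN, AddSubgroup.relIndex_map_map, hgM, top_sup_eq, AddSubgroup.relIndex_top_right]
  have l1 : M.map (nsmulAddMonoidHom 2) ≤ DA := by
    rw [← hfM, ← hfD]; exact AddSubgroup.map_mono le_top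
  have l2 : P.map (nsmulAddMonoidHom 2) ≤ NA := by
    rw [← hgP, ← hgN]; exact AddSubgroup.map_mono le_top
  have t1 := AddSubgroup.relIndex_mul_relIndex _ _ _ l1 hDM
  have t2 := AddSubgroup.relIndex_mul_relIndex _ _ _ l2 hNP
  have key : ∀ S : AddSubgroup A, (S.map (nsmulAddMonoidHom 2)).relIndex S =
      2 ^ Module.finrank ℤ S * Nat.card (nsmulAddMonoidHom (α := S) 2).ker ∧
      Nat.card (nsmulAddMonoidHom (α := S) 2).ker ≠ 0 := by
    intro S
    have : Module.Finite ℤ S := inferInstanceAs (Module.Finite ℤ (AddSubgroup.toIntSubmodule S))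
    refine ⟨?_, (aux_two_index S).2⟩
    rw [← (aux_two_index S).1, AddSubgroup.relIndex,
      AddSubgroup.addSubgroupOf_map_nsmulAddMonoidHom_eq_range]
  have hker : Nat.card (nsmulAddMonoidHom (α := P) 2).ker =
      Nat.card (nsmulAddMonoidHom (α := M) 2).ker := by
    have hPM : ∀ a : A, 2 • a = 0 → (a ∈ P ↔ a ∈ M) := by
      intro a ha
      rw [hP, hM]
      rw [two_nsmul] at ha
      have : a = -a := by rw [eq_neg_iff_add_eq_zero]; exact ha
      conv_rhs => rw [add_comm, ← eq_neg_iff_add_eq_zero, ← this]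
    apply Nat.card_congr
    refine ⟨fun x => ⟨⟨x.1.1, ?_⟩, ?_⟩, fun x => ⟨⟨x.1.1, ?_⟩, ?_⟩, fun x => rfl, fun x => rfl⟩
    · have := x.2
      rw [AddMonoidHom.mem_ker, nsmulAddMonoidHom_apply, Subtype.ext_iff] at this
      exact (hPM _ this).1 x.1.2
    · have := x.2
      rw [AddMonoidHom.mem_ker, nsmulAddMonoidHom_apply, Subtype.ext_iff] at this ⊢
      exact this
    · have := x.2
      rw [AddMonoidHom.mem_ker, nsmulAddMonoidHom_apply, Subtype.ext_iff] at this
      exact (hPM _ this).2 x.1.2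
    · have := x.2
      rw [AddMonoidHom.mem_ker, nsmulAddMonoidHom_apply, Subtype.ext_iff] at this ⊢
      exact this
  have hrk : Module.finrank ℤ P + 1 ≤ Module.finrank ℤ M := by
    let fl : A →ₗ[ℤ] A := f.toIntLinearMap
    have h1 := Submodule.finrank_quotient_add_finrank (LinearMap.ker fl)
    rw [fl.quotKerEquivRange.finrank_eq] at h1
    have h2 : Module.finrank ℤ (LinearMap.ker fl) = Module.finrank ℤ P := by
      rw [← hfP]; rfl
    have h3 : Module.finrank ℤ (LinearMap.range fl) ≤ Module.finrank ℤ M := by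
      have hle : LinearMap.range fl ≤ AddSubgroup.toIntSubmodule M := by
        rintro _ ⟨b, rfl⟩
        exact hDM ((hDA _).2 ⟨b, rfl⟩)
      exact Submodule.finrank_mono hle
    omega
  have kP := key P
  have kM := key M
  rw [kP.1, e2, hker] at t2
  rw [kM.1, e1] at t1
  have hc := kM.2
  set c := Nat.card (nsmulAddMonoidHom (α := M) 2).ker
  set i := (P ⊔ M).index
  have hpos : 0 < 2 ^ Module.finrank ℤ M * c := by positivity
  have hi : 0 < i := by
    rcases Nat.eq_zero_or_pos i with h | h
    · rw [h, zero_mul] at t1; omega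
    · exact h
  refine ⟨?_, ?_, ?_⟩
  · have : i * (2 * NA.relIndex P) ≤ i * DA.relIndex M := by
      rw [t1]
      calc i * (2 * NA.relIndex P) = 2 * (2 ^ Module.finrank ℤ P * c) := by rw [← t2]; ring
        _ = 2 ^ (Module.finrank ℤ P + 1) * c := by ring
        _ ≤ _ := Nat.mul_le_mul_right _ (Nat.pow_le_pow_right (by norm_num) hrk)
    exact Nat.le_of_mul_le_mul_left this hi
  · intro h
    rw [h, mul_zero] at t1; omega
  · intro h
    rw [h, mul_zero] at t2
    have : 0 < 2 ^ Module.finrank ℤ P * c := by positivity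
    omega

structure QS {R S : Type*} [CommRing R] [CommRing S] [Algebra R S] (N : S →* R) (s : S ≃+* S) :
    Prop where
  invol : ∀ x, s (s x) = x
  norm : ∀ x, x * s x = algebraMap R S (N x)
  fixR : ∀ a : R, s (algebraMap R S a) = algebraMap R S a
  fixed : ∀ x, s x = x → ∃ a : R, algebraMap R S a = x
  nontriv : ∃ x, s x ≠ x

lemma aux_galois (F k : Type*) [Field F] [NumberField F] [Field k] [NumberField k] [Algebra F k]
    (hdeg : Module.finrank F k = 2) : IsGalois F k := by
  have : Algebra.IsQuadraticExtension F k := ⟨hdeg⟩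
  infer_instance

lemma aux_setup (F k : Type*) [Field F] [NumberField F] [Field k] [NumberField k] [Algebra F k]
    (hdeg : Module.finrank F k = 2) :
    ∃ s : 𝓞 k ≃+* 𝓞 k, QS (RingOfIntegers.norm F : 𝓞 k →* 𝓞 F) s := by
  have := aux_galois F k hdeg
  have hc : Fintype.card (k ≃ₐ[F] k) = 2 := by
    rw [← Nat.card_eq_fintype_card, IsGalois.card_aut_eq_finrank, hdeg]
  obtain ⟨σ, hσ, huniv⟩ : ∃ σ : k ≃ₐ[F] k, σ ≠ 1 ∧ ∀ τ : k ≃ₐ[F] k, τ = 1 ∨ τ = σ := by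
    have h2 : (Finset.univ : Finset (k ≃ₐ[F] k)).card = 2 := by rw [Finset.card_univ, hc]
    obtain ⟨x, hx, hx'⟩ := Finset.card_eq_two.1 h2
    obtain ⟨hxx, hu⟩ := hx'
    have hm : ∀ τ : k ≃ₐ[F] k, τ = x ∨ τ = hx := fun τ => by
      have := Finset.mem_univ τ
      rw [hu] at this
      simpa using this
    rcases hm 1 with h | h
    · exact ⟨hx, by rw [h]; exact hxx.symm, by rw [h]; exact hm⟩
    · exact ⟨x, by rw [h]; exact hxx, by rw [h]; exact fun τ => (hm τ).symm⟩
  have hσ2 : σ * σ = 1 := by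
    rcases huniv (σ * σ) with h | h
    · exact h
    · exact absurd (mul_eq_left.1 h) hσ
  have hinv : ∀ x, σ (σ x) = x := fun x => by
    rw [← AlgEquiv.mul_apply, hσ2, AlgEquiv.one_apply]
  have huv : (Finset.univ : Finset (k ≃ₐ[F] k)) = {1, σ} := by
    ext τ; simpa using huniv τ
  refine ⟨RingOfIntegers.mapRingEquiv σ.toRingEquiv, ?_, ?_, ?_, ?_, ?_⟩
  · intro x
    apply RingOfIntegers.ext
    simp only [RingOfIntegers.mapRingEquiv_apply]
    exact hinv _
  · intro x
    apply RingOfIntegers.ext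
    rw [RingOfIntegers.coe_algebraMap_norm, Algebra.norm_eq_prod_automorphisms, huv,
      Finset.prod_pair hσ.symm]
    rfl
  · intro a
    apply RingOfIntegers.ext
    rw [RingOfIntegers.mapRingEquiv_apply]
    exact σ.commutes (a : F)
  · intro x hx
    have hx' : σ (x : k) = x := by
      have := congrArg (fun y : 𝓞 k => (y : k)) hx
      exact this
    have : (x : k) ∈ Set.range (algebraMap F k) := by
      rw [IsGalois.mem_range_algebraMap_iff_fixed]
      intro τ
      rcases huniv τ with h | h
      · rw [h]; rfl
      · rw [h]; exact hx'
    obtain ⟨a, ha⟩ := this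
    have hint : IsIntegral ℤ a := by
      have h1 : IsIntegral ℤ (algebraMap F k a) := by rw [ha]; exact RingOfIntegers.isIntegral_coe x
      exact (isIntegral_algebraMap_iff (algebraMap F k).injective).1 h1
    refine ⟨⟨a, hint⟩, ?_⟩
    apply RingOfIntegers.ext
    exact ha
  · by_contra hcon
    push Not at hcon
    apply hσ
    ext x
    obtain ⟨a, b, hb, rfl⟩ := IsFractionRing.div_surjective (A := 𝓞 k) x
    have h1 : ∀ y : 𝓞 k, σ (algebraMap (𝓞 k) k y) = algebraMap (𝓞 k) k y := fun y =>
      congrArg (fun y : 𝓞 k => (y : k)) (hcon y)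
    rw [map_div₀, h1, h1]; rfl

lemma aux_places (F k : Type*) [Field F] [NumberField F] [Field k] [NumberField k] [Algebra F k]
    (hdeg : Module.finrank F k = 2) (hinf : UnramifiedAtInfinitePlaces F k) :
    2 * NumberField.Units.rank F + 1 = NumberField.Units.rank k := by
  have := aux_galois F k hdeg
  have : IsUnramifiedAtInfinitePlaces F k := by
    constructor
    intro w
    by_contra hw
    rw [InfinitePlace.not_isUnramified_iff] at hw
    obtain ⟨hwc, hwr⟩ := hw
    set v := w.comap (algebraMap F k) with hv
    have hr := InfinitePlace.isReal_iff.1 hwr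
    obtain ⟨ψ, hψ⟩ := hinf hr.embedding
    let w' : InfinitePlace k := InfinitePlace.mk ((algebraMap ℝ ℂ).comp ψ)
    have hw' : w'.comap (algebraMap F k) = v := by
      rw [InfinitePlace.comap_mk, RingHom.comp_assoc, hψ]
      conv_rhs => rw [← InfinitePlace.mk_embedding v]
      congr 1
      ext x
      exact ComplexEmbedding.IsReal.coe_embedding_apply hr x
    obtain ⟨σ, hσ⟩ := InfinitePlace.exists_smul_eq_of_comap_eq (hw'.trans hv)
    have hwr' : w'.IsReal := by
      refine ⟨_, ?_, rfl⟩
      rw [ComplexEmbedding.isReal_iff]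
      ext x
      simp [ComplexEmbedding.conjugate]
    rw [← hσ, InfinitePlace.isComplex_smul_iff] at hwc
    exact InfinitePlace.not_isReal_iff_isComplex.2 hwc hwr'
  have h := IsUnramifiedAtInfinitePlaces.card_infinitePlace F k
  rw [hdeg] at h
  unfold NumberField.Units.rank
  have : 0 < Fintype.card (InfinitePlace F) := Fintype.card_pos
  omega

lemma aux_finrank (F k : Type*) [Field F] [NumberField F] [Field k] [NumberField k] [Algebra F k]
    (hdeg : Module.finrank F k = 2) : Module.finrank (𝓞 F) (𝓞 k) = 2 := by
  rw [← hdeg]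
  exact (IsFractionRing.finrank_eq (𝓞 F) F (𝓞 k) k).symm

section QSlemmas
set_option linter.unusedSectionVars false
variable {R S : Type*} [CommRing R] [CommRing S] [IsDedekindDomain S] [Algebra R S]
  {N : S →* R} {s : S ≃+* S}

lemma QS.mem_map (h : QS N s) (J : Ideal S) (x : S) : x ∈ J.map s ↔ s x ∈ J := by
  rw [Ideal.mem_map_of_equiv]
  constructor
  · rintro ⟨y, hy, rfl⟩
    rwa [h.invol]
  · intro hx
    exact ⟨s x, hx, h.invol x⟩

lemma QS.map_map (h : QS N s) (J : Ideal S) : (J.map s).map s = J := by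
  ext x; rw [h.mem_map, h.mem_map, h.invol]

lemma QS.map_algebraMap (h : QS N s) (I : Ideal R) :
    (I.map (algebraMap R S)).map s = I.map (algebraMap R S) := by
  have : (s : S →+* S).comp (algebraMap R S) = algebraMap R S := RingHom.ext h.fixR
  have h2 : (I.map (algebraMap R S)).map (s : S →+* S) = I.map (algebraMap R S) := by
    rw [Ideal.map_map, this]
  exact h2

lemma QS.h90 (h : QS N s) (x y : S) (hx : x ≠ 0) (hy : y ≠ 0) (hxy : x * s x = y * s y) :
    ∃ β, β ≠ 0 ∧ x * s β = y * β := by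
  have hsy : s y ≠ 0 := by simpa using hy
  have key : ∀ c, x * s (s y * (y * c + x * s c)) = y * (s y * (y * c + x * s c)) := by
    intro c
    simp only [map_mul, map_add, h.invol]
    linear_combination (c * y) * hxy
  by_cases h1 : y + x = 0
  · obtain ⟨θ, hθ⟩ := h.nontriv
    refine ⟨_, ?_, key θ⟩
    refine mul_ne_zero hsy ?_
    have : y * θ + x * s θ = x * (s θ - θ) := by linear_combination θ * h1
    rw [this]
    exact mul_ne_zero hx (sub_ne_zero.2 hθ)
  · refine ⟨_, ?_, key 1⟩
    refine mul_ne_zero hsy ?_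
    simpa using h1

lemma QS.trans (h : QS N s) (Q Q' : Ideal S) [hQ : Q.IsPrime] [hQ' : Q'.IsMaximal]
    (hc : Q.comap (algebraMap R S) = Q'.comap (algebraMap R S)) : Q' = Q ∨ Q' = Q.map s := by
  have hprime : (Q.map s).IsPrime := Ideal.map_isPrime_of_equiv s
  have hsub : (Q' : Set S) ⊆ Q ∪ (Q.map s : Ideal S) := by
    intro x hx
    have h1 : algebraMap R S (N x) ∈ Q' := by
      rw [← h.norm]; exact Q'.mul_mem_right _ hx
    have h2 : algebraMap R S (N x) ∈ Q := by
      have : N x ∈ Q'.comap (algebraMap R S) := h1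
      rw [← hc] at this; exact this
    rw [← h.norm] at h2
    rcases hQ.mem_or_mem h2 with h3 | h3
    · exact Or.inl h3
    · exact Or.inr ((h.mem_map _ _).2 h3)
  rcases Ideal.subset_union.1 hsub with h1 | h1
  · exact Or.inl (hQ'.eq_of_le hQ.ne_top h1)
  · exact Or.inr (hQ'.eq_of_le hprime.ne_top h1)

lemma QS.N_ne_zero (h : QS N s) {x : S} (hx : x ≠ 0) : N x ≠ 0 := by
  intro h0
  have := h.norm x
  rw [h0, map_zero] at this
  rcases mul_eq_zero.1 this with h1 | h1
  · exact hx h1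
  · exact hx (by simpa using h1)

lemma aux_lt {X J' : Ideal S} (hX : X ≠ ⊤) (hJ : X * J' ≠ ⊥) : X * J' < J' := by
  refine lt_of_le_of_ne Ideal.mul_le_right ?_
  intro he
  apply hX
  have hJ' : J' ≠ 0 := by rintro rfl; simp at hJ
  have : X * J' = 1 * J' := by rw [he, one_mul]
  have := mul_right_cancel₀ hJ' this
  rw [this, Ideal.one_eq_top]

lemma QS.inv_of_mul (_ : QS N s) {X J' : Ideal S} (hX : X.map s = X) (hX0 : X ≠ ⊥)
    (hJ : (X * J').map s = X * J') : J'.map s = J' := by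
  rw [Ideal.map_mul, hX] at hJ
  exact mul_left_cancel₀ hX0 hJ

lemma QS.invariant_ideal (h : QS N s) [IsDedekindDomain R] (hinj : Function.Injective (algebraMap R S))
    (p1 p2 : Ideal R) (P1 P2 : Ideal S) [P1.IsMaximal] [P2.IsMaximal]
    (hP1 : p1.map (algebraMap R S) = P1 ^ 2) (hP2 : p2.map (algebraMap R S) = P2 ^ 2)
    (hs1 : P1.map s = P1) (hs2 : P2.map s = P2) (h10 : P1 ≠ ⊥) (h20 : P2 ≠ ⊥)
    (hunr : ∀ q : Ideal R, q.IsPrime → q ≠ ⊥ → q ≠ p1 → q ≠ p2 → ∀ Q : Ideal S, Q.IsPrime →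
      ¬ Q ^ 2 ∣ q.map (algebraMap R S)) (J : Ideal S) (hJ : J ≠ ⊥) (hJs : J.map s = J) :
    ∃ (a b : ℕ) (c : Ideal R), c ≠ ⊥ ∧ J = P1 ^ a * P2 ^ b * c.map (algebraMap R S) := by
  induction J using WellFoundedGT.induction with
  | ind J ih =>
  by_cases hJt : J = ⊤
  · refine ⟨0, 0, ⊤, ?_, ?_⟩
    · exact top_ne_bot
    · rw [Ideal.map_top, hJt]; simp
  obtain ⟨Q, hQ, hJQ⟩ := Ideal.exists_le_maximal J hJt
  have hQ0 : Q ≠ ⊥ := by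
    rintro rfl
    exact hJ (le_bot_iff.1 hJQ)
  set q := Q.comap (algebraMap R S) with hq
  have hqp : q.IsPrime := Ideal.comap_isPrime _ _
  have hmQ : q.map (algebraMap R S) ≤ Q := Ideal.map_comap_le
  have hq0 : q ≠ ⊥ := by
    obtain ⟨x, hxQ, hx⟩ := Submodule.exists_mem_ne_zero_of_ne_bot hQ0
    intro hb
    have : N x ∈ q := by
      rw [hq, Ideal.mem_comap, ← h.norm]; exact Q.mul_mem_right _ hxQ
    rw [hb] at this
    exact h.N_ne_zero hx (by simpa using this)
  by_cases h1 : q = p1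
  · have hPQ : P1 = Q := by
      have : P1 ≤ Q := by
        rw [h1, hP1] at hmQ
        exact (Ideal.IsPrime.pow_le_iff two_ne_zero).1 hmQ
      exact Ideal.IsMaximal.eq_of_le ‹P1.IsMaximal› hQ.ne_top this
    obtain ⟨J', hJ'⟩ := Ideal.dvd_iff_le.2 hJQ
    rw [← hPQ] at hJ'
    have hlt : J < J' := by
      rw [hJ']; exact aux_lt (Ideal.IsPrime.ne_top inferInstance) (by rwa [← hJ'])
    have hinv' : J'.map s = J' := h.inv_of_mul hs1 h10 (by rwa [← hJ'])
    obtain ⟨a, b, c, hc, he⟩ := ih J' hlt hlt.ne_bot hinv'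
    exact ⟨a + 1, b, c, hc, by rw [hJ', he]; ring⟩
  by_cases h2 : q = p2
  · have hPQ : P2 = Q := by
      have : P2 ≤ Q := by
        rw [h2, hP2] at hmQ
        exact (Ideal.IsPrime.pow_le_iff two_ne_zero).1 hmQ
      exact Ideal.IsMaximal.eq_of_le ‹P2.IsMaximal› hQ.ne_top this
    obtain ⟨J', hJ'⟩ := Ideal.dvd_iff_le.2 hJQ
    rw [← hPQ] at hJ'
    have hlt : J < J' := by
      rw [hJ']; exact aux_lt (Ideal.IsPrime.ne_top inferInstance) (by rwa [← hJ'])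
    have hinv' : J'.map s = J' := h.inv_of_mul hs2 h20 (by rwa [← hJ'])
    obtain ⟨a, b, c, hc, he⟩ := ih J' hlt hlt.ne_bot hinv'
    exact ⟨a, b + 1, c, hc, by rw [hJ', he]; ring⟩
  have hun := hunr q hqp hq0 h1 h2
  have hm0 : q.map (algebraMap R S) ≠ ⊥ := by
    rwa [Ne, Ideal.map_eq_bot_iff_of_injective hinj]
  have hdvd : q.map (algebraMap R S) ∣ J := by
    rw [UniqueFactorizationMonoid.dvd_iff_normalizedFactors_le_normalizedFactors hm0 hJ]
    have hnd : (UniqueFactorizationMonoid.normalizedFactors (q.map (algebraMap R S))).Nodup := by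
      rw [← UniqueFactorizationMonoid.squarefree_iff_nodup_normalizedFactors hm0,
        squarefree_iff_irreducible_sq_not_dvd_of_ne_zero hm0]
      intro X hX hd
      rw [← pow_two] at hd
      exact hun X (Ideal.isPrime_of_prime hX.prime) hd
    rw [Multiset.le_iff_subset hnd]
    intro X hX
    rw [Ideal.mem_normalizedFactors_iff hm0] at hX
    rw [Ideal.mem_normalizedFactors_iff hJ]
    refine ⟨hX.1, ?_⟩
    have hXp := hX.1
    have hcX : Q.comap (algebraMap R S) = X.comap (algebraMap R S) := by
      have hle : q ≤ X.comap (algebraMap R S) := Ideal.map_le_iff_le_comap.1 hX.2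
      have : q.IsMaximal := hqp.isMaximal hq0
      exact this.eq_of_le (Ideal.comap_isPrime _ _).ne_top hle
    have hX0 : X ≠ ⊥ := by
      rintro rfl
      exact hm0 (le_bot_iff.1 hX.2)
    have hXm : X.IsMaximal := hXp.isMaximal hX0
    rcases h.trans Q X hcX with e | e
    · rw [e]; exact hJQ
    · rw [e, ← hJs]; exact Ideal.map_mono hJQ
  obtain ⟨J', hJ'⟩ := hdvd
  have hlt : J < J' := by
    rw [hJ']
    refine aux_lt ?_ (by rwa [← hJ'])
    intro ht
    exact hQ.ne_top (top_le_iff.1 (ht ▸ hmQ))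
  have hinv' : J'.map s = J' := h.inv_of_mul (h.map_algebraMap q) hm0 (by rwa [← hJ'])
  obtain ⟨a, b, c, hc, he⟩ := ih J' hlt hlt.ne_bot hinv'
  refine ⟨a, b, q * c, ?_, by rw [hJ', he, Ideal.map_mul]; ring⟩
  exact mul_ne_zero hq0 hc

lemma QS.unit_of (h : QS N s) (n : ℕ) (hn : Odd n) (c : Ideal R) (hc : (c ^ n).IsPrincipal)
    (β : S) (hβ : β ≠ 0) (hβc : Ideal.span {β} = c.map (algebraMap R S)) (η : Sˣ)
    (hη : β = η * s β) : ∃ u : Sˣ, (u : S) = η * s u := by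
  obtain ⟨m, rfl⟩ := hn
  obtain ⟨d, hd⟩ := hc
  have h1 : Ideal.span {β ^ (2 * m + 1)} = Ideal.span {algebraMap R S d} := by
    rw [← Ideal.span_singleton_pow, hβc, ← Ideal.map_pow, hd, Ideal.submodule_span_eq,
      Ideal.map_span, Set.image_singleton]
  rw [Ideal.span_singleton_eq_span_singleton] at h1
  obtain ⟨u, hu⟩ := h1.symm
  have h2 : β ^ 2 = η * algebraMap R S (N β) := by
    rw [← h.norm]; nth_rewrite 1 [pow_two, hη]; ring
  have h3 : β * (algebraMap R S (N β)) ^ m = algebraMap R S d * (u * (η⁻¹ ^ m : Sˣ)) := by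
    have : β ^ (2 * m + 1) = β * (η ^ m * (algebraMap R S (N β)) ^ m) := by
      rw [pow_succ, pow_mul, h2]; ring
    rw [this] at hu
    have h4 : ((η ^ m : Sˣ) : S) * ((η⁻¹ ^ m : Sˣ) : S) = 1 := by
      rw [← Units.val_mul]; simp
    rw [Units.val_pow_eq_pow_val] at h4
    linear_combination (-((η⁻¹ ^ m : Sˣ) : S)) * hu - β * (algebraMap R S (N β)) ^ m * h4
  refine ⟨u * η⁻¹ ^ m, ?_⟩
  have h5 := congrArg s h3
  simp only [map_mul, map_pow, h.fixR] at h5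
  have hd0 : algebraMap R S d ≠ 0 := by
    intro h0
    rw [h0, zero_mul] at hu
    exact (pow_ne_zero _ hβ) hu.symm
  apply mul_left_cancel₀ hd0
  rw [Units.val_mul, ← h3]
  rw [map_mul]
  nth_rewrite 1 [hη]
  linear_combination (η : S) * h5

end QSlemmas

lemma aux_index {G X : Type*} [Group G] (H : Subgroup G) [Finite X] (f : G → X)
    (hX : Nat.card X = 4) (hf : ∀ a b, f a = f b → a⁻¹ * b ∈ H) :
    H.index ≤ 4 ∧ (4 ≤ H.index → Function.Surjective f) := by
  let g : G ⧸ H → X := fun q => f q.out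
  have hg : Function.Injective g := by
    intro a b hab
    have := hf _ _ hab
    rw [← QuotientGroup.eq, QuotientGroup.out_eq', QuotientGroup.out_eq'] at this
    exact this
  have hle : Nat.card (G ⧸ H) ≤ Nat.card X := Nat.card_le_card_of_injective g hg
  refine ⟨by rw [← hX]; exact hle, fun h4 => ?_⟩
  have hfin : Finite (G ⧸ H) := Finite.of_injective g hg
  have hb : Function.Bijective g := by
    rw [Nat.bijective_iff_injective_and_card]
    exact ⟨hg, le_antisymm hle (by rw [hX]; exact h4)⟩
  intro x
  obtain ⟨q, hq⟩ := hb.2 x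
  exact ⟨_, hq⟩

lemma aux_ramified (F k : Type*) [Field F] [NumberField F] [Field k] [NumberField k] [Algebra F k]
    (hdeg : Module.finrank F k = 2) (p : Ideal (𝓞 F)) [hp : p.IsPrime] (hp0 : p ≠ ⊥)
    (s : 𝓞 k ≃+* 𝓞 k) (hs : QS (RingOfIntegers.norm F : 𝓞 k →* 𝓞 F) s)
    (hram : IsRamifiedIn F k p) :
    ∃ P : Ideal (𝓞 k), P.IsMaximal ∧ P ≠ ⊥ ∧ p.map (algebraMap (𝓞 F) (𝓞 k)) = P ^ 2 ∧
      P.map s = P ∧ P.comap (algebraMap (𝓞 F) (𝓞 k)) = p ∧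
      ∀ x : 𝓞 k, ∃ a : 𝓞 F, x - algebraMap (𝓞 F) (𝓞 k) a ∈ P := by
  obtain ⟨P, hP, hd⟩ := hram
  have hinj : Function.Injective (algebraMap (𝓞 F) (𝓞 k)) :=
    FaithfulSMul.algebraMap_injective (𝓞 F) (𝓞 k)
  have hm0 : p.map (algebraMap (𝓞 F) (𝓞 k)) ≠ ⊥ := by
    rwa [Ne, Ideal.map_eq_bot_iff_of_injective hinj]
  have hP0 : P ≠ ⊥ := by
    rintro rfl
    apply hm0
    have := Ideal.le_of_dvd hd
    rw [← le_bot_iff]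
    refine this.trans ?_
    rw [pow_two]; exact Ideal.mul_le_right
  have hPm : P.IsMaximal := hP.isMaximal hP0
  have hpm : p.IsMaximal := hp.isMaximal hp0
  have hcom : P.comap (algebraMap (𝓞 F) (𝓞 k)) = p := by
    refine (hpm.eq_of_le (Ideal.comap_isPrime _ _).ne_top ?_).symm
    rw [← Ideal.map_le_iff_le_comap]
    exact (Ideal.le_of_dvd hd).trans (Ideal.pow_le_self two_ne_zero)
  have hfin : Finite (𝓞 k ⧸ P) := Ideal.finiteQuotientOfFreeOfNeBot P hP0
  have hfin' : Finite (𝓞 F ⧸ p) := Ideal.finiteQuotientOfFreeOfNeBot p hp0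
  let φ : 𝓞 F ⧸ p →+* 𝓞 k ⧸ P := Ideal.quotientMap P (algebraMap (𝓞 F) (𝓞 k)) hcom.ge
  have hφ : Function.Injective φ := Ideal.quotientMap_injective' hcom.le
  have hle : Ideal.absNorm p ≤ Ideal.absNorm P := by
    have := Nat.card_le_card_of_injective φ hφ
    simpa [Ideal.absNorm_apply, Submodule.cardQuot_apply] using this
  have hnorm : Ideal.absNorm (p.map (algebraMap (𝓞 F) (𝓞 k))) = Ideal.absNorm p ^ 2 := by
    rw [Ideal.absNorm_algebraMap, aux_finrank F k hdeg]
  obtain ⟨X, hX⟩ := hd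
  have hnp : 0 < Ideal.absNorm p := Nat.pos_of_ne_zero (by rwa [Ne, Ideal.absNorm_eq_zero_iff])
  have hnX : 0 < Ideal.absNorm X := by
    refine Nat.pos_of_ne_zero ?_
    rw [Ne, Ideal.absNorm_eq_zero_iff]
    rintro rfl
    exact hm0 (by rw [hX]; simp)
  have heq : Ideal.absNorm p ^ 2 = Ideal.absNorm P ^ 2 * Ideal.absNorm X := by
    rw [← hnorm, hX, map_mul, map_pow]
  have h1 : Ideal.absNorm p ^ 2 ≤ Ideal.absNorm P ^ 2 := Nat.pow_le_pow_left hle 2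
  have hX1 : Ideal.absNorm X = 1 := by
    have hpp : 0 < Ideal.absNorm P ^ 2 := lt_of_lt_of_le (by positivity) h1
    nlinarith
  have hNP : Ideal.absNorm p = Ideal.absNorm P := by
    rw [hX1, mul_one] at heq
    exact Nat.pow_left_injective two_ne_zero heq
  have hXt : X = ⊤ := Ideal.absNorm_eq_one_iff.1 hX1
  have hmap : p.map (algebraMap (𝓞 F) (𝓞 k)) = P ^ 2 := by
    rw [hX, hXt]; simp
  refine ⟨P, hPm, hP0, hmap, ?_, hcom, ?_⟩
  · have h2 : (P.map s) ^ 2 = P ^ 2 := by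
      rw [← Ideal.map_pow, ← hmap, hs.map_algebraMap]
    have hpr : (P.map s).IsPrime := Ideal.map_isPrime_of_equiv s
    refine (hPm.eq_of_le hpr.ne_top ?_).symm
    exact (Ideal.IsPrime.pow_le_iff two_ne_zero).1 ((Ideal.pow_le_self two_ne_zero).trans' h2.ge)
  · intro x
    have hb : Function.Bijective φ := by
      rw [Nat.bijective_iff_injective_and_card]
      refine ⟨hφ, ?_⟩
      simpa [Ideal.absNorm_apply, Submodule.cardQuot_apply] using hNP
    obtain ⟨q, hq⟩ := hb.2 (Ideal.Quotient.mk P x)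
    obtain ⟨a, rfl⟩ := Ideal.Quotient.mk_surjective q
    refine ⟨a, ?_⟩
    rw [← Ideal.Quotient.eq, ← hq]
    exact Ideal.quotientMap_mk

lemma aux_descent {R S : Type*} [CommRing R] [CommRing S] [IsDedekindDomain S] [Algebra R S]
    {N : S →* R} {s : S ≃+* S} (h : QS N s) (P : Ideal S) [hP : P.IsMaximal] (hP0 : P ≠ ⊥)
    (hPs : P.map s = P) (ε : S) (n : ℕ) :
    ∀ x y : S, y ∉ P ^ n → x * s x = ε * (y * s y) →
      ∃ x' y' : S, y' ∉ P ∧ x' * s x' = ε * (y' * s y') := by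
  have hsP : ∀ x, s x ∈ P → x ∈ P := by
    intro x hx
    rw [← hPs, h.mem_map]; exact hx
  have hsP' : ∀ x, x ∈ P → s x ∈ P := by
    intro x hx
    exact hsP _ (by rwa [h.invol])
  obtain ⟨π, hπ, hπ2⟩ : ∃ π ∈ P, π ∉ P ^ 2 := by
    have : ¬ P ≤ P ^ 2 := by
      intro hle
      have h1 : P * P = P * 1 := by
        rw [mul_one, ← pow_two]; exact le_antisymm (Ideal.pow_le_self two_ne_zero) hle
      have := mul_left_cancel₀ (show P ≠ 0 from hP0) h1
      exact hP.ne_top (by rw [this, Ideal.one_eq_top])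
    exact Set.not_subset.1 this
  have hπ0 : π ≠ 0 := by rintro rfl; simp at hπ2
  obtain ⟨r', hr'⟩ := Ideal.dvd_iff_le.2 ((Ideal.span_singleton_le_iff_mem P).2 hπ)
  obtain ⟨r, hr, hrP⟩ : ∃ r ∈ r', r ∉ P := by
    have : ¬ r' ≤ P := by
      intro hle
      apply hπ2
      rw [← Ideal.span_singleton_le_iff_mem, hr', pow_two]
      exact Ideal.mul_mono_right hle
    exact Set.not_subset.1 this
  have hdiv : ∀ x ∈ P, ∃ x', x * r = π * x' := by
    intro x hx
    have : x * r ∈ Ideal.span {π} := by rw [hr']; exact Ideal.mul_mem_mul hx hr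
    exact Ideal.mem_span_singleton.1 this
  induction n with
  | zero => intro x y hy; simp at hy
  | succ n ih =>
    intro x y hy hxy
    by_cases hyP : y ∈ P
    · have hxP : x ∈ P := by
        have : x * s x ∈ P := by
          rw [hxy]; exact P.mul_mem_left _ (P.mul_mem_right _ hyP)
        rcases hP.isPrime.mem_or_mem this with h1 | h1
        · exact h1
        · exact hsP _ h1
      obtain ⟨x', hx'⟩ := hdiv x hxP
      obtain ⟨y', hy'⟩ := hdiv y hyP
      refine ih x' y' ?_ ?_
      · intro hy'n
        apply hy
        have h1 : r * y ∈ P ^ (n + 1) := by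
          rw [mul_comm, hy', pow_succ, mul_comm π]; exact Ideal.mul_mem_mul hy'n hπ
        exact (Ideal.IsPrime.mul_mem_pow P h1).resolve_left hrP
      · have hsπ : s π ≠ 0 := by simpa using hπ0
        have hx2 := congrArg s hx'
        have hy2 := congrArg s hy'
        simp only [map_mul] at hx2 hy2
        apply mul_left_cancel₀ (mul_ne_zero hπ0 hsπ)
        have e1 : π * s π * (x' * s x') = (x * r) * (s x * s r) := by rw [hx', hx2]; ring
        have e2 : π * s π * (ε * (y' * s y')) = ε * ((y * r) * (s y * s r)) := by
          rw [hy', hy2]; ring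
        rw [e1, e2]
        linear_combination (r * s r) * hxy
    · exact ⟨x, y, hyP, hxy⟩

lemma aux_res (F k : Type*) [Field F] [NumberField F] [Field k] [NumberField k] [Algebra F k]
    (p : Ideal (𝓞 F)) [hp : p.IsPrime] (hp0 : p ≠ ⊥) (hodd : Odd (Ideal.absNorm p))
    (s : 𝓞 k ≃+* 𝓞 k) (hs : QS (RingOfIntegers.norm F : 𝓞 k →* 𝓞 F) s)
    (P : Ideal (𝓞 k)) (hP : P.IsMaximal) (hP0 : P ≠ ⊥) (hPs : P.map s = P)
    (hcom : P.comap (algebraMap (𝓞 F) (𝓞 k)) = p)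
    (hres : ∀ x : 𝓞 k, ∃ a : 𝓞 F, x - algebraMap (𝓞 F) (𝓞 k) a ∈ P)
    (ε : (𝓞 F)ˣ) (x y : 𝓞 k) (hy : y ≠ 0)
    (hxy : x * s x = algebraMap (𝓞 F) (𝓞 k) ε * (y * s y)) :
    quadResSym F p (ε : 𝓞 F) = 1 := by
  obtain ⟨n, hn⟩ : ∃ n, y ∉ P ^ n := by
    by_contra hcon
    push Not at hcon
    have : y ∈ ⨅ n : ℕ, P ^ n := by simpa [Ideal.mem_iInf] using hcon
    rw [Ideal.iInf_pow_eq_bot_of_isDomain P hP.ne_top] at this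
    exact hy (by simpa using this)
  obtain ⟨x', y', hy', he⟩ := aux_descent hs P hP0 hPs _ n
    x y hn hxy
  have hsP' : ∀ x, x ∈ P → s x ∈ P := by
    intro x hx
    rw [← hPs, hs.mem_map, hs.invol]; exact hx
  have key : ∀ z, ∃ a : 𝓞 F, z - algebraMap (𝓞 F) (𝓞 k) a ∈ P ∧
      s z - algebraMap (𝓞 F) (𝓞 k) a ∈ P := by
    intro z
    obtain ⟨a, ha⟩ := hres z
    refine ⟨a, ha, ?_⟩
    have := hsP' _ ha
    rwa [map_sub, hs.fixR] at this
  obtain ⟨a, ha, ha'⟩ := key x'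
  obtain ⟨b, hb, hb'⟩ := key y'
  have hpm : p.IsMaximal := hp.isMaximal hp0
  have hab : a * a - ε * (b * b) ∈ p := by
    rw [← hcom, Ideal.mem_comap, ← Ideal.Quotient.eq_zero_iff_mem]
    rw [← Ideal.Quotient.eq] at ha ha' hb hb'
    have := congrArg (Ideal.Quotient.mk P) he
    simp only [map_mul, map_sub] at this ⊢
    rw [ha, ha', hb, hb'] at this
    rw [this, sub_self]
  have hbp : b ∉ p := by
    intro hbp
    apply hy'
    rw [← hcom, Ideal.mem_comap] at hbp
    have := P.add_mem hb hbp
    rwa [sub_add_cancel] at this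
  unfold quadResSym
  rw [if_pos]
  let K := 𝓞 F ⧸ p
  let _ : Field K := Ideal.Quotient.field p
  have hfin' : Finite K := Ideal.finiteQuotientOfFreeOfNeBot p hp0
  let _ : Fintype K := Fintype.ofFinite K
  have hcard : Fintype.card K = Ideal.absNorm p := by
    rw [Ideal.absNorm_apply, Submodule.cardQuot_apply, Nat.card_eq_fintype_card]
  let mk : 𝓞 F →+* K := Ideal.Quotient.mk p
  have hb0 : mk b ≠ 0 := fun h0 => hbp (Ideal.Quotient.eq_zero_iff_mem.1 h0)
  have hab' : mk a * mk a = mk ε * (mk b * mk b) := by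
    have := Ideal.Quotient.eq_zero_iff_mem.2 hab
    have h2 : mk (a * a - ε * (b * b)) = 0 := this
    rw [map_sub, map_mul, map_mul, map_mul, sub_eq_zero] at h2
    exact h2
  have hε0 : mk ε ≠ 0 := (ε.isUnit.map mk).ne_zero
  have ha0 : mk a ≠ 0 := by
    intro h0
    rw [h0, zero_mul] at hab'
    exact mul_ne_zero hε0 (mul_ne_zero hb0 hb0) hab'.symm
  have hsq : mk ε = (mk a / mk b) ^ 2 := by
    field_simp
    linear_combination -hab'
  have hfinal : mk ((ε : 𝓞 F) ^ ((Ideal.absNorm p - 1) / 2) - 1) = 0 := by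
    rw [map_sub, map_pow, map_one, hsq, ← pow_mul, Nat.mul_div_cancel', ← hcard,
      FiniteField.pow_card_sub_one_eq_one _ (div_ne_zero ha0 hb0), sub_self]
    obtain ⟨m, hm⟩ := hodd
    rw [hm]; exact ⟨m, by omega⟩
  exact Ideal.Quotient.eq_zero_iff_mem.1 hfinal

lemma aux_herbrand_mul (A : Type*) [CommGroup A] [Module.Finite ℤ (Additive A)] (s : A →* A)
    (hs : ∀ a, s (s a) = a) (P M NA DA : Subgroup A)
    (hP : ∀ a, a ∈ P ↔ s a = a) (hM : ∀ a, a ∈ M ↔ a * s a = 1)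
    (hNA : ∀ a, a ∈ NA ↔ ∃ b, b * s b = a) (hDA : ∀ a, a ∈ DA ↔ ∃ b, b / s b = a)
    (hr : 2 * Module.finrank ℤ (Additive P) + 1 ≤ Module.finrank ℤ (Additive A)) :
    2 * NA.relIndex P ≤ DA.relIndex M ∧ DA.relIndex M ≠ 0 ∧ NA.relIndex P ≠ 0 :=
  aux_herbrand (Additive A) (MonoidHom.toAdditive s) hs (Subgroup.toAddSubgroup P)
    (Subgroup.toAddSubgroup M) (Subgroup.toAddSubgroup NA) (Subgroup.toAddSubgroup DA)
    hP hM hNA hDA hr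

lemma aux_units (F k : Type*) [Field F] [NumberField F] [Field k] [NumberField k] [Algebra F k]
    (hdeg : Module.finrank F k = 2) (hinf : UnramifiedAtInfinitePlaces F k)
    (s : 𝓞 k ≃+* 𝓞 k) (hs : QS (RingOfIntegers.norm F : 𝓞 k →* 𝓞 F) s) :
    ∃ M D : Subgroup (𝓞 k)ˣ, (∀ η, η ∈ M ↔ (η : 𝓞 k) * s η = 1) ∧
      (∀ η, η ∈ D ↔ ∃ u : (𝓞 k)ˣ, (u : 𝓞 k) = η * s u) ∧
      2 * (relUnitNormRange F k).index ≤ D.relIndex M ∧ D.relIndex M ≠ 0 ∧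
      (relUnitNormRange F k).index ≠ 0 := by
  let sU : (𝓞 k)ˣ →* (𝓞 k)ˣ := Units.map (s : 𝓞 k →* 𝓞 k)
  have hsU : ∀ u, ((sU u : (𝓞 k)ˣ) : 𝓞 k) = s u := fun u => rfl
  let φ : (𝓞 F)ˣ →* (𝓞 k)ˣ := Units.map (algebraMap (𝓞 F) (𝓞 k) : 𝓞 F →* 𝓞 k)
  have hinj : Function.Injective (algebraMap (𝓞 F) (𝓞 k)) :=
    FaithfulSMul.algebraMap_injective (𝓞 F) (𝓞 k)
  have hφ : Function.Injective φ := Units.map_injective hinj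
  have hφv : ∀ u, ((φ u : (𝓞 k)ˣ) : 𝓞 k) = algebraMap (𝓞 F) (𝓞 k) u := fun u => rfl
  have hinvol : ∀ a, sU (sU a) = a := fun a => Units.ext (hs.invol _)
  have hfix : ∀ a, a ∈ φ.range ↔ sU a = a := by
    intro a
    constructor
    · rintro ⟨b, rfl⟩
      exact Units.ext (hs.fixR _)
    · intro ha
      obtain ⟨b, hb⟩ := hs.fixed (a : 𝓞 k) (congrArg Units.val ha)
      have ha' : sU a⁻¹ = a⁻¹ := by rw [map_inv, ha]
      obtain ⟨c, hc⟩ := hs.fixed ((a⁻¹ : (𝓞 k)ˣ) : 𝓞 k) (congrArg Units.val ha')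
      have hbc : b * c = 1 := by
        apply hinj
        rw [map_mul, hb, hc, map_one, Units.mul_inv]
      exact ⟨⟨b, c, hbc, by rw [mul_comm]; exact hbc⟩, Units.ext hb⟩
  have hfg : Module.Finite ℤ (Additive (𝓞 k)ˣ) := inferInstance
  have hrank : 2 * Module.finrank ℤ (Additive φ.range) + 1 ≤
      Module.finrank ℤ (Additive (𝓞 k)ˣ) := by
    have h1 : Module.finrank ℤ (Additive φ.range) = Module.finrank ℤ (Additive (𝓞 F)ˣ) :=
      ((MulEquiv.toAdditive (MonoidHom.ofInjective hφ)).toIntLinearEquiv.finrank_eq).symm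
    rw [h1, NumberField.Units.finrank_eq, NumberField.Units.finrank_eq, aux_places F k hdeg hinf]
  let g : (𝓞 k)ˣ →* (𝓞 k)ˣ := MonoidHom.id _ * sU
  let f : (𝓞 k)ˣ →* (𝓞 k)ˣ := MonoidHom.id _ / sU
  have hmain := aux_herbrand_mul (𝓞 k)ˣ sU hinvol φ.range g.ker g.range f.range hfix
    (fun a => Iff.rfl) (fun a => Iff.rfl) (fun a => Iff.rfl) hrank
  have hidx : g.range.relIndex φ.range = (relUnitNormRange F k).index := by
    have h1 : g.range = (relUnitNormRange F k).map φ := by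
      have : g = φ.comp (Units.map (RingOfIntegers.norm F : 𝓞 k →* 𝓞 F)) := by
        ext u
        exact congrArg _ (hs.norm u)
      rw [this, relUnitNormRange, MonoidHom.range_comp]
    rw [h1, MonoidHom.range_eq_map, Subgroup.relIndex_map_map_of_injective _ _ hφ,
      Subgroup.relIndex_top_right]
  rw [hidx] at hmain
  refine ⟨g.ker, f.range, ?_, ?_, hmain⟩
  · intro η
    rw [MonoidHom.mem_ker, ← Units.val_eq_one]
    rfl
  · intro η
    refine exists_congr fun u => ?_
    have : f u = u / sU u := rfl
    rw [this, div_eq_iff_eq_mul, Units.ext_iff]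
    rfl

lemma aux_class_pow {F : Type*} [Field F] [NumberField F] (c : Ideal (𝓞 F)) (hc : c ≠ ⊥) :
    (c ^ NumberField.classNumber F).IsPrincipal := by
  have hc' : c ∈ nonZeroDivisors (Ideal (𝓞 F)) := mem_nonZeroDivisors_of_ne_zero hc
  have : (ClassGroup.mk0 ⟨c, hc'⟩) ^ NumberField.classNumber F = 1 := by
    rw [NumberField.classNumber, pow_card_eq_one]
  rw [← map_pow, ClassGroup.mk0_eq_one_iff] at this
  exact this

lemma aux_parity {S : Type*} [CommRing S] (X q : Ideal S) (h : q = X ^ 2) (a b : ℕ)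
    (hab : (a : ZMod 2) = b) : ∃ n, X ^ a * X ^ b = q ^ n := by
  have : Even (a + b) := by
    rw [← ZMod.natCast_eq_zero_iff_even]
    push_cast
    rw [hab]
    exact CharTwo.add_self_eq_zero _
  obtain ⟨m, hm⟩ := this
  exact ⟨m, by rw [← pow_add, hm, h, ← pow_mul, two_mul]⟩

lemma aux_unit_fixed {R S : Type*} [CommRing R] [CommRing S] [Algebra R S]
    {N : S →* R} {s : S ≃+* S} (h : QS N s) (hinj : Function.Injective (algebraMap R S))
    (e : Sˣ) (he : s e = e) : ∃ a : Rˣ, algebraMap R S a = e := by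
  obtain ⟨b, hb⟩ := h.fixed (e : S) he
  have ha' : s ((e⁻¹ : Sˣ) : S) = (e⁻¹ : Sˣ) := by
    have h1 : (e : S) * s ((e⁻¹ : Sˣ) : S) = 1 := by
      nth_rewrite 1 [← he]
      rw [← map_mul, Units.mul_inv, map_one]
    exact (Units.inv_eq_of_mul_eq_one_right h1).symm
  obtain ⟨c, hc⟩ := h.fixed _ ha'
  have hbc : b * c = 1 := by
    apply hinj
    rw [map_mul, hb, hc, map_one, Units.mul_inv]
  exact ⟨⟨b, c, hbc, by rw [mul_comm]; exact hbc⟩, hb⟩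

lemma aux_princ_cancel {S : Type*} [CommRing S] [IsDedekindDomain S] (I X : Ideal S)
    (hX : X ≠ ⊥) (hXp : X.IsPrincipal) (h : (I * X).IsPrincipal) : I.IsPrincipal := by
  obtain ⟨β, hβ⟩ := hXp
  obtain ⟨x, hx⟩ := h
  rw [Ideal.submodule_span_eq] at hβ hx
  have hxm : x ∈ X := by
    have : x ∈ I * X := hx.ge (Ideal.mem_span_singleton_self x)
    exact (Ideal.mul_le_right : I * X ≤ X) this
  rw [hβ] at hxm
  obtain ⟨y, hy⟩ := Ideal.mem_span_singleton.1 hxm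
  refine ⟨y, ?_⟩
  rw [Ideal.submodule_span_eq]
  apply mul_right_cancel₀ (show X ≠ 0 from hX)
  rw [hx, hβ, hy, Ideal.span_singleton_mul_span_singleton, mul_comm β y]

lemma aux_princ_mul {S : Type*} [CommRing S] {I J : Ideal S} (hI : I.IsPrincipal)
    (hJ : J.IsPrincipal) : (I * J).IsPrincipal := by
  obtain ⟨a, rfl⟩ := hI
  obtain ⟨b, rfl⟩ := hJ
  exact ⟨a * b, by simp [Ideal.submodule_span_eq, Ideal.span_singleton_mul_span_singleton]⟩

lemma aux_princ_pow {S : Type*} [CommRing S] {I : Ideal S} (hI : I.IsPrincipal) (n : ℕ) :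
    (I ^ n).IsPrincipal := by
  obtain ⟨a, rfl⟩ := hI
  exact ⟨a ^ n, by simp [Ideal.submodule_span_eq, Ideal.span_singleton_pow]⟩

lemma aux_princ_map {R S : Type*} [CommRing R] [CommRing S] {I : Ideal R} (hI : I.IsPrincipal)
    (f : R →+* S) : (I.map f).IsPrincipal := by
  obtain ⟨a, rfl⟩ := hI
  exact ⟨f a, by simp [Ideal.submodule_span_eq, Ideal.map_span]⟩

/-- In the two-ramified-primes situation with both `𝔭₁` and `𝔭₂` not primary,
the class number of `k` is odd and `(E_F : N_{k/F} E_k) = 2`. -/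
theorem scholz_case_not_primary
    (F : Type*) [Field F] [NumberField F]
    (hoddF : Odd (NumberField.classNumber F))
    (k : Type*) [Field k] [NumberField k] [Algebra F k]
    (hdeg : Module.finrank F k = 2)
    (𝔭₁ 𝔭₂ : Ideal (𝓞 F)) (hp1 : 𝔭₁.IsPrime) (hp2 : 𝔭₂.IsPrime) (hne : 𝔭₁ ≠ 𝔭₂)
    (hN1 : Odd (Ideal.absNorm 𝔭₁)) (hN2 : Odd (Ideal.absNorm 𝔭₂))
    (hram : ∀ 𝔭 : Ideal (𝓞 F), 𝔭.IsPrime → 𝔭 ≠ ⊥ →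
      (IsRamifiedIn F k 𝔭 ↔ 𝔭 = 𝔭₁ ∨ 𝔭 = 𝔭₂))
    (hinf : UnramifiedAtInfinitePlaces F k)
    (hnprim1 : ¬ IsPrimaryIdeal F 𝔭₁) (hnprim2 : ¬ IsPrimaryIdeal F 𝔭₂)
    : Odd (NumberField.classNumber k) ∧ (relUnitNormRange F k).index = 2 := by
  have hinj : Function.Injective (algebraMap (𝓞 F) (𝓞 k)) :=
    FaithfulSMul.algebraMap_injective (𝓞 F) (𝓞 k)
  have hp10 : 𝔭₁ ≠ ⊥ := by rintro rfl; simp at hN1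
  have hp20 : 𝔭₂ ≠ ⊥ := by rintro rfl; simp at hN2
  obtain ⟨s, hs⟩ := aux_setup F k hdeg
  obtain ⟨P1, hP1m, hP10, hP1, hP1s, hP1c, hP1r⟩ :=
    aux_ramified F k hdeg 𝔭₁ hp10 s hs ((hram 𝔭₁ hp1 hp10).2 (Or.inl rfl))
  obtain ⟨P2, hP2m, hP20, hP2, hP2s, -, -⟩ :=
    aux_ramified F k hdeg 𝔭₂ hp20 s hs ((hram 𝔭₂ hp2 hp20).2 (Or.inr rfl))
  have hunr : ∀ q : Ideal (𝓞 F), q.IsPrime → q ≠ ⊥ → q ≠ 𝔭₁ → q ≠ 𝔭₂ → ∀ Q : Ideal (𝓞 k),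
      Q.IsPrime → ¬ Q ^ 2 ∣ q.map (algebraMap (𝓞 F) (𝓞 k)) := by
    intro q hq hq0 h1 h2 Q hQ hd
    rcases (hram q hq hq0).1 ⟨Q, hQ, hd⟩ with h | h
    · exact h1 h
    · exact h2 h
  have hinvid := hs.invariant_ideal hinj 𝔭₁ 𝔭₂ P1 P2 hP1 hP2 hP1s hP2s hP10 hP20 hunr
  have hm1 : 𝔭₁.map (algebraMap (𝓞 F) (𝓞 k)) ≠ ⊥ := by
    rwa [Ne, Ideal.map_eq_bot_iff_of_injective hinj]
  obtain ⟨ε₀, hε₀⟩ : ∃ ε : (𝓞 F)ˣ, quadResSym F 𝔭₁ (ε : 𝓞 F) ≠ 1 := by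
    unfold IsPrimaryIdeal at hnprim1
    push Not at hnprim1
    exact hnprim1
  have hres : ∀ x y : 𝓞 k, y ≠ 0 → x * s x ≠ algebraMap (𝓞 F) (𝓞 k) ε₀ * (y * s y) :=
    fun x y hy hxy => hε₀ (aux_res F k 𝔭₁ hp10 hN1 s hs P1 hP1m hP10 hP1s hP1c hP1r ε₀ x y hy hxy)
  obtain ⟨M, D, hM, hD, hle, hD0, hE0⟩ := aux_units F k hdeg hinf s hs
  have hnr : ∀ ε : (𝓞 F)ˣ, ε ∈ relUnitNormRange F k ↔
      ∃ u : (𝓞 k)ˣ, algebraMap (𝓞 F) (𝓞 k) ε = u * s u := by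
    intro ε
    refine exists_congr fun u => ?_
    rw [Units.ext_iff, hs.norm, hinj.eq_iff, eq_comm]
    rfl
  have hε₀n : ε₀ ∉ relUnitNormRange F k := by
    intro hmem
    obtain ⟨u, hu⟩ := (hnr _).1 hmem
    exact hres u 1 one_ne_zero (by rw [hu]; simp)
  have hE1 : (relUnitNormRange F k).index ≠ 1 := by
    rw [Ne, Subgroup.index_eq_one]
    intro h
    exact hε₀n (h ▸ Subgroup.mem_top _)
  -- the parity map
  have hchoice : ∀ η : M, ∃ (β : 𝓞 k) (a b : ℕ) (c : Ideal (𝓞 F)), β ≠ 0 ∧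
      β = ((η : (𝓞 k)ˣ) : 𝓞 k) * s β ∧ c ≠ ⊥ ∧
      Ideal.span {β} = P1 ^ a * P2 ^ b * c.map (algebraMap (𝓞 F) (𝓞 k)) := by
    intro η
    have hη := (hM _).1 η.2
    obtain ⟨β, hβ0, hβ⟩ := hs.h90 ((η : (𝓞 k)ˣ) : 𝓞 k) 1 (Units.ne_zero _) one_ne_zero
      (by rw [hη]; simp)
    rw [one_mul] at hβ
    have hinv : (Ideal.span {β}).map s = Ideal.span {β} := by
      rw [Ideal.map_span, Set.image_singleton, Ideal.span_singleton_eq_span_singleton]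
      exact ⟨η, by rw [mul_comm]; exact hβ⟩
    obtain ⟨a, b, c, hc, he⟩ := hinvid (Ideal.span {β}) (by simpa using hβ0) hinv
    exact ⟨β, a, b, c, hβ0, hβ.symm, hc, he⟩
  choose β a b c hβ0 hβ hc hspan using hchoice
  let f : M → ZMod 2 × ZMod 2 := fun η => ((a η : ZMod 2), (b η : ZMod 2))
  have hX4 : Nat.card (ZMod 2 × ZMod 2) = 4 := by simp
  have hf : ∀ x y : M, f x = f y → x⁻¹ * y ∈ D.subgroupOf M := by
    intro x y hxy
    obtain ⟨m, hm⟩ := aux_parity P1 _ hP1 (a x) (a y) (congrArg Prod.fst hxy)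
    obtain ⟨n, hn⟩ := aux_parity P2 _ hP2 (b x) (b y) (congrArg Prod.snd hxy)
    have hid : Ideal.span {β x * β y} =
        (𝔭₁ ^ m * 𝔭₂ ^ n * (c x * c y)).map (algebraMap (𝓞 F) (𝓞 k)) := by
      rw [← Ideal.span_singleton_mul_span_singleton, hspan, hspan, Ideal.map_mul, Ideal.map_mul,
        Ideal.map_mul, Ideal.map_pow, Ideal.map_pow, ← hm, ← hn]
      ring
    have hne0 : 𝔭₁ ^ m * 𝔭₂ ^ n * (c x * c y) ≠ ⊥ :=
      mul_ne_zero (mul_ne_zero (pow_ne_zero _ hp10) (pow_ne_zero _ hp20))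
        (mul_ne_zero (hc x) (hc y))
    obtain ⟨u, hu⟩ := hs.unit_of _ hoddF _ (aux_class_pow _ hne0) _ (mul_ne_zero (hβ0 x) (hβ0 y)) hid
      ((x : (𝓞 k)ˣ) * y) (by
        rw [map_mul, Units.val_mul]
        nth_rewrite 1 [hβ x, hβ y]
        ring)
    rw [Subgroup.mem_subgroupOf]
    have hxy' : ((x : (𝓞 k)ˣ) * y) ∈ D := (hD _).2 ⟨u, hu⟩
    have hx2 : ((x : (𝓞 k)ˣ) * x) ∈ D := by
      refine (hD _).2 ⟨x, ?_⟩
      have := (hM _).1 x.2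
      rw [Units.val_mul, mul_assoc, this, mul_one]
    have := D.mul_mem (D.inv_mem hx2) hxy'
    convert this using 1
    simp [mul_assoc]
  obtain ⟨hle4, hsurj⟩ := aux_index (D.subgroupOf M) f hX4 hf
  have hrel : D.relIndex M = (D.subgroupOf M).index := rfl
  rw [hrel] at hle hD0
  have hidx : (relUnitNormRange F k).index = 2 := by omega
  refine ⟨?_, hidx⟩
  have hsurj' := hsurj (by omega)
  -- invariant ideals with principal square are principal
  have hfinal : ∀ J : Ideal (𝓞 k), J ≠ ⊥ → J.map s = J → (J ^ 2).IsPrincipal → J.IsPrincipal := by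
    intro J hJ0 hJs hJ2
    obtain ⟨a', b', c', hc', hJ⟩ := hinvid J hJ0 hJs
    obtain ⟨η, hη⟩ := hsurj' ((a' : ZMod 2), (b' : ZMod 2))
    obtain ⟨m, hm⟩ := aux_parity P1 _ hP1 a' (a η) (congrArg Prod.fst hη).symm
    obtain ⟨n, hn⟩ := aux_parity P2 _ hP2 b' (b η) (congrArg Prod.snd hη).symm
    have hid : J * Ideal.span {β η} =
        (𝔭₁ ^ m * 𝔭₂ ^ n * (c' * c η)).map (algebraMap (𝓞 F) (𝓞 k)) := by
      rw [hspan, hJ, Ideal.map_mul, Ideal.map_mul,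
        Ideal.map_mul, Ideal.map_pow, Ideal.map_pow, ← hm, ← hn]
      ring
    have hne0 : 𝔭₁ ^ m * 𝔭₂ ^ n * (c' * c η) ≠ ⊥ :=
      mul_ne_zero (mul_ne_zero (pow_ne_zero _ hp10) (pow_ne_zero _ hp20))
        (mul_ne_zero hc' (hc η))
    have hpr := aux_princ_map (aux_class_pow _ hne0) (algebraMap (𝓞 F) (𝓞 k))
    rw [Ideal.map_pow, ← hid] at hpr
    obtain ⟨l, hl⟩ := hoddF
    have hβη : Ideal.span {β η} ≠ ⊥ := by simpa using hβ0 η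
    have e : (J * Ideal.span {β η}) ^ (NumberField.classNumber F) =
        J * ((J ^ 2) ^ l * Ideal.span {β η} ^ (2 * l + 1)) := by
      rw [hl]; ring
    rw [e] at hpr
    refine aux_princ_cancel _ _ ?_ ?_ hpr
    · exact mul_ne_zero (pow_ne_zero _ (pow_ne_zero _ hJ0)) (pow_ne_zero _ hβη)
    · exact aux_princ_mul (aux_princ_pow hJ2 l) (aux_princ_pow ⟨_, rfl⟩ _)
  have hall : ∀ I : Ideal (𝓞 k), I ≠ ⊥ → (I ^ 2).IsPrincipal → I.IsPrincipal := by
    intro I hI0 hI2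
    have hsI0 : I.map s ≠ ⊥ := by
      intro h0
      apply hI0
      rw [← hs.map_map I, h0, Ideal.map_bot]
    have hsI2 : ((I ^ 2).map s).IsPrincipal := aux_princ_map hI2 (s : 𝓞 k →+* 𝓞 k)
    have hIs : (I * I.map s).IsPrincipal := by
      apply hfinal
      · exact mul_ne_zero hI0 hsI0
      · rw [Ideal.map_mul, hs.map_map, mul_comm]
      · rw [mul_pow, ← Ideal.map_pow]
        exact aux_princ_mul hI2 hsI2
    obtain ⟨δ, hδ⟩ := hIs
    obtain ⟨γ, hγ⟩ := hI2
    rw [Ideal.submodule_span_eq] at hδ hγ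
    have hspan0 : ∀ x : 𝓞 k, Ideal.span {x} ≠ ⊥ → x ≠ 0 := by
      intro x hx h0
      exact hx (by simpa using h0)
    have hδ0 : δ ≠ 0 := hspan0 _ (by rw [← hδ]; exact mul_ne_zero hI0 hsI0)
    have hγ0 : γ ≠ 0 := hspan0 _ (by rw [← hγ]; exact pow_ne_zero _ hI0)
    have hsγ0 : s γ ≠ 0 := by simpa using hγ0
    have hms : ∀ x, (Ideal.span {x}).map s = Ideal.span {s x} := by
      intro x; rw [Ideal.map_span, Set.image_singleton]
    have r1 : I * Ideal.span {δ} = I.map s * Ideal.span {γ} := by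
      rw [← hδ, ← hγ]; ring
    have r2 : I.map s * Ideal.span {s δ} = I * Ideal.span {s γ} := by
      have := congrArg (Ideal.map s) r1
      rw [Ideal.map_mul, Ideal.map_mul, hs.map_map, hms, hms] at this
      exact this
    have r3 : Ideal.span {γ * s γ} = Ideal.span {δ * s δ} := by
      apply mul_left_cancel₀ (mul_ne_zero hI0 hsI0)
      rw [← Ideal.span_singleton_mul_span_singleton, ← Ideal.span_singleton_mul_span_singleton]
      calc I * I.map s * (Ideal.span {γ} * Ideal.span {s γ})
          = (I.map s * Ideal.span {γ}) * (I * Ideal.span {s γ}) := by ring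
        _ = (I * Ideal.span {δ}) * (I.map s * Ideal.span {s δ}) := by rw [r1, r2]
        _ = _ := by ring
    rw [Ideal.span_singleton_eq_span_singleton] at r3
    obtain ⟨e, he⟩ := r3
    have hγγ0 : γ * s γ ≠ 0 := mul_ne_zero hγ0 hsγ0
    have hefix : s (e : 𝓞 k) = e := by
      have := congrArg s he
      simp only [map_mul, hs.invol] at this
      apply mul_left_cancel₀ hγγ0
      rw [he]
      linear_combination this
    obtain ⟨ε, hε⟩ := aux_unit_fixed hs hinj e hefix
    have hεn : ε ∈ relUnitNormRange F k := by
      by_contra hεn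
      have hmul : ε * ε₀ ∈ relUnitNormRange F k := by
        rw [Subgroup.mul_mem_iff_of_index_two hidx]
        exact ⟨fun h => absurd h hεn, fun h => absurd h hε₀n⟩
      obtain ⟨u, hu⟩ := (hnr _).1 hmul
      rw [Units.val_mul, map_mul, hε] at hu
      apply hres (u * γ) δ hδ0
      rw [← he, map_mul]
      linear_combination (-(γ * s γ)) * hu
    obtain ⟨u, hu⟩ := (hnr _).1 hεn
    rw [hε] at hu
    obtain ⟨β', hβ'0, hβ'⟩ := hs.h90 δ (u * γ) hδ0 (mul_ne_zero (Units.ne_zero _) hγ0) (by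
      rw [← he, map_mul, hu]; ring)
    have hβs : Ideal.span {β'} ≠ ⊥ := by simpa using hβ'0
    have hJ : (I * Ideal.span {β'}).IsPrincipal := by
      apply hfinal
      · exact mul_ne_zero hI0 hβs
      · have hδs : Ideal.span {δ} ≠ ⊥ := by simpa using hδ0
        apply mul_right_cancel₀ hδs
        rw [Ideal.map_mul, hms]
        have h1 : Ideal.span {δ} * Ideal.span {s β'} = Ideal.span {γ} * Ideal.span {β'} := by
          rw [Ideal.span_singleton_mul_span_singleton, Ideal.span_singleton_mul_span_singleton,
            hβ', Ideal.span_singleton_eq_span_singleton]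
          exact ⟨u⁻¹, by
            have := Units.mul_inv u
            linear_combination (γ * β') * this⟩
        calc I.map s * Ideal.span {s β'} * Ideal.span {δ}
            = I.map s * (Ideal.span {δ} * Ideal.span {s β'}) := by ring
          _ = (I.map s * Ideal.span {γ}) * Ideal.span {β'} := by rw [h1]; ring
          _ = _ := by rw [← r1]; ring
      · rw [mul_pow, hγ]
        exact aux_princ_mul ⟨_, rfl⟩ (aux_princ_pow ⟨_, rfl⟩ _)
    exact aux_princ_cancel _ _ hβs ⟨_, rfl⟩ hJ
  by_contra hodd
  rw [Nat.not_odd_iff_even] at hodd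
  have h2 : 2 ∣ Fintype.card (ClassGroup (𝓞 k)) := hodd.two_dvd
  obtain ⟨x, hx⟩ := exists_prime_orderOf_dvd_card 2 h2
  obtain ⟨I, rfl⟩ := ClassGroup.mk0_surjective x
  have hx2 : (ClassGroup.mk0 I) ^ 2 = 1 := by rw [← hx]; exact pow_orderOf_eq_one _
  rw [← map_pow, ClassGroup.mk0_eq_one_iff] at hx2
  have hI := hall (I : Ideal (𝓞 k)) (nonZeroDivisors.ne_zero I.2) hx2
  have hI1 : ClassGroup.mk0 I = 1 := by
    rw [ClassGroup.mk0_eq_one_iff]; exact hI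
  rw [hI1, orderOf_one] at hx
  omega
end

section
/- Let F be a number field with odd class number and unit group E_F, and let K/F be a quadratic extension in which exactly one prime ideal 𝔭 ramifies (and which is unramified at all other finite primes and at all infinite places). Then K has odd class number, and every unit of F is the relative norm of a unit of K, i.e. E_F = N_{K/F}E_K. -/
open NumberField
open scoped Classical

section helpers

open Module

set_option linter.unusedSectionVars false

theorem aux_rank_nullity {X Y : Type*} [AddCommGroup X] [AddCommGroup Y] [Module.Finite ℤ X]
    (ψ : X →ₗ[ℤ] Y) :
    finrank ℤ (LinearMap.range ψ) + finrank ℤ (LinearMap.ker ψ) = finrank ℤ X := by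
  rw [← Submodule.finrank_quotient_add_finrank (LinearMap.ker ψ),
    ψ.quotKerEquivRange.finrank_eq]

theorem aux_fin_zero (X : Type*) [AddCommGroup X] [Module.Finite ℤ X] (n : ℕ) (hn : n ≠ 0)
    (h : ∀ x : X, n • x = 0) : finrank ℤ X = 0 := by
  rw [Module.finrank_eq_zero_iff_isTorsion]
  intro x
  refine ⟨⟨(n : ℤ), by simpa using hn⟩, ?_⟩
  have := h x
  simpa [Submonoid.smul_def] using this

theorem aux_fin_eq {X Y : Type*} [AddCommGroup X] [Module.Finite ℤ X] [AddCommGroup Y]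
    [Module.Finite ℤ Y] (φ : X →+ Y) (n : ℕ) (hn : n ≠ 0)
    (h1 : ∀ x, φ x = 0 → n • x = 0) (h2 : ∀ y, ∃ x, φ x = n • y) :
    finrank ℤ X = finrank ℤ Y := by
  let ψ : X →ₗ[ℤ] Y := φ.toIntLinearMap
  have a := aux_rank_nullity ψ
  have b := Submodule.finrank_quotient_add_finrank (LinearMap.range ψ)
  have c : finrank ℤ (LinearMap.ker ψ) = 0 := by
    apply aux_fin_zero _ n hn
    rintro ⟨x, hx⟩
    ext
    exact h1 x hx
  have d : finrank ℤ (Y ⧸ LinearMap.range ψ) = 0 := by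
    apply aux_fin_zero _ n hn
    intro y
    obtain ⟨y, rfl⟩ := Submodule.mkQ_surjective _ y
    rw [← map_nsmul]
    simp only [Submodule.mkQ_apply, Submodule.Quotient.mk_eq_zero]
    exact h2 y
  omega

theorem aux_index_nsmul_prod (X T : Type*) [AddCommGroup X] [Module.Finite ℤ X] [Module.Free ℤ X]
    [AddCommGroup T] [Finite T] :
    (nsmulAddMonoidHom (α := X × T) 2).range.index
      = 2 ^ finrank ℤ (X × T) * Nat.card (nsmulAddMonoidHom (α := X × T) 2).ker := by
  have h1 : finrank ℤ (X × T) = finrank ℤ X := by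
    apply aux_fin_eq (AddMonoidHom.fst X T) (Nat.card T) Nat.card_pos.ne'
    · rintro ⟨x, t⟩ h
      simp at h
      subst h
      ext
      · simp
      · simp
    · intro y; exact ⟨(Nat.card T • y, 0), rfl⟩
  have h2 : (nsmulAddMonoidHom (α := X × T) 2).range =
      (nsmulAddMonoidHom (α := X) 2).range.prod (nsmulAddMonoidHom (α := T) 2).range := by
    ext ⟨x, t⟩
    simp [AddSubgroup.mem_prod, Prod.ext_iff]
  have h3 : Nat.card (nsmulAddMonoidHom (α := X × T) 2).ker
      = Nat.card (nsmulAddMonoidHom (α := T) 2).ker := by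
    apply Nat.card_congr
    refine ⟨fun z => ⟨z.1.2, ?_⟩, fun z => ⟨(0, z.1), ?_⟩, ?_, ?_⟩
    · have := z.2
      simp only [AddMonoidHom.mem_ker, nsmulAddMonoidHom_apply, Prod.ext_iff] at this ⊢
      exact this.2
    · have := z.2
      simp only [AddMonoidHom.mem_ker, nsmulAddMonoidHom_apply, Prod.ext_iff] at this ⊢
      exact ⟨by simp, this⟩
    · rintro ⟨⟨x, t⟩, h⟩
      simp only [AddMonoidHom.mem_ker, nsmulAddMonoidHom_apply, Prod.ext_iff] at h
      have h1 : (2 : ℤ) • x = 0 := by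
        have := h.1
        rw [← natCast_zsmul] at this
        exact this
      have : x = 0 := (smul_eq_zero.mp h1).resolve_left two_ne_zero
      simp [this]
    · intro z; rfl
  rw [h1, h2, h3, AddSubgroup.index_prod, AddSubgroup.index_range_nsmul, AddSubgroup.index_range]

theorem aux_index_nsmul (A : Type*) [AddCommGroup A] [Module.Finite ℤ A] :
    (nsmulAddMonoidHom (α := A) 2).range.index
      = 2 ^ finrank ℤ A * Nat.card (nsmulAddMonoidHom (α := A) 2).ker := by
  have hG : AddGroup.FG A := Module.Finite.iff_addGroup_fg.mp inferInstance
  obtain ⟨n, ι, fι, p, hp, e, ⟨f⟩⟩ := AddCommGroup.equiv_free_prod_directSum_zmod A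
  have : ∀ i, NeZero (p i ^ e i) := fun i => ⟨pow_ne_zero _ (hp i).ne_zero⟩
  have : Finite (DirectSum ι fun i => ZMod (p i ^ e i)) :=
    Finite.of_equiv _ (DirectSum.addEquivProd _).symm.toEquiv
  have h := aux_index_nsmul_prod (Fin n →₀ ℤ) (DirectSum ι fun i => ZMod (p i ^ e i))
  rw [← LinearEquiv.finrank_eq f.toIntLinearEquiv] at h
  rw [← AddEquiv.map_range_nsmulAddMonoidHom f, AddSubgroup.index_map_equiv] at h
  rw [h]
  congr 1
  apply Nat.card_congr
  refine ⟨fun z => ⟨f.symm z.1, ?_⟩, fun z => ⟨f z.1, ?_⟩, ?_, ?_⟩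
  · have := z.2
    simp only [AddMonoidHom.mem_ker, nsmulAddMonoidHom_apply] at this ⊢
    rw [← map_nsmul, this, map_zero]
  · have := z.2
    simp only [AddMonoidHom.mem_ker, nsmulAddMonoidHom_apply] at this ⊢
    rw [← map_nsmul, this, map_zero]
  · intro z; simp
  · intro z; simp

section
variable {M : Type*} [AddCommGroup M] [Module.Finite ℤ M]

theorem aux_fin_sub (H : AddSubgroup M) : Module.Finite ℤ H :=
  inferInstanceAs (Module.Finite ℤ H.toIntSubmodule)

theorem aux_finrank_ker (s : M →+ M) (hs : ∀ x, s (s x) = x) :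
    finrank ℤ (AddMonoidHom.id M + s).ker + finrank ℤ (AddMonoidHom.id M - s).ker = finrank ℤ M := by
  set f := AddMonoidHom.id M + s with hf
  set g := AddMonoidHom.id M - s with hg
  have f_ap : ∀ x, f x = x + s x := fun x => rfl
  have g_ap : ∀ x, g x = x - s x := fun x => rfl
  have := aux_fin_sub g.ker
  have := aux_fin_sub f.ker
  have := aux_fin_sub f.range
  have a := aux_rank_nullity f.toIntLinearMap
  have b : finrank ℤ g.ker = finrank ℤ f.range := by
    have h2 : ∀ x, g x = 0 → f x = 2 • x := by
      intro x hx; rw [g_ap, sub_eq_zero] at hx; rw [f_ap, ← hx, two_nsmul]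
    apply aux_fin_eq (f.rangeRestrict.comp g.ker.subtype) 2 two_ne_zero
    · rintro ⟨x, hx⟩ h
      ext
      have := congrArg Subtype.val h
      change 2 • x = 0
      rw [← h2 x hx]
      exact this
    · rintro ⟨_, y, rfl⟩
      refine ⟨⟨f y, ?_⟩, ?_⟩
      · change g _ = 0
        simp [f_ap, g_ap, hs, add_comm]
      · ext
        change f (f y) = 2 • f y
        simp only [f_ap, hs, two_nsmul, map_add]
        abel
  have c : finrank ℤ f.range = finrank ℤ (LinearMap.range f.toIntLinearMap) := rfl
  have d : finrank ℤ f.ker = finrank ℤ (LinearMap.ker f.toIntLinearMap) := rfl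
  omega

/-- common half of the Herbrand computation -/
theorem aux_half {M : Type*} [AddCommGroup M] (f g : M →+ M) (hfg : ∀ x, g (f x) = 0) (h2 : ∀ x, g x = 0 → f x = 2 • x) :
    (nsmulAddMonoidHom (α := g.ker) 2).range.index
      = f.range.relIndex g.ker * (f.ker ⊔ g.ker).index := by
  have h1 : (nsmulAddMonoidHom (α := g.ker) 2).range.index
      = ((f.ker ⊔ g.ker).map f).relIndex g.ker := by
    rw [AddSubgroup.relIndex]
    congr 1
    ext ⟨x, hx⟩
    simp only [AddMonoidHom.mem_range, AddSubgroup.mem_addSubgroupOf, AddSubgroup.mem_map,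
      AddSubgroup.mem_sup]
    constructor
    · rintro ⟨⟨y, hy⟩, h⟩
      refine ⟨y, ⟨0, by simp, y, hy, by simp⟩, ?_⟩
      have := congrArg Subtype.val h
      simp at this
      rw [h2 y hy, this]
    · rintro ⟨_, ⟨a, ha, b, hb, rfl⟩, h⟩
      refine ⟨⟨b, hb⟩, ?_⟩
      ext
      simp
      rw [← h, map_add, ha, zero_add, h2 b hb]
  have h3 : (f.ker ⊔ g.ker).index = ((f.ker ⊔ g.ker).map f).relIndex f.range := by
    rw [← AddSubgroup.relIndex_top_right, AddMonoidHom.range_eq_map, AddSubgroup.relIndex_map_map]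
    simp
  rw [h1, h3, mul_comm, AddSubgroup.relIndex_mul_relIndex]
  · rw [AddMonoidHom.range_eq_map]; exact AddSubgroup.map_mono le_top
  · rintro _ ⟨x, rfl⟩; exact hfg x

theorem aux_herbrand_s13 (s : M →+ M) (hs : ∀ x, s (s x) = x) (hs2 : ∀ x, 2 • x = 0 → s x = x)
    (k : ℕ) (hM : finrank ℤ M = 2 * k + 1)
    (hk : finrank ℤ (AddMonoidHom.id M - s).ker = k)
    (hind : ∀ a b, a + s a = 0 → b + s b = 0 → (∀ v, v - s v ≠ a) → (∀ v, v - s v ≠ b) →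
      ∃ v, v - s v = a + b) :
    (∃ u, u + s u = 0 ∧ ∀ v, v - s v ≠ u) ∧ ∀ x, s x = x → ∃ y, y + s y = x := by
  set f := AddMonoidHom.id M + s with hf
  set g := AddMonoidHom.id M - s with hg
  have f_ap : ∀ x, f x = x + s x := fun x => rfl
  have g_ap : ∀ x, g x = x - s x := fun x => rfl
  have e1 := aux_half f g (by intro x; simp [f_ap, g_ap, hs, add_comm])
    (by intro x hx; rw [g_ap, sub_eq_zero] at hx; rw [f_ap, ← hx, two_nsmul])
  have e2 := aux_half g f (by intro x; simp [f_ap, g_ap, hs])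
    (by intro x hx
        rw [f_ap, add_comm, add_eq_zero_iff_eq_neg] at hx
        rw [g_ap, hx, two_nsmul, sub_neg_eq_add])
  have := aux_fin_sub g.ker
  have := aux_fin_sub f.ker
  rw [aux_index_nsmul] at e1 e2
  have hfk : finrank ℤ f.ker = k + 1 := by
    have := aux_finrank_ker s hs
    rw [← hf, ← hg] at this; omega
  have hc : Nat.card (nsmulAddMonoidHom (α := f.ker) 2).ker
      = Nat.card (nsmulAddMonoidHom (α := g.ker) 2).ker := by
    have key : ∀ x : M, 2 • x = 0 → f x = 0 ∧ g x = 0 := by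
      intro x hx
      rw [f_ap, g_ap, hs2 x hx, ← two_nsmul]
      exact ⟨hx, sub_self _⟩
    have key2 : ∀ (H : AddSubgroup M) (z : (nsmulAddMonoidHom (α := H) 2).ker),
        2 • (z.1.1 : M) = 0 := by
      intro H z
      have := z.2
      simp only [AddMonoidHom.mem_ker, nsmulAddMonoidHom_apply] at this
      exact congrArg Subtype.val this
    apply Nat.card_congr
    refine ⟨fun z => ⟨⟨z.1.1, (key _ (key2 _ z)).2⟩, ?_⟩,
      fun z => ⟨⟨z.1.1, (key _ (key2 _ z)).1⟩, ?_⟩, ?_, ?_⟩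
    · have := key2 _ z
      simp only [AddMonoidHom.mem_ker, nsmulAddMonoidHom_apply]
      ext; exact this
    · have := key2 _ z
      simp only [AddMonoidHom.mem_ker, nsmulAddMonoidHom_apply]
      ext; exact this
    · intro z; rfl
    · intro z; rfl
  have hc0 : Nat.card (nsmulAddMonoidHom (α := f.ker) 2).ker ≠ 0 := by
    have := aux_fin_sub (nsmulAddMonoidHom (α := f.ker) 2).ker
    have : Finite (nsmulAddMonoidHom (α := f.ker) 2).ker := by
      apply Module.finite_of_fg_torsion
      intro x
      refine ⟨⟨2, by simp⟩, ?_⟩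
      have := x.2
      simp only [AddMonoidHom.mem_ker, nsmulAddMonoidHom_apply] at this
      ext1
      have e : ((0 : (nsmulAddMonoidHom (α := f.ker) 2).ker) : f.ker) = 0 := rfl
      rw [e, ← this]
      simp [Submonoid.smul_def, two_smul]
    exact Nat.card_pos.ne'
  rw [hk] at e1
  rw [hfk, hc, pow_succ, sup_comm] at e2
  rw [hc] at hc0
  set c := Nat.card (nsmulAddMonoidHom (α := g.ker) 2).ker
  set q := (f.ker ⊔ g.ker).index
  have hq : q ≠ 0 := by
    intro h; rw [h, mul_zero] at e1; simp [hc0] at e1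
  have key : g.range.relIndex f.ker = 2 * f.range.relIndex g.ker := by
    apply Nat.eq_of_mul_eq_mul_right (Nat.pos_of_ne_zero hq)
    rw [mul_assoc, ← e1, ← e2]; ring
  have hN0 : f.range.relIndex g.ker ≠ 0 := by
    intro h; rw [h, zero_mul] at e1; simp [hc0] at e1
  have hex : ∃ u, u + s u = 0 ∧ ∀ v, v - s v ≠ u := by
    by_contra! hcon
    have : g.range.relIndex f.ker = 1 := by
      rw [AddSubgroup.relIndex_eq_one]
      intro u hu
      exact hcon u hu
    omega
  refine ⟨hex, ?_⟩
  have h2 : g.range.relIndex f.ker ∣ 2 := by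
    obtain ⟨u, hu, hu'⟩ := hex
    rw [AddSubgroup.relIndex_dvd_two_iff]
    refine ⟨u, hu, fun b hb => ?_⟩
    by_cases hb' : ∃ v, v - s v = b
    · right; exact hb'
    · left; push Not at hb'
      exact hind b u hb hu hb' hu'
  have h3 : f.range.relIndex g.ker = 1 := by
    have := Nat.le_of_dvd two_pos h2
    omega
  rw [AddSubgroup.relIndex_eq_one] at h3
  intro x hx
  exact h3 (show g x = 0 by rw [g_ap, hx, sub_self])
end

section ideals
variable {A B : Type*} [CommRing A] [CommRing B] [IsDedekindDomain A] [IsDedekindDomain B]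
  [Algebra A B] [Module.Finite A B] [Module.IsTorsionFree A B]
  (s : B ≃ₐ[A] B)

theorem aux_map_map (hs : ∀ x, s (s x) = x) (I : Ideal B) : (I.map s).map s = I := by
  have h1 : ∀ J : Ideal B, J ≤ (J.map s).map s := fun J x hx => by
    rw [← hs x]; exact Ideal.mem_map_of_mem s (Ideal.mem_map_of_mem s hx)
  apply le_antisymm _ (h1 I)
  rw [Ideal.map_le_iff_le_comap, Ideal.map_le_iff_le_comap]
  intro x hx
  simp only [Ideal.mem_comap, hs]; exact hx

theorem aux_map_base (a : Ideal A) :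
    (a.map (algebraMap A B)).map s = a.map (algebraMap A B) := by
  apply le_antisymm
  · rw [Ideal.map_le_iff_le_comap, Ideal.map_le_iff_le_comap]
    intro x hx
    simp only [Ideal.mem_comap, s.commutes]
    exact Ideal.mem_map_of_mem _ hx
  · rw [Ideal.map_le_iff_le_comap]
    intro x hx
    rw [Ideal.mem_comap, ← s.commutes x]
    exact Ideal.mem_map_of_mem s (Ideal.mem_map_of_mem _ hx)

theorem aux_relNorm_one (C : Ideal B) (h : Ideal.relNorm A C = 1) : C = 1 := by
  have := Ideal.relNorm_le_comap A C
  rw [h, Ideal.one_eq_top, top_le_iff, Ideal.comap_eq_top_iff] at this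
  rw [this, Ideal.one_eq_top]

theorem aux_mul_map (h2 : finrank A B = 2)
    (hnorm : ∀ x, algebraMap A B (Algebra.intNorm A B x) = x * s x)
    (I : Ideal B) : I * I.map s = (Ideal.relNorm A I).map (algebraMap A B) := by
  by_cases hI : I = ⊥
  · subst hI; simp
  have hle : (Ideal.relNorm A I).map (algebraMap A B) ≤ I * I.map s := by
    rw [Ideal.map_relNorm, Ideal.span_le]
    rintro _ ⟨x, hx, rfl⟩
    simp only [Function.comp_apply, hnorm]
    exact Ideal.mul_mem_mul hx (Ideal.mem_map_of_mem s hx)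
  obtain ⟨C, hC⟩ := Ideal.dvd_iff_le.mpr hle
  have h3 := congrArg (Ideal.relNorm A) hC
  rw [Ideal.relNorm_algebraMap, h2, map_mul, map_mul, Ideal.relNorm_map_algEquiv, pow_two] at h3
  have h4 : Ideal.relNorm A I ≠ 0 := by
    rw [Ideal.zero_eq_bot, Ne, Ideal.relNorm_eq_bot_iff]; exact hI
  have h5 : Ideal.relNorm A C = 1 :=
    (mul_right_eq_self₀.mp h3.symm).resolve_right (mul_ne_zero h4 h4)
  rw [hC, aux_relNorm_one C h5, mul_one]

theorem aux_map_prime (Q : Ideal B) (hQ : Q.IsPrime) : (Q.map s).IsPrime :=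
  Ideal.map_isPrime_of_equiv s

theorem aux_ne_bot {a : Ideal A} (ha : a ≠ ⊥) : a.map (algebraMap A B) ≠ ⊥ := by
  rwa [Ne, Ideal.map_eq_bot_iff_of_injective (FaithfulSMul.algebraMap_injective A B)]

theorem aux_eq_of_dvd {P Q : Ideal B} (hP : P.IsPrime) (hQ : Q.IsPrime) (hP0 : P ≠ ⊥)
    (h : Q ∣ P) : Q = P :=
  ((hP.isMaximal hP0).eq_of_le hQ.ne_top (Ideal.dvd_iff_le.mp h)).symm

theorem aux_dvd_relNorm {Q : Ideal B} (hQ : Q.IsPrime) :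
    Q.comap (algebraMap A B) ∣ Ideal.relNorm A Q :=
  Ideal.dvd_iff_le.mpr (Ideal.relNorm_le_comap A Q)

theorem aux_ram (h2 : finrank A B = 2) {p : Ideal A} (hp : p.IsPrime) (hp0 : p ≠ ⊥) {P : Ideal B}
    (hP : P.IsPrime) (hPp : P ^ 2 ∣ p.map (algebraMap A B)) :
    P ^ 2 = p.map (algebraMap A B) ∧ P.map s = P ∧ P ≠ ⊥ := by
  have hP0 : P ≠ ⊥ := by
    rintro rfl
    have : p.map (algebraMap A B) = ⊥ := by
      rw [← Ideal.zero_eq_bot] at hPp ⊢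
      rw [zero_pow two_ne_zero] at hPp
      exact zero_dvd_iff.mp hPp
    exact aux_ne_bot hp0 this
  have hle : p.map (algebraMap A B) ≤ P :=
    Ideal.dvd_iff_le.mp ((dvd_pow_self P two_ne_zero).trans hPp)
  have hc : p = P.comap (algebraMap A B) :=
    (hp.isMaximal hp0).eq_of_le (Ideal.IsPrime.comap _).ne_top (Ideal.map_le_iff_le_comap.mp hle)
  have heq : P ^ 2 = p.map (algebraMap A B) := by
    obtain ⟨C, hC⟩ := hPp
    obtain ⟨D, hD⟩ := aux_dvd_relNorm (A := A) hP
    rw [← hc] at hD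
    have h3 := congrArg (Ideal.relNorm A) hC
    rw [Ideal.relNorm_algebraMap, h2, map_mul, map_pow, hD, mul_pow, mul_assoc] at h3
    have h4 : D ^ 2 * Ideal.relNorm A C = 1 :=
      (mul_right_eq_self₀.mp h3.symm).resolve_right (pow_ne_zero 2 hp0)
    have h5 : Ideal.relNorm A C = 1 := by
      have : IsUnit (Ideal.relNorm A C) := IsUnit.of_mul_eq_one _ ((mul_comm _ _).trans h4)
      rwa [Ideal.isUnit_iff, ← Ideal.one_eq_top] at this
    rw [hC, aux_relNorm_one C h5, mul_one]
  refine ⟨heq, ?_, hP0⟩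
  have h3 : P.map s ∣ P ^ 2 := by
    rw [heq, ← aux_map_base s p, ← heq]
    exact Ideal.dvd_iff_le.mpr (Ideal.map_mono (Ideal.pow_le_self two_ne_zero))
  have hsp := aux_map_prime s P hP
  have h4 : P ^ 2 ≤ P.map s := Ideal.dvd_iff_le.mp h3
  exact aux_eq_of_dvd hP hsp hP0 (Ideal.dvd_iff_le.mpr (hsp.le_of_pow_le h4))

theorem aux_unram (hs : ∀ x, s (s x) = x) (h2 : finrank A B = 2)
    (hnorm : ∀ x, algebraMap A B (Algebra.intNorm A B x) = x * s x)
    {Q : Ideal B} (hQ : Q.IsPrime) (hQ0 : Q ≠ ⊥)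
    (hu : ¬ Q ^ 2 ∣ (Q.comap (algebraMap A B)).map (algebraMap A B))
    {J : Ideal B} (hJ : J.map s = J) (hQJ : Q ∣ J) :
    (Q.comap (algebraMap A B)).map (algebraMap A B) ∣ J := by
  set q := Q.comap (algebraMap A B) with hq
  have hn := aux_mul_map s h2 hnorm Q
  obtain ⟨D, hD⟩ := aux_dvd_relNorm (A := A) hQ
  rw [← hq] at hD
  rw [hD, Ideal.map_mul] at hn
  have hpQ : Prime Q := Ideal.prime_of_isPrime hQ0 hQ
  by_cases hsQ : Q.map s = Q
  · rw [hsQ] at hn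
    obtain ⟨C, hC⟩ : Q ∣ q.map (algebraMap A B) := Ideal.dvd_iff_le.mpr Ideal.map_comap_le
    rw [hC] at hn hu ⊢
    have h3 : Q = C * D.map (algebraMap A B) := by
      rw [mul_assoc] at hn
      exact mul_left_cancel₀ hQ0 hn
    have hnC : ¬ Q ∣ C := by
      intro h; apply hu; rw [pow_two]; exact mul_dvd_mul_left Q h
    obtain ⟨X, hX⟩ := (hpQ.dvd_or_dvd (dvd_of_eq h3)).resolve_left hnC
    rw [hX] at h3
    have h4 : C * X = 1 := by
      have : Q * (C * X) = Q * 1 := by rw [mul_one]; conv_rhs => rw [h3]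
                                       ring
      exact mul_left_cancel₀ hQ0 this
    have h5 : C = 1 := by
      have : IsUnit C := IsUnit.of_mul_eq_one _ h4
      rwa [Ideal.isUnit_iff, ← Ideal.one_eq_top] at this
    rw [h5, mul_one]; exact hQJ
  · have h3 : Q.map s ∣ J := by
      rw [← hJ]; exact Ideal.dvd_iff_le.mpr (Ideal.map_mono (Ideal.dvd_iff_le.mp hQJ))
    have h4 : Q * Q.map s ∣ J := by
      obtain ⟨J', rfl⟩ := hQJ
      apply mul_dvd_mul_left
      have hsp := aux_map_prime s Q hQ
      have hsp0 : Q.map s ≠ ⊥ := by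
        intro h
        apply hQ0
        rw [← aux_map_map s hs Q, h, Ideal.map_bot]
      refine ((Ideal.prime_of_isPrime hsp0 hsp).dvd_or_dvd h3).resolve_left fun h => ?_
      exact hsQ (aux_eq_of_dvd hQ hsp hQ0 h)
    rw [hn] at h4
    exact (dvd_mul_right _ _).trans h4

theorem aux_decomp (hs : ∀ x, s (s x) = x) (h2 : finrank A B = 2)
    (hnorm : ∀ x, algebraMap A B (Algebra.intNorm A B x) = x * s x)
    {p : Ideal A} (hp : p.IsPrime) (hp0 : p ≠ ⊥) {P : Ideal B}
    (hP : P.IsPrime) (hPp : P ^ 2 ∣ p.map (algebraMap A B))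
    (hun : ∀ q : Ideal A, q.IsPrime → q ≠ ⊥ → q ≠ p →
      ∀ Q : Ideal B, Q.IsPrime → ¬ Q ^ 2 ∣ q.map (algebraMap A B))
    (J : Ideal B) : J ≠ ⊥ → J.map s = J →
    ∃ a : Ideal A, a ≠ ⊥ ∧ (J = a.map (algebraMap A B) ∨ J = P * a.map (algebraMap A B)) := by
  obtain ⟨hP2, hPs, hP0⟩ := aux_ram s h2 hp hp0 hP hPp
  induction J using IsNoetherian.induction with
  | hgt J ih =>
  intro hJ0 hJ
  by_cases hJt : J = ⊤
  · exact ⟨⊤, by simp, Or.inl (by rw [hJt, Ideal.map_top])⟩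
  obtain ⟨Q, hQm, hJQ⟩ := Ideal.exists_le_maximal J hJt
  have hQ := hQm.isPrime
  have hQ0 : Q ≠ ⊥ := by rintro rfl; exact hJ0 (le_bot_iff.mp hJQ)
  have hQJ : Q ∣ J := Ideal.dvd_iff_le.mpr hJQ
  have step : ∀ X J' : Ideal B, X ≠ ⊤ → X.map s = X → J = X * J' →
      J < J' ∧ J' ≠ ⊥ ∧ J'.map s = J' := by
    intro X J' hX hXs h
    have hX0 : X ≠ 0 := by rintro rfl; rw [zero_mul] at h; exact hJ0 h
    have hJ'0 : J' ≠ 0 := by rintro rfl; rw [mul_zero] at h; exact hJ0 h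
    refine ⟨lt_of_le_of_ne (h ▸ Ideal.mul_le_right) ?_, hJ'0, ?_⟩
    · intro h'
      rw [h'] at h
      have := (right_eq_mul₀ hJ'0).mp h
      exact hX (by rw [this, Ideal.one_eq_top])
    · rw [h, Ideal.map_mul, hXs] at hJ
      exact mul_left_cancel₀ hX0 hJ
  set q := Q.comap (algebraMap A B) with hq
  have hqp : q.IsPrime := Ideal.IsPrime.comap _
  have hq0 : q ≠ ⊥ := Ideal.IsIntegral.comap_ne_bot A hQ0
  have hqQ : q.map (algebraMap A B) ≤ Q := Ideal.map_comap_le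
  by_cases hqe : q = p
  · have hQP : Q = P := by
      have h3 : P ^ 2 ≤ Q := by rw [hP2, ← hqe]; exact hqQ
      exact aux_eq_of_dvd hP hQ hP0 (Ideal.dvd_iff_le.mpr (hQ.le_of_pow_le h3))
    rw [hQP] at hQJ
    obtain ⟨J', hJ'⟩ := hQJ
    obtain ⟨h3, h4, h5⟩ := step P J' hP.ne_top hPs hJ'
    obtain ⟨a, ha, h | h⟩ := ih J' h3 h4 h5
    · exact ⟨a, ha, Or.inr (by rw [hJ', h])⟩
    · refine ⟨p * a, mul_ne_zero hp0 ha, Or.inl ?_⟩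
      rw [hJ', h, Ideal.map_mul, ← hP2]; ring
  · have h3 := aux_unram s hs h2 hnorm hQ hQ0 (hun q hqp hq0 hqe Q hQ) hJ hQJ
    obtain ⟨J', hJ'⟩ := h3
    rw [← hq] at hJ'
    obtain ⟨h3, h4, h5⟩ := step _ J' (fun h => hQ.ne_top (top_le_iff.mp (h ▸ hqQ)))
      (aux_map_base s q) hJ'
    obtain ⟨a, ha, h | h⟩ := ih J' h3 h4 h5
    · exact ⟨q * a, mul_ne_zero hq0 ha, Or.inl (by rw [hJ', h, Ideal.map_mul])⟩
    · refine ⟨q * a, mul_ne_zero hq0 ha, Or.inr ?_⟩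
      rw [hJ', h, Ideal.map_mul]; ring
end ideals

section elems
open scoped nonZeroDivisors

theorem aux_princ {A : Type*} [CommRing A] [IsDedekindDomain A] (h : ℕ) (hh : Odd h)
    (I : Ideal A) (hI : I ≠ ⊥) (b x y : A) (hx : x ≠ 0)
    (h1 : I ^ 2 = Ideal.span {b}) (h3 : Ideal.span {x} * I ^ h = Ideal.span {y}) :
    ∃ d, I = Ideal.span {d} := by
  have hI' : I ∈ (Ideal A)⁰ := mem_nonZeroDivisors_of_ne_zero hI
  have e1 : (ClassGroup.mk0 ⟨I, hI'⟩) ^ 2 = 1 := by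
    rw [← map_pow]
    refine (ClassGroup.mk0_eq_one_iff (I := I ^ 2) (pow_mem hI' 2)).mpr ?_
    rw [h1]; exact ⟨⟨b, rfl⟩⟩
  have e2 : (ClassGroup.mk0 ⟨I, hI'⟩) ^ h = 1 := by
    have hx' : Ideal.span {x} ∈ (Ideal A)⁰ :=
      mem_nonZeroDivisors_of_ne_zero (by simpa using hx)
    have e3 : ClassGroup.mk0 ⟨Ideal.span {x}, hx'⟩ = 1 :=
      (ClassGroup.mk0_eq_one_iff hx').mpr ⟨⟨x, rfl⟩⟩
    have e4 : ClassGroup.mk0 (⟨Ideal.span {x}, hx'⟩ * ⟨I, hI'⟩ ^ h) = 1 := by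
      refine (ClassGroup.mk0_eq_one_iff (I := Ideal.span {x} * I ^ h)
        (mul_mem hx' (pow_mem hI' h))).mpr ?_
      rw [h3]; exact ⟨⟨y, rfl⟩⟩
    rwa [map_mul, map_pow, e3, one_mul] at e4
  have e5 : ClassGroup.mk0 ⟨I, hI'⟩ = 1 := by
    obtain ⟨m, rfl⟩ := hh
    rwa [pow_succ, pow_mul, e1, one_pow, one_mul] at e2
  obtain ⟨⟨d, hd⟩⟩ := (ClassGroup.mk0_eq_one_iff hI').mp e5
  exact ⟨d, hd⟩

variable {A B : Type*} [CommRing A] [CommRing B] [IsDedekindDomain A] [IsDedekindDomain B]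
  [Algebra A B] [Module.Finite A B] [Module.IsTorsionFree A B]
  (s : B ≃ₐ[A] B) (hs : ∀ x, s (s x) = x)

theorem aux_anti (hs : ∀ x, s (s x) = x) (hne : ∃ x, s x ≠ x) : ∃ x, x ≠ 0 ∧ s x = - x := by
  obtain ⟨x, hx⟩ := hne
  exact ⟨x - s x, fun h => hx (sub_eq_zero.mp h).symm, by simp [hs]⟩

theorem aux_gamma (hs : ∀ x, s (s x) = x) (hne : ∃ x, s x ≠ x) (a b : B) (ha : s a = a)
    (hab : b * s b = a * a) : ∃ γ, γ ≠ 0 ∧ b * γ = a * s γ := by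
  by_cases h : a + s b = 0
  · obtain ⟨x, hx, hx'⟩ := aux_anti s hs hne
    refine ⟨x, hx, ?_⟩
    have : b = - a := by
      have := congrArg s h
      rw [map_add, hs, ha, map_zero] at this
      exact (neg_eq_of_add_eq_zero_right this).symm
    rw [this, hx']; ring
  · refine ⟨_, h, ?_⟩
    rw [map_add, hs, ha, mul_add, hab]; ring

theorem aux_h90 (hs : ∀ x, s (s x) = x) (hne : ∃ x, s x ≠ x) (u : B) (hu : u * s u = 1) :
    ∃ α, α ≠ 0 ∧ α = u * s α := by
  obtain ⟨γ, h0, h⟩ := aux_gamma s hs hne 1 (s u) (by simp) (by rw [hs, mul_comm, hu, one_mul])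
  refine ⟨γ, h0, ?_⟩
  rw [one_mul] at h
  rw [← h, ← mul_assoc, hu, one_mul]

theorem aux_span_map (α : B) : (Ideal.span {α}).map s = Ideal.span {s α} := by
  rw [Ideal.map_span, Set.image_singleton]

theorem aux_triv (h : ℕ) (hh : Odd h)
    (hcl : ∀ a : Ideal A, a ≠ ⊥ → ∃ c, a ^ h = Ideal.span {c})
    (u : Bˣ) (hu : (u : B) * s u = 1) (α : B) (hα0 : α ≠ 0) (hα : α = u * s α)
    (a : Ideal A) (ha : a ≠ ⊥) (haα : Ideal.span {α} = a.map (algebraMap A B)) :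
    ∃ v : Bˣ, (v : B) = u * s v := by
  obtain ⟨c, hc⟩ := hcl a ha
  have h1 : Ideal.span {algebraMap A B c} = Ideal.span {α ^ h} := by
    rw [← Ideal.span_singleton_pow, haα, ← Ideal.map_pow, hc, Ideal.map_span, Set.image_singleton]
  rw [Ideal.span_singleton_eq_span_singleton] at h1
  obtain ⟨v, hv⟩ := h1
  have hc0 : algebraMap A B c ≠ 0 := by
    intro h0; rw [h0, zero_mul] at hv; exact pow_ne_zero h hα0 hv.symm
  have h2 : (v : B) = u ^ h * s v := by
    have h3 : α ^ h = u ^ h * s (α ^ h) := by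
      conv_lhs => rw [hα]
      rw [mul_pow, map_pow]
    rw [← hv, map_mul, s.commutes] at h3
    apply mul_left_cancel₀ hc0
    rw [h3]; ring
  obtain ⟨m, rfl⟩ := hh
  refine ⟨v * (u ^ m)⁻¹, ?_⟩
  have h4 : s ((u ^ m)⁻¹ : Bˣ) = ((u ^ m : Bˣ) : B) := by
    have h5 : s ((u ^ m : Bˣ) : B) * s (((u ^ m)⁻¹ : Bˣ) : B) = 1 := by
      rw [← map_mul, Units.mul_inv, map_one]
    have h6 : ((u ^ m : Bˣ) : B) * s ((u ^ m : Bˣ) : B) = 1 := by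
      rw [Units.val_pow_eq_pow_val, map_pow, ← mul_pow, hu, one_pow]
    calc s ((u ^ m)⁻¹ : Bˣ) = (((u ^ m : Bˣ) : B) * s ((u ^ m : Bˣ) : B)) * s ((u ^ m)⁻¹ : Bˣ) := by
          rw [h6, one_mul]
      _ = _ := by rw [mul_assoc, h5, mul_one]
  rw [Units.val_mul, map_mul, h4, ← Units.eq_mul_inv_iff_mul_eq, inv_inv] 
  conv_lhs => rw [h2]
  rw [Units.val_pow_eq_pow_val]; ring

section main
variable (h : ℕ) (hh : Odd h) (hcl : ∀ a : Ideal A, a ≠ ⊥ → ∃ c, a ^ h = Ideal.span {c})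
  (P : Ideal B) (p : Ideal A)
  (hdec : ∀ J : Ideal B, J ≠ ⊥ → J.map s = J → ∃ a : Ideal A, a ≠ ⊥ ∧
    (J = a.map (algebraMap A B) ∨ J = P * a.map (algebraMap A B)))

include hdec in
theorem aux_type (u : Bˣ) (α : B) (hα0 : α ≠ 0) (hα : α = u * s α) :
    ∃ a : Ideal A, a ≠ ⊥ ∧ (Ideal.span {α} = a.map (algebraMap A B) ∨
      Ideal.span {α} = P * a.map (algebraMap A B)) := by
  apply hdec
  · simpa using hα0
  · rw [aux_span_map, Ideal.span_singleton_eq_span_singleton]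
    refine ⟨u, ?_⟩
    rw [mul_comm]; exact hα.symm

include hh hcl hdec in
theorem aux_hind (hs : ∀ x, s (s x) = x) (hne : ∃ x, s x ≠ x) (hp0 : p ≠ ⊥)
    (hP2 : P ^ 2 = p.map (algebraMap A B)) (u w : Bˣ)
    (hu : (u : B) * s u = 1) (hw : (w : B) * s w = 1)
    (hu' : ∀ v : Bˣ, (v : B) ≠ u * s v) (hw' : ∀ v : Bˣ, (v : B) ≠ w * s v) :
    ∃ v : Bˣ, (v : B) = (u * w) * s v := by
  obtain ⟨α, hα0, hα⟩ := aux_h90 s hs hne u hu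
  obtain ⟨β, hβ0, hβ⟩ := aux_h90 s hs hne w hw
  obtain ⟨a, ha, ea | ea⟩ := aux_type s P hdec u α hα0 hα
  · obtain ⟨v, hv⟩ := aux_triv s h hh hcl u hu α hα0 hα a ha ea
    exact absurd hv (hu' v)
  obtain ⟨b, hb, eb | eb⟩ := aux_type s P hdec w β hβ0 hβ
  · obtain ⟨v, hv⟩ := aux_triv s h hh hcl w hw β hβ0 hβ b hb eb
    exact absurd hv (hw' v)
  have := aux_triv s h hh hcl (u * w) (by
    rw [Units.val_mul, map_mul]
    calc _ = ((u : B) * s u) * (w * s w) := by ring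
      _ = 1 := by rw [hu, hw, one_mul]) (α * β) (mul_ne_zero hα0 hβ0) (by
        rw [Units.val_mul, map_mul]
        conv_lhs => rw [hα, hβ]
        ring) (p * a * b) (mul_ne_zero (mul_ne_zero hp0 ha) hb) (by
        rw [← Ideal.span_singleton_mul_span_singleton, ea, eb, Ideal.map_mul, Ideal.map_mul, ← hP2]
        ring)
  simpa using this

include hh hcl hdec in
theorem aux_Pprinc (hs : ∀ x, s (s x) = x) (hne : ∃ x, s x ≠ x) 
    (u : Bˣ) (hu : (u : B) * s u = 1) 
    (hu' : ∀ v : Bˣ, (v : B) ≠ u * s v) :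
    ∃ x y : B, x ≠ 0 ∧ Ideal.span {x} * P ^ h = Ideal.span {y} := by
  obtain ⟨α, hα0, hα⟩ := aux_h90 s hs hne u hu
  obtain ⟨a, ha, ea | ea⟩ := aux_type s P hdec u α hα0 hα
  · obtain ⟨v, hv⟩ := aux_triv s h hh hcl u hu α hα0 hα a ha ea
    exact absurd hv (hu' v)
  obtain ⟨c, hc⟩ := hcl a ha
  have e : Ideal.span {algebraMap A B c} * P ^ h = Ideal.span {α ^ h} := by
    rw [← Ideal.span_singleton_pow, ea, mul_pow, ← Ideal.map_pow, hc, Ideal.map_span,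
      Set.image_singleton, mul_comm]
  refine ⟨_, _, ?_, e⟩
  intro h0
  rw [h0] at e
  have : Ideal.span {α ^ h} = ⊥ := by rw [← e]; simp
  rw [Ideal.span_singleton_eq_bot] at this
  exact pow_ne_zero h hα0 this

include hh hcl hdec in
theorem aux_two_torsion (hs : ∀ x, s (s x) = x) (hne : ∃ x, s x ≠ x)
    (hmul : ∀ I : Ideal B, I * I.map s = (Ideal.relNorm A I).map (algebraMap A B))
    (hH0 : ∀ w : Bˣ, s w = w → ∃ y : Bˣ, (y : B) * s y = w)
    (hP : ∃ x y : B, x ≠ 0 ∧ Ideal.span {x} * P ^ h = Ideal.span {y})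
    (I : Ideal B) (hI : I ≠ ⊥) (b : B) (hb : I ^ 2 = Ideal.span {b}) :
    ∃ d, I = Ideal.span {d} := by
  obtain ⟨a, ha⟩ : ∃ a, Ideal.relNorm A I = Ideal.span {a} := by
    have hn : Ideal.relNorm A I ≠ ⊥ := by rwa [Ne, Ideal.relNorm_eq_bot_iff]
    obtain ⟨c, hc⟩ := hcl _ hn
    refine aux_princ h hh _ hn (Algebra.intNorm A B b) 1 c one_ne_zero ?_ ?_
    · rw [← map_pow, hb, Ideal.relNorm_singleton]
    · rw [Ideal.span_singleton_one, ← Ideal.one_eq_top, one_mul, hc]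
  set a' := algebraMap A B a with ha'
  have hsa : s a' = a' := s.commutes a
  have hII : I * I.map s = Ideal.span {a'} := by
    rw [hmul, ha, Ideal.map_span, Set.image_singleton]
  have hb0 : b ≠ 0 := by
    rintro rfl
    apply pow_ne_zero 2 hI
    rw [hb]; simp
  obtain ⟨b', hb', hbb⟩ : ∃ b', I ^ 2 = Ideal.span {b'} ∧ b' * s b' = a' * a' := by
    have e : Ideal.span {b * s b} = Ideal.span {a' * a'} := by
      rw [← Ideal.span_singleton_mul_span_singleton, ← Ideal.span_singleton_mul_span_singleton,
        ← aux_span_map, ← hb, ← hII, Ideal.map_pow]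
      ring
    rw [Ideal.span_singleton_eq_span_singleton] at e
    obtain ⟨w, hw⟩ := e
    have hsb0 : s b ≠ 0 := by simpa using hb0
    have hsw : s w = w := by
      have := congrArg s hw
      rw [map_mul, map_mul, map_mul, hs, hsa, ← hw, mul_comm (s b) b] at this
      exact mul_left_cancel₀ (mul_ne_zero hb0 hsb0) this
    obtain ⟨y, hy⟩ := hH0 w hsw
    refine ⟨b * y, ?_, ?_⟩
    · rw [hb, Ideal.span_singleton_eq_span_singleton]
      exact ⟨y, rfl⟩
    · rw [← hw, ← hy, map_mul]; ring
  have hb'0 : Ideal.span {b'} ≠ 0 := by rw [← hb']; exact pow_ne_zero 2 hI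
  obtain ⟨γ, hγ0, hγ⟩ := aux_gamma s hs hne a' b' hsa hbb
  obtain ⟨x, y, hx, hxy⟩ := hP
  have hJ0 : Ideal.span {γ} * I ≠ ⊥ := mul_ne_zero (by simpa using hγ0) hI
  have hJs : (Ideal.span {γ} * I).map s = Ideal.span {γ} * I := by
    apply mul_left_cancel₀ hb'0
    rw [Ideal.map_mul, aux_span_map]
    calc Ideal.span {b'} * (Ideal.span {s γ} * I.map s)
        = Ideal.span {s γ} * I * (I * I.map s) := by rw [← hb']; ring
      _ = Ideal.span {a' * s γ} * I := by
          rw [hII, ← Ideal.span_singleton_mul_span_singleton]; ring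
      _ = _ := by rw [← hγ, ← Ideal.span_singleton_mul_span_singleton]; ring
  obtain ⟨c, hc0, hc⟩ := hdec _ hJ0 hJs
  obtain ⟨d, hd⟩ := hcl c hc0
  have hγh : γ ^ h ≠ 0 := pow_ne_zero h hγ0
  rcases hc with hc | hc
  · refine aux_princ h hh I hI b (γ ^ h) (algebraMap A B d) hγh hb ?_
    rw [← Ideal.span_singleton_pow, ← mul_pow, hc, ← Ideal.map_pow, hd, Ideal.map_span,
      Set.image_singleton]
  · refine aux_princ h hh I hI b (x * γ ^ h) (y * algebraMap A B d) (mul_ne_zero hx hγh) hb ?_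
    rw [← Ideal.span_singleton_mul_span_singleton, ← Ideal.span_singleton_pow, mul_assoc,
      ← mul_pow, hc, mul_pow, ← mul_assoc, hxy, ← Ideal.map_pow, hd, Ideal.map_span,
      Set.image_singleton, Ideal.span_singleton_mul_span_singleton]
end main
end elems

end helpers

theorem aux_places_s13 (F K : Type*) [Field F] [NumberField F] [Field K] [NumberField K] [Algebra F K]
    [IsGalois F K] (hinf : UnramifiedAtInfinitePlaces F K) : IsUnramifiedAtInfinitePlaces F K := by
  constructor
  intro w
  rw [InfinitePlace.isUnramified_iff]
  by_cases hc : (w.comap (algebraMap F K)).IsComplex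
  · exact Or.inr hc
  left
  rw [InfinitePlace.not_isComplex_iff_isReal] at hc
  obtain ⟨ψ, hψ⟩ := hinf (InfinitePlace.embedding_of_isReal hc)
  let ψ' : K →+* ℂ := Complex.ofRealHom.comp ψ
  have hreal : ComplexEmbedding.IsReal ψ' := by
    ext x
    simp [ψ', ComplexEmbedding.conjugate_coe_eq]
  have hcomap : (InfinitePlace.mk ψ').comap (algebraMap F K) = w.comap (algebraMap F K) := by
    rw [InfinitePlace.comap_mk, ← InfinitePlace.mk_embedding (w.comap (algebraMap F K))]
    congr 1
    ext x
    rw [← InfinitePlace.embedding_of_isReal_apply hc, ← hψ]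
    rfl
  obtain ⟨σ, hσ⟩ := InfinitePlace.exists_smul_eq_of_comap_eq hcomap
  rw [← hσ, InfinitePlace.isReal_smul_iff]
  exact ⟨ψ', hreal, rfl⟩

/-- The involution on `𝓞 K`. -/
theorem aux_invol (F K : Type*) [Field F] [NumberField F] [Field K] [NumberField K] [Algebra F K]
    [IsGalois F K] (hdeg : Module.finrank F K = 2) :
    ∃ s : 𝓞 K ≃ₐ[𝓞 F] 𝓞 K, (∀ x, s (s x) = x) ∧ (∃ x, s x ≠ x) ∧
      (∀ x, algebraMap (𝓞 F) (𝓞 K) (RingOfIntegers.norm F x) = x * s x) ∧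
      (∀ x, s x = x → ∃ a, algebraMap (𝓞 F) (𝓞 K) a = x) := by
  have hcard : Nat.card Gal(K/F) = 2 := by rw [IsGalois.card_aut_eq_finrank, hdeg]
  obtain ⟨σ, hσ⟩ : ∃ σ : Gal(K/F), σ ≠ 1 := by
    have : Nontrivial Gal(K/F) := Finite.one_lt_card_iff_nontrivial.mp (by omega)
    exact exists_ne 1
  have hall : ∀ τ : Gal(K/F), τ = 1 ∨ τ = σ := by
    intro τ
    by_contra! hcon
    have : ({1, σ, τ} : Finset Gal(K/F)).card = 3 := by
      rw [Finset.card_eq_three]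
      exact ⟨1, σ, τ, hσ.symm, hcon.1.symm, hcon.2.symm, rfl⟩
    have h2 := Finset.card_le_univ ({1, σ, τ} : Finset Gal(K/F))
    rw [← Nat.card_eq_fintype_card] at h2
    omega
  have hσσ : ∀ x, σ (σ x) = x := by
    intro x
    have : σ * σ = 1 := by
      rcases hall (σ * σ) with h | h
      · exact h
      · exact absurd (mul_eq_left.mp h) hσ
    exact DFunLike.congr_fun this x
  have huniv : (Finset.univ : Finset Gal(K/F)) = {1, σ} := by
    ext τ; simpa using hall τ
  have hfix : ∀ x : K, σ x = x → ∃ a : F, algebraMap F K a = x := by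
    intro x hx
    have := (IsGalois.mem_range_algebraMap_iff_fixed (F := F) (E := K) x).mpr (by
      intro τ
      rcases hall τ with rfl | rfl
      · rfl
      · exact hx)
    exact this
  let s := galRestrict (𝓞 F) F K (𝓞 K) σ
  have hs : ∀ x : 𝓞 K, ((s x : 𝓞 K) : K) = σ x := algebraMap_galRestrict_apply (𝓞 F) σ
  refine ⟨s, ?_, ?_, ?_, ?_⟩
  · intro x; ext; rw [hs, hs, hσσ]
  · by_contra! hcon
    apply hσ
    have : s = 1 := AlgEquiv.ext hcon
    exact (map_eq_one_iff _ (galRestrict (𝓞 F) F K (𝓞 K)).injective).mp this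
  · intro x; ext
    rw [RingOfIntegers.coe_algebraMap_norm, Algebra.norm_eq_prod_automorphisms, huniv,
      Finset.prod_pair hσ.symm]
    change (x : K) * σ x = (x : K) * ((s x : 𝓞 K) : K)
    rw [hs]
  · intro x hx
    obtain ⟨a, ha⟩ := hfix x (by rw [← hs, hx])
    have hint : IsIntegral ℤ a := by
      have : IsIntegral ℤ (algebraMap F K a) := by rw [ha]; exact x.2
      exact (isIntegral_algebraMap_iff (algebraMap F K).injective).mp this
    refine ⟨⟨a, hint⟩, ?_⟩
    ext
    exact ha
/-- If `F` has odd class number and `K/F` is a quadratic extension in which exactly one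
prime ideal `𝔭` ramifies (and no infinite place ramifies), then `K` has odd class
number and `E_F = N_{K/F} E_K`. -/

theorem odd_classNumber_of_one_ramified_prime
    (F : Type*) [Field F] [NumberField F]
    (hoddF : Odd (NumberField.classNumber F))
    (K : Type*) [Field K] [NumberField K] [Algebra F K]
    (hdeg : Module.finrank F K = 2)
    (𝔭 : Ideal (𝓞 F)) (hp : 𝔭.IsPrime) (hpne : 𝔭 ≠ ⊥)
    (hram : ∀ 𝔮 : Ideal (𝓞 F), 𝔮.IsPrime → 𝔮 ≠ ⊥ → (IsRamifiedIn F K 𝔮 ↔ 𝔮 = 𝔭))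
    (hinf : UnramifiedAtInfinitePlaces F K)
    : Odd (NumberField.classNumber K) ∧ relUnitNormRange F K = ⊤ := by
  have : Algebra.IsQuadraticExtension F K := ⟨hdeg⟩
  have : IsGalois F K := inferInstance
  obtain ⟨s, hs, hne, hnorm, hfix⟩ := aux_invol F K hdeg
  have hinj : Function.Injective (algebraMap (𝓞 F) (𝓞 K)) :=
    FaithfulSMul.algebraMap_injective _ _
  have hfin2 : Module.finrank (𝓞 F) (𝓞 K) = 2 := by
    rw [← hdeg]; exact (IsFractionRing.finrank_eq (𝓞 F) F (𝓞 K) K).symm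
  have hnorm' : ∀ x, algebraMap (𝓞 F) (𝓞 K) (Algebra.intNorm (𝓞 F) (𝓞 K) x) = x * s x := by
    intro x
    rw [← hnorm]
    congr 1
    ext
    rw [RingOfIntegers.coe_norm]
    exact Algebra.algebraMap_intNorm (K := F) (L := K) x
  obtain ⟨P, hP, hPp⟩ := (hram 𝔭 hp hpne).mpr rfl
  obtain ⟨hP2, -, -⟩ := aux_ram s hfin2 hp hpne hP hPp
  have hdec := aux_decomp s hs hfin2 hnorm' hp hpne hP hPp
    (fun q hq hq0 hqp Q hQ hd => hqp ((hram q hq hq0).mp ⟨Q, hQ, hd⟩))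
  set h := NumberField.classNumber F with hh
  have hcl : ∀ a : Ideal (𝓞 F), a ≠ ⊥ → ∃ c, a ^ h = Ideal.span {c} := by
    intro a ha
    have ha' : a ∈ nonZeroDivisors (Ideal (𝓞 F)) := mem_nonZeroDivisors_of_ne_zero ha
    have e1 : (ClassGroup.mk0 ⟨a, ha'⟩) ^ h = 1 := by
      rw [hh, NumberField.classNumber]; exact pow_card_eq_one
    rw [← map_pow] at e1
    obtain ⟨⟨d, hd⟩⟩ := (ClassGroup.mk0_eq_one_iff (I := a ^ h) (pow_mem ha' h)).mp e1
    exact ⟨d, hd⟩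
  -- the unit computation
  let sU : (𝓞 K)ˣ →* (𝓞 K)ˣ := Units.map (s : 𝓞 K →* 𝓞 K)
  have hsU : ∀ u : (𝓞 K)ˣ, ((sU u : (𝓞 K)ˣ) : 𝓞 K) = s u := fun u => rfl
  have hrank : NumberField.Units.rank K = 2 * NumberField.Units.rank F + 1 := by
    have := aux_places_s13 F K hinf
    have e := IsUnramifiedAtInfinitePlaces.card_infinitePlace F K
    have e0 : 0 < Fintype.card (InfinitePlace F) := Fintype.card_pos
    rw [NumberField.Units.rank, NumberField.Units.rank]
    rw [hdeg] at e
    omega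
  have hsub : ∀ u v : (𝓞 K)ˣ, v * (sU v)⁻¹ = u ↔ (v : 𝓞 K) = u * s v := by
    intro u v
    rw [mul_inv_eq_iff_eq_mul, Units.ext_iff]; rfl
  obtain ⟨⟨u, hu, hu'⟩, hH0⟩ := aux_herbrand_s13 (M := Additive (𝓞 K)ˣ) sU.toAdditive
    (by intro x; apply Additive.toMul.injective; ext1; exact hs _)
    (by
      intro x hx
      have hx2 : ((x.toMul : (𝓞 K)ˣ) : 𝓞 K) * x.toMul = 1 := by
        have : x.toMul * x.toMul = 1 := by
          rw [two_nsmul] at hx; exact hx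
        exact congrArg Units.val this
      apply Additive.toMul.injective; ext1
      change s x.toMul = x.toMul
      rcases mul_self_eq_one_iff.mp hx2 with h1 | h1 <;> rw [h1] <;> simp)
    (NumberField.Units.rank F)
    (by rw [NumberField.Units.finrank_eq, hrank])
    (by
      rw [← NumberField.Units.finrank_eq F]
      have := aux_fin_sub (AddMonoidHom.id (Additive (𝓞 K)ˣ) - sU.toAdditive).ker
      symm
      let i : (𝓞 F)ˣ →* (𝓞 K)ˣ := Units.map (algebraMap (𝓞 F) (𝓞 K))
      have hi : ∀ t, sU (i t) = i t := by
        intro t; ext1; exact s.commutes _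
      refine aux_fin_eq (i.toAdditive.codRestrict _ ?_) 1 one_ne_zero ?_ ?_
      · intro x
        change i.toAdditive x - sU.toAdditive (i.toAdditive x) = 0
        rw [sub_eq_zero]
        exact (hi x.toMul).symm
      · intro x hx
        rw [one_smul]
        have h1 : i x.toMul = 1 := congrArg Subtype.val hx
        apply Additive.toMul.injective
        ext1
        apply hinj
        have := congrArg Units.val h1
        simpa [i] using this
      · rintro ⟨y, hy⟩
        have hy1 : s y.toMul = (y.toMul : (𝓞 K)ˣ) := by
          have : y - sU.toAdditive y = 0 := hy
          rw [sub_eq_zero] at this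
          exact (congrArg Units.val (congrArg Additive.toMul this)).symm
        have hy2 : s ((y.toMul⁻¹ : (𝓞 K)ˣ) : 𝓞 K) = ((y.toMul⁻¹ : (𝓞 K)ˣ) : 𝓞 K) := by
          have e : sU y.toMul = y.toMul := Units.ext hy1
          have : sU (y.toMul⁻¹) = y.toMul⁻¹ := by rw [map_inv, e]
          exact congrArg Units.val this
        obtain ⟨a, ha⟩ := hfix _ hy1
        obtain ⟨b, hb⟩ := hfix _ hy2
        have hab : a * b = 1 := by
          apply hinj; rw [map_mul, ha, hb, map_one, Units.mul_inv]
        refine ⟨Additive.ofMul ⟨a, b, hab, by rw [mul_comm, hab]⟩, ?_⟩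
        rw [one_smul]
        ext1
        apply Additive.toMul.injective
        ext1
        exact ha)
    (by
      intro a b ha hb ha' hb'
      obtain ⟨v, hv⟩ := aux_hind s h hoddF hcl P 𝔭 hdec hs hne hpne hP2 a.toMul b.toMul
        (congrArg Units.val (congrArg Additive.toMul ha))
        (congrArg Units.val (congrArg Additive.toMul hb))
        (fun v hv => ha' (Additive.ofMul v) (by
          rw [sub_eq_add_neg]; exact (hsub _ v).mpr hv))
        (fun v hv => hb' (Additive.ofMul v) (by
          rw [sub_eq_add_neg]; exact (hsub _ v).mpr hv))
      refine ⟨Additive.ofMul v, ?_⟩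
      rw [sub_eq_add_neg]; exact (hsub (a.toMul * b.toMul) v).mpr hv)
  have hPr := aux_Pprinc s h hoddF hcl P hdec hs hne u.toMul
    (congrArg Units.val (congrArg Additive.toMul hu))
    (fun v hv => hu' (Additive.ofMul v) (by
          rw [sub_eq_add_neg]; exact (hsub _ v).mpr hv))
  have hH0' : ∀ w : (𝓞 K)ˣ, s w = w → ∃ y : (𝓞 K)ˣ, (y : 𝓞 K) * s y = w := by
    intro w hw
    obtain ⟨y, hy⟩ := hH0 (Additive.ofMul w) (by
      apply Additive.toMul.injective; ext1; exact hw)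
    exact ⟨y.toMul, congrArg Units.val (congrArg Additive.toMul hy)⟩
  constructor
  · by_contra hodd
    rw [Nat.not_odd_iff_even] at hodd
    have h2 : 2 ∣ Fintype.card (ClassGroup (𝓞 K)) := hodd.two_dvd
    have : Fact (Nat.Prime 2) := ⟨Nat.prime_two⟩
    obtain ⟨c, hc⟩ := exists_prime_orderOf_dvd_card 2 h2
    obtain ⟨⟨I, hI⟩, rfl⟩ := ClassGroup.mk0_surjective c
    have hc2 := pow_orderOf_eq_one (ClassGroup.mk0 ⟨I, hI⟩)
    rw [hc, ← map_pow] at hc2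
    obtain ⟨⟨b, hb⟩⟩ := (ClassGroup.mk0_eq_one_iff (I := I ^ 2) (pow_mem hI 2)).mp hc2
    obtain ⟨d, hd⟩ := aux_two_torsion s h hoddF hcl P hdec hs hne
      (aux_mul_map s hfin2 hnorm') hH0' hPr I (nonZeroDivisors.ne_zero hI) b hb
    have : ClassGroup.mk0 ⟨I, hI⟩ = 1 := (ClassGroup.mk0_eq_one_iff hI).mpr ⟨⟨d, hd⟩⟩
    rw [this, orderOf_one] at hc
    omega
  · rw [eq_top_iff]
    intro t _
    obtain ⟨y, hy⟩ := hH0' (Units.map (algebraMap (𝓞 F) (𝓞 K)) t) (s.commutes _)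
    refine ⟨y, ?_⟩
    ext1
    apply hinj
    change algebraMap (𝓞 F) (𝓞 K) (RingOfIntegers.norm F (y : 𝓞 K)) = _
    rw [hnorm, hy]; rfl
end
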